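/- arXiv:2010.12524 — 3 statements merged into one kernel-verified Lean document; each statement's English description precedes it below -/
import Mathlib

section
/- For every p > 0 there exists a constant C > 0, depending only on n, Λ and p, with the following property. For every solution φ, every x₀ and every s ∈ (0,1) with B_s(x₀) ⊆ B₁, setting v = φ − inf_{B_s(x₀)} φ, one has sup_{B_{s/2}(x₀)} v ≤ C e^{2Λκ} [ s^{−n/p} (∫_{B_s(x₀)} v^p dx)^{1/p} + s² ]. -/
open MeasureTheory Metric Real Set

/-- A (weak) solution of the quasilinear elliptic equation
`-∂ⱼ(aᵢⱼ(x,φ)∂ᵢφ) = ρ(x,φ)[1 - (1/2) f e^φ + F(x,φ,∇φ)]` on the unit ball `B₁ ⊆ ℝⁿ`,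
which is continuously differentiable and satisfies `0 ≤ φ ≤ κ`. -/
def IsSolution (n : ℕ) (κ : ℝ)
    (a : Fin n → Fin n → EuclideanSpace ℝ (Fin n) → ℝ → ℝ)
    (ρ : EuclideanSpace ℝ (Fin n) → ℝ → ℝ)
    (f : EuclideanSpace ℝ (Fin n) → ℝ)
    (F : EuclideanSpace ℝ (Fin n) → ℝ → EuclideanSpace ℝ (Fin n) → ℝ)
    (φ : EuclideanSpace ℝ (Fin n) → ℝ) : Prop :=
  ContDiffOn ℝ 1 φ (ball (0 : EuclideanSpace ℝ (Fin n)) 1) ∧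
  (∀ x ∈ ball (0 : EuclideanSpace ℝ (Fin n)) 1, 0 ≤ φ x ∧ φ x ≤ κ) ∧
  ∀ ψ : EuclideanSpace ℝ (Fin n) → ℝ,
    ContDiff ℝ (⊤ : ℕ∞) ψ → HasCompactSupport ψ →
    tsupport ψ ⊆ ball (0 : EuclideanSpace ℝ (Fin n)) 1 →
    (∫ x in ball (0 : EuclideanSpace ℝ (Fin n)) 1,
        ∑ i : Fin n, ∑ j : Fin n,
          a i j x (φ x) * fderiv ℝ φ x (EuclideanSpace.single i 1) *
            fderiv ℝ ψ x (EuclideanSpace.single j 1))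
      = ∫ x in ball (0 : EuclideanSpace ℝ (Fin n)) 1,
          ρ x (φ x) * (1 - (1/2) * f x * Real.exp (φ x) + F x (φ x) (gradient φ x)) * ψ x

/-- Structural assumptions on the coefficients: symmetry and `Λ`-ellipticity of `aᵢⱼ`,
`1/2 ≤ ρ ≤ 2`, `0 ≤ f ≤ 1`, the natural growth bound `|F(x,z,p)| ≤ |p|² + 1`,
and continuity of all coefficients. -/
def GoodCoeffs (n : ℕ) (Λ : ℝ)
    (a : Fin n → Fin n → EuclideanSpace ℝ (Fin n) → ℝ → ℝ)
    (ρ : EuclideanSpace ℝ (Fin n) → ℝ → ℝ)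
    (f : EuclideanSpace ℝ (Fin n) → ℝ)
    (F : EuclideanSpace ℝ (Fin n) → ℝ → EuclideanSpace ℝ (Fin n) → ℝ) : Prop :=
  (∀ i j, ContinuousOn (fun p : EuclideanSpace ℝ (Fin n) × ℝ => a i j p.1 p.2)
      ((ball (0 : EuclideanSpace ℝ (Fin n)) 1) ×ˢ (Set.univ : Set ℝ))) ∧
  (∀ i j x z, a i j x z = a j i x z) ∧
  (∀ x ∈ ball (0 : EuclideanSpace ℝ (Fin n)) 1, ∀ z : ℝ, ∀ ξ : EuclideanSpace ℝ (Fin n),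
      Λ⁻¹ * ‖ξ‖ ^ 2 ≤ ∑ i : Fin n, ∑ j : Fin n, a i j x z * ξ i * ξ j ∧
      ∑ i : Fin n, ∑ j : Fin n, a i j x z * ξ i * ξ j ≤ Λ * ‖ξ‖ ^ 2) ∧
  ContinuousOn (fun p : EuclideanSpace ℝ (Fin n) × ℝ => ρ p.1 p.2)
      ((ball (0 : EuclideanSpace ℝ (Fin n)) 1) ×ˢ (Set.univ : Set ℝ)) ∧
  (∀ x ∈ ball (0 : EuclideanSpace ℝ (Fin n)) 1, ∀ z : ℝ, 1/2 ≤ ρ x z ∧ ρ x z ≤ 2) ∧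
  ContinuousOn f (ball (0 : EuclideanSpace ℝ (Fin n)) 1) ∧
  (∀ x ∈ ball (0 : EuclideanSpace ℝ (Fin n)) 1, 0 ≤ f x ∧ f x ≤ 1) ∧
  ContinuousOn (fun p : EuclideanSpace ℝ (Fin n) × ℝ × EuclideanSpace ℝ (Fin n) =>
      F p.1 p.2.1 p.2.2)
      ((ball (0 : EuclideanSpace ℝ (Fin n)) 1) ×ˢ
        (Set.univ : Set (ℝ × EuclideanSpace ℝ (Fin n)))) ∧
  (∀ x ∈ ball (0 : EuclideanSpace ℝ (Fin n)) 1, ∀ (z : ℝ) (p : EuclideanSpace ℝ (Fin n)),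
      |F x z p| ≤ ‖p‖ ^ 2 + 1)


/-! ### Auxiliary calculus -/

lemma posPow_hasDerivAt (m : ℕ) (t : ℝ) :
    HasDerivAt (fun s : ℝ => max s 0 ^ (m + 2)) (((m : ℝ) + 2) * max t 0 ^ (m + 1)) t := by
  refine hasDerivAt_of_hasDerivAt_of_ne' (x := 0) (g := fun t => ((m : ℝ) + 2) * max t 0 ^ (m + 1))
    ?_ ?_ ?_ t
  · intro y hy
    rcases lt_or_gt_of_ne hy with h | h
    · have : (fun s : ℝ => max s 0 ^ (m + 2)) =ᶠ[nhds y] fun _ => (0:ℝ) := by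
        filter_upwards [Iio_mem_nhds h] with s hs
        have hs' : s < 0 := hs
        simp [max_eq_right hs'.le]
      have h2 := (hasDerivAt_const y (0:ℝ)).congr_of_eventuallyEq this
      simpa [max_eq_right h.le] using h2
    · have : (fun s : ℝ => max s 0 ^ (m + 2)) =ᶠ[nhds y] fun s => s ^ (m + 2) := by
        filter_upwards [Ioi_mem_nhds h] with s hs
        have hs' : 0 < s := hs
        simp [max_eq_left hs'.le]
      have h2 := (hasDerivAt_pow (m + 2) y).congr_of_eventuallyEq this
      simpa [max_eq_left h.le] using h2
  · fun_prop
  · fun_prop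

lemma posPow_contDiff (m : ℕ) : ContDiff ℝ 1 (fun s : ℝ => max s 0 ^ (m + 2)) := by
  rw [contDiff_one_iff_deriv]
  refine ⟨fun t => (posPow_hasDerivAt m t).differentiableAt, ?_⟩
  have : deriv (fun s : ℝ => max s 0 ^ (m + 2)) = fun t => ((m : ℝ) + 2) * max t 0 ^ (m + 1) := by
    ext t
    exact (posPow_hasDerivAt m t).deriv
  rw [this]
  fun_prop

/-- Sobolev inequality in `L¹` form combined with the Hoelder inequality on a set of finite measure. -/
lemma sobolev_set (n : ℕ) (hn : 2 ≤ n) :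
    ∃ C > (0:ℝ), ∀ u : EuclideanSpace ℝ (Fin n) → ℝ, ContDiff ℝ 1 u → HasCompactSupport u →
      (∀ x, 0 ≤ u x) → ∀ A : Set (EuclideanSpace ℝ (Fin n)), MeasurableSet A → volume A ≠ ⊤ →
      (∀ x, x ∉ A → u x = 0) →
      (∫ x, u x) ^ n ≤ C * (∫ x, ‖fderiv ℝ u x‖) ^ n * (volume A).toReal := by
  have hn1 : (1:ℝ) < n := by exact_mod_cast (by omega : 1 < n)
  have hn1' : (1:NNReal) < n := by exact_mod_cast (by omega : 1 < n)
  set q : NNReal := NNReal.conjExponent n with hq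
  have hconj : NNReal.HolderConjugate n q := NNReal.HolderConjugate.conjExponent hn1'
  have hconj' : NNReal.HolderConjugate
      (Module.finrank ℝ (EuclideanSpace ℝ (Fin n))) q := by simpa using hconj
  set c : NNReal := eLpNormLESNormFDerivOneConst
    (volume : Measure (EuclideanSpace ℝ (Fin n))) q with hc
  refine ⟨((c:ℝ) + 1) ^ n, by positivity, ?_⟩
  intro u hu hcs hpos A hA hAfin hzero
  have h1 : eLpNorm u q volume ≤ c * eLpNorm (fderiv ℝ u) 1 volume :=
    eLpNorm_le_eLpNorm_fderiv_one volume hu hcs hconj'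
  have hui : Integrable u := hu.continuous.integrable_of_hasCompactSupport hcs
  have hdi : Integrable (fderiv ℝ u) :=
    (hu.continuous_fderiv one_ne_zero).integrable_of_hasCompactSupport (hcs.fderiv ℝ)
  have h2 : eLpNorm u 1 volume = eLpNorm u 1 (volume.restrict A) := by
    symm
    apply eLpNorm_restrict_eq_of_support_subset
    intro x hx
    by_contra h
    exact hx (hzero x h)
  have hq1 : (1 : ENNReal) ≤ (q : ENNReal) := by
    exact_mod_cast hconj.symm.lt.le
  have h3 : eLpNorm u 1 (volume.restrict A) ≤ eLpNorm u q (volume.restrict A) *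
      (volume.restrict A) Set.univ ^ (1 / (1:ENNReal).toReal - 1 / (q:ENNReal).toReal) :=
    eLpNorm_le_eLpNorm_mul_rpow_measure_univ hq1 hu.continuous.aestronglyMeasurable
  have hexp : 1 / (1:ENNReal).toReal - 1 / (q:ENNReal).toReal = 1 / (n:ℝ) := by
    have := hconj.coe.inv_add_inv_eq_one
    simp only [ENNReal.toReal_one, ENNReal.coe_toReal, one_div, inv_one]
    simp only [NNReal.coe_natCast] at this
    linarith
  rw [hexp, Measure.restrict_apply_univ] at h3
  have h4 : eLpNorm u 1 volume ≤ c * eLpNorm (fderiv ℝ u) 1 volume * volume A ^ (1 / (n:ℝ)) := by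
    rw [h2]
    refine h3.trans ?_
    gcongr
    exact (eLpNorm_mono_measure u Measure.restrict_le_self).trans h1
  have e1 : eLpNorm u 1 volume = ENNReal.ofReal (∫ x, u x) := by
    rw [eLpNorm_one_eq_lintegral_enorm, ← ofReal_integral_norm_eq_lintegral_enorm hui]
    congr 1
    refine integral_congr_ae (Filter.Eventually.of_forall fun x => ?_)
    simp [abs_of_nonneg (hpos x)]
  have e2 : eLpNorm (fderiv ℝ u) 1 volume = ENNReal.ofReal (∫ x, ‖fderiv ℝ u x‖) := by
    rw [eLpNorm_one_eq_lintegral_enorm, ← ofReal_integral_norm_eq_lintegral_enorm hdi]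
  rw [e1, e2] at h4
  have hn0 : (0:ℝ) ≤ ∫ x, u x := integral_nonneg hpos
  have hn0' : (0:ℝ) ≤ ∫ x, ‖fderiv ℝ u x‖ := integral_nonneg fun x => norm_nonneg _
  have hfin : (c:ENNReal) * ENNReal.ofReal (∫ x, ‖fderiv ℝ u x‖) * volume A ^ (1 / (n:ℝ)) ≠ ⊤ := by
    apply ENNReal.mul_ne_top (ENNReal.mul_ne_top ENNReal.coe_ne_top ENNReal.ofReal_ne_top)
    exact ENNReal.rpow_ne_top_of_nonneg (by positivity) hAfin
  have h5 := ENNReal.toReal_mono hfin h4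
  rw [ENNReal.toReal_mul, ENNReal.toReal_mul, ENNReal.toReal_ofReal hn0,
    ENNReal.toReal_ofReal hn0', ← ENNReal.toReal_rpow, ENNReal.coe_toReal] at h5
  have h6 := pow_le_pow_left₀ hn0 h5 n
  rw [mul_pow, mul_pow] at h6
  have h7 : ((volume A).toReal ^ (1 / (n:ℝ))) ^ n = (volume A).toReal := by
    rw [one_div]
    exact Real.rpow_inv_natCast_pow ENNReal.toReal_nonneg (by omega)
  rw [h7] at h6
  refine h6.trans ?_
  gcongr
  simp


/-! ### Extension of the weak formulation to `C¹` test functions -/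

lemma continuous_mul_of_tsupport {E : Type*} [TopologicalSpace E] {U : Set E} (hU : IsOpen U)
    {g h : E → ℝ} (hg : ContinuousOn g U) (hh : Continuous h) (hs : tsupport h ⊆ U) :
    Continuous (fun x => g x * h x) := by
  rw [continuous_iff_continuousAt]
  intro x
  by_cases hx : x ∈ tsupport h
  · exact (hg.continuousAt (hU.mem_nhds (hs hx))).mul hh.continuousAt
  · have : (fun x => g x * h x) =ᶠ[nhds x] fun _ => 0 := by
      filter_upwards [(isClosed_tsupport h).isOpen_compl.mem_nhds hx] with y hy
      rw [image_eq_zero_of_notMem_tsupport hy, mul_zero]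
    exact continuousAt_const.congr this.symm

lemma integrable_mul_of_tsupport {n : ℕ} {U : Set (EuclideanSpace ℝ (Fin n))} (hU : IsOpen U)
    {g h : EuclideanSpace ℝ (Fin n) → ℝ} (hg : ContinuousOn g U) (hh : Continuous h)
    (hc : HasCompactSupport h) (hs : tsupport h ⊆ U) :
    Integrable (fun x => g x * h x) :=
  (continuous_mul_of_tsupport hU hg hh hs).integrable_of_hasCompactSupport hc.mul_left

lemma pd_continuous {n : ℕ} {ψ : EuclideanSpace ℝ (Fin n) → ℝ} (h : ContDiff ℝ 1 ψ)
    (v : EuclideanSpace ℝ (Fin n)) : Continuous (fun x => fderiv ℝ ψ x v) :=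
  (h.continuous_fderiv one_ne_zero).clm_apply continuous_const

lemma pd_tsupport {n : ℕ} (ψ : EuclideanSpace ℝ (Fin n) → ℝ) 
    (v : EuclideanSpace ℝ (Fin n)) : tsupport (fun x => fderiv ℝ ψ x v) ⊆ tsupport ψ := by
  refine subset_trans (closure_mono ?_) (tsupport_fderiv_subset ℝ (f := ψ))
  intro x hx h
  apply hx
  simp only [h]
  rfl

lemma exists_mollify {n : ℕ} {ψ : EuclideanSpace ℝ (Fin n) → ℝ} (h : ContDiff ℝ 1 ψ)
    (hc : HasCompactSupport ψ) {δ ε : ℝ} (hδ : 0 < δ) (hε : 0 < ε) :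
    ∃ χ : EuclideanSpace ℝ (Fin n) → ℝ, ContDiff ℝ (⊤ : ℕ∞) χ ∧
      tsupport χ ⊆ cthickening δ (tsupport ψ) ∧ (∀ x, |χ x - ψ x| ≤ ε) ∧
      ∀ x, ‖fderiv ℝ χ x - fderiv ℝ ψ x‖ ≤ ε := by
  have u1 : UniformContinuous ψ :=
    h.continuous.uniformContinuous_of_tendsto_cocompact hc.is_zero_at_infty
  have hd := h.continuous_fderiv one_ne_zero
  have u2 : UniformContinuous (fderiv ℝ ψ) :=
    hd.uniformContinuous_of_tendsto_cocompact (hc.fderiv ℝ).is_zero_at_infty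
  obtain ⟨δ1, hδ1, H1⟩ := Metric.uniformContinuous_iff.1 u1 ε hε
  obtain ⟨δ2, hδ2, H2⟩ := Metric.uniformContinuous_iff.1 u2 ε hε
  set r := min δ (min δ1 δ2) with hr
  have hrpos : 0 < r := lt_min hδ (lt_min hδ1 hδ2)
  let b : ContDiffBump (0 : EuclideanSpace ℝ (Fin n)) := ⟨r / 2, r, by positivity, by linarith⟩
  let χ : EuclideanSpace ℝ (Fin n) → ℝ :=
    MeasureTheory.convolution (b.normed volume) ψ (ContinuousLinearMap.lsmul ℝ ℝ) volume
  have hloc : LocallyIntegrable (b.normed volume) (volume : Measure (EuclideanSpace ℝ (Fin n))) :=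
    (b.continuous_normed).locallyIntegrable
  have hder : ∀ x, HasFDerivAt χ (MeasureTheory.convolution (b.normed volume) (fderiv ℝ ψ)
      (ContinuousLinearMap.lsmul ℝ ℝ) volume x) x := by
    intro x
    have := hc.hasFDerivAt_convolution_right (ContinuousLinearMap.lsmul ℝ ℝ) hloc h x
    have e : MeasureTheory.convolution (b.normed volume) (fderiv ℝ ψ)
        (ContinuousLinearMap.lsmul ℝ ℝ) volume x = MeasureTheory.convolution (b.normed volume)
        (fderiv ℝ ψ) ((ContinuousLinearMap.lsmul ℝ ℝ : ℝ →L[ℝ] ℝ →L[ℝ] ℝ).precompR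
          (EuclideanSpace ℝ (Fin n))) volume x := by
      unfold MeasureTheory.convolution
      refine integral_congr_ae (Filter.Eventually.of_forall fun t => ?_)
      ext v
      simp [ContinuousLinearMap.precompR_apply]
    rw [e]
    exact this
  refine ⟨χ, ?_, ?_, ?_, ?_⟩
  · exact b.hasCompactSupport_normed.contDiff_convolution_left _ b.contDiff_normed
      h.continuous.locallyIntegrable
  · refine closure_minimal ?_ isClosed_cthickening
    intro x hx
    have h1 := support_convolution_subset (ContinuousLinearMap.lsmul ℝ ℝ) hx
    obtain ⟨y, hy, z, hz, hyz⟩ := h1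
    rw [b.support_normed_eq] at hy
    refine mem_cthickening_of_dist_le x z δ _ (subset_tsupport _ hz) ?_
    have : x - z = y := by simp [← hyz]
    rw [dist_eq_norm, this]
    have h3 : ‖y‖ < r := by simpa using hy
    exact h3.le.trans (min_le_left _ _)
  · intro x
    have := b.dist_normed_convolution_le (μ := volume) (g := ψ) (x₀ := x) (ε := ε)
      h.continuous.aestronglyMeasurable (fun y hy => (H1 ((mem_ball.1 hy).trans_le
        ((min_le_right _ _).trans (min_le_left _ _)))).le)
    exact this
  · intro x
    have := b.dist_normed_convolution_le (μ := volume) (g := fderiv ℝ ψ) (x₀ := x) (ε := ε)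
      hd.aestronglyMeasurable (fun y hy => (H2 ((mem_ball.1 hy).trans_le
        ((min_le_right _ _).trans (min_le_right _ _)))).le)
    rw [(hder x).fderiv, ← dist_eq_norm]
    exact this

lemma weak_integrable {n : ℕ} {U : Set (EuclideanSpace ℝ (Fin n))} (hU : IsOpen U)
    {V : Fin n → EuclideanSpace ℝ (Fin n) → ℝ} {R : EuclideanSpace ℝ (Fin n) → ℝ}
    (hV : ∀ j, ContinuousOn (V j) U) (hR : ContinuousOn R U)
    {ψ : EuclideanSpace ℝ (Fin n) → ℝ} (h : ContDiff ℝ 1 ψ)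
    (hc : HasCompactSupport ψ) (hs : tsupport ψ ⊆ U) :
    Integrable (fun x => ∑ j, V j x * fderiv ℝ ψ x (EuclideanSpace.single j 1)) ∧
    Integrable (fun x => R x * ψ x) := by
  refine ⟨integrable_finsetSum _ fun j _ => ?_, integrable_mul_of_tsupport hU hR h.continuous hc hs⟩
  refine integrable_mul_of_tsupport hU (hV j) (pd_continuous h _) ?_ ((pd_tsupport ψ _).trans hs)
  exact hc.of_isClosed_subset (isClosed_tsupport _) (pd_tsupport ψ _)

lemma test_C1 {n : ℕ} {U : Set (EuclideanSpace ℝ (Fin n))} (hU : IsOpen U)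
    {V : Fin n → EuclideanSpace ℝ (Fin n) → ℝ} {R : EuclideanSpace ℝ (Fin n) → ℝ}
    (hV : ∀ j, ContinuousOn (V j) U) (hR : ContinuousOn R U)
    (hweak : ∀ ψ : EuclideanSpace ℝ (Fin n) → ℝ, ContDiff ℝ (⊤ : ℕ∞) ψ → HasCompactSupport ψ →
      tsupport ψ ⊆ U → ∫ x in U, ∑ j, V j x * fderiv ℝ ψ x (EuclideanSpace.single j 1) =
        ∫ x in U, R x * ψ x)
    {ψ : EuclideanSpace ℝ (Fin n) → ℝ} (h : ContDiff ℝ 1 ψ)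
    (hc : HasCompactSupport ψ) (hs : tsupport ψ ⊆ U) :
    ∫ x, (∑ j, V j x * fderiv ℝ ψ x (EuclideanSpace.single j 1) - R x * ψ x) = 0 := by
  obtain ⟨δ, hδ, hK⟩ := hc.isCompact.exists_cthickening_subset_open hU hs
  set K := cthickening δ (tsupport ψ) with hKdef
  have hKc : IsCompact K := hc.isCompact.cthickening
  have hbd : ∃ M, 0 ≤ M ∧ ∀ x ∈ K, ∑ j, |V j x| + |R x| ≤ M := by
    have hcont : ContinuousOn (fun x => ∑ j, |V j x| + |R x|) K :=
      (continuousOn_finsetSum _ fun j _ => ((hV j).mono hK).abs).add (hR.mono hK).abs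
    obtain ⟨M, hM⟩ := hKc.exists_bound_of_continuousOn hcont
    exact ⟨max M 0, le_max_right _ _, fun x hx =>
      ((le_abs_self _).trans (hM x hx)).trans (le_max_left _ _)⟩
  obtain ⟨M, hM0, hM⟩ := hbd
  have key : ∀ ε > 0, |∫ x, (∑ j, V j x * fderiv ℝ ψ x (EuclideanSpace.single j 1) - R x * ψ x)|
      ≤ ε * (M * (volume K).toReal) := by
    intro ε hε
    obtain ⟨χ, hχ, hχs, h0, h1⟩ := exists_mollify h hc hδ hε
    have hχ1 : ContDiff ℝ 1 χ := hχ.of_le (by exact_mod_cast le_top)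
    have hχc : HasCompactSupport χ := hKc.of_isClosed_subset (isClosed_tsupport _) hχs
    have i1 := weak_integrable hU hV hR h hc hs
    have i2 := weak_integrable hU hV hR hχ1 hχc (hχs.trans hK)
    have hz : ∫ x, (∑ j, V j x * fderiv ℝ χ x (EuclideanSpace.single j 1) - R x * χ x) = 0 := by
      rw [integral_sub i2.1 i2.2, sub_eq_zero]
      have hw := hweak χ hχ hχc (hχs.trans hK)
      rw [setIntegral_eq_integral_of_forall_compl_eq_zero,
        setIntegral_eq_integral_of_forall_compl_eq_zero] at hw
      · exact hw
      · intro x hx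
        have : x ∉ tsupport χ := fun h => hx (hK (hχs h))
        rw [image_eq_zero_of_notMem_tsupport this, mul_zero]
      · intro x hx
        have : x ∉ tsupport χ := fun h => hx (hK (hχs h))
        refine Finset.sum_eq_zero fun j _ => ?_
        rw [image_eq_zero_of_notMem_tsupport (fun h => this (pd_tsupport χ _ h)), mul_zero]
    have j1 : Integrable (fun x => ∑ j, V j x * fderiv ℝ ψ x (EuclideanSpace.single j 1)
        - R x * ψ x) := i1.1.sub i1.2
    have j2 : Integrable (fun x => ∑ j, V j x * fderiv ℝ χ x (EuclideanSpace.single j 1)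
        - R x * χ x) := i2.1.sub i2.2
    rw [← sub_zero (∫ x, _), ← hz, ← integral_sub j1 j2]
    rw [← setIntegral_eq_integral_of_forall_compl_eq_zero (s := K)]
    · rw [← Real.norm_eq_abs]
      have := norm_setIntegral_le_of_norm_le_const (μ := volume) (s := K) (C := ε * M)
        (f := fun x => (∑ j, V j x * fderiv ℝ ψ x (EuclideanSpace.single j 1) - R x * ψ x) -
          (∑ j, V j x * fderiv ℝ χ x (EuclideanSpace.single j 1) - R x * χ x))
        hKc.measure_lt_top (fun x hx => ?_)
      · simpa [Measure.real, mul_assoc] using this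
      · have e : (∑ j, V j x * fderiv ℝ ψ x (EuclideanSpace.single j 1) - R x * ψ x) -
          (∑ j, V j x * fderiv ℝ χ x (EuclideanSpace.single j 1) - R x * χ x)
          = R x * (χ x - ψ x) - ∑ j, V j x * ((fderiv ℝ χ x - fderiv ℝ ψ x)
              (EuclideanSpace.single j 1)) := by
          simp only [sub_apply, mul_sub, Finset.sum_sub_distrib]
          ring
        rw [e, Real.norm_eq_abs]
        calc _ ≤ |R x * (χ x - ψ x)| + |∑ j, V j x * ((fderiv ℝ χ x - fderiv ℝ ψ x)
              (EuclideanSpace.single j 1))| := abs_sub _ _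
          _ ≤ |R x| * ε + ∑ j, |V j x| * ε := by
              gcongr
              · rw [abs_mul]; gcongr; exact h0 x
              · refine (Finset.abs_sum_le_sum_abs _ _).trans (Finset.sum_le_sum fun j _ => ?_)
                rw [abs_mul]; gcongr
                rw [← Real.norm_eq_abs]
                refine ((fderiv ℝ χ x - fderiv ℝ ψ x).le_opNorm _).trans ?_
                simpa using h1 x
          _ = ε * (∑ j, |V j x| + |R x|) := by rw [← Finset.sum_mul]; ring
          _ ≤ ε * M := by gcongr; exact hM x hx
    · intro x hx
      have t1 : x ∉ tsupport χ := fun h => hx (hχs h)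
      have t2 : x ∉ tsupport ψ := fun h => hx (self_subset_cthickening _ h)
      have z1 : ∀ v, fderiv ℝ χ x v = 0 := fun v =>
        image_eq_zero_of_notMem_tsupport (f := fun x => fderiv ℝ χ x v)
          (fun h => t1 (pd_tsupport χ _ h))
      have z2 : ∀ v, fderiv ℝ ψ x v = 0 := fun v =>
        image_eq_zero_of_notMem_tsupport (f := fun x => fderiv ℝ ψ x v)
          (fun h => t2 (pd_tsupport ψ _ h))
      simp [z1, z2, image_eq_zero_of_notMem_tsupport t1, image_eq_zero_of_notMem_tsupport t2]
  by_contra hne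
  set I := ∫ x, (∑ j, V j x * fderiv ℝ ψ x (EuclideanSpace.single j 1) - R x * ψ x)
  have hpos : 0 < |I| := abs_pos.2 hne
  set B := M * (volume K).toReal with hB
  have hB0 : 0 ≤ B := by positivity
  have := key (|I| / (2 * (B + 1))) (by positivity)
  rw [div_mul_eq_mul_div, le_div_iff₀ (by positivity)] at this
  nlinarith


/-! ### Cutoff functions -/

lemma cutoff {n : ℕ} (x₁ : EuclideanSpace ℝ (Fin n)) {d : ℝ} (hd : 0 < d) (j : ℕ) :
    ∃ η : EuclideanSpace ℝ (Fin n) → ℝ, ContDiff ℝ 1 η ∧ (∀ x, 0 ≤ η x) ∧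
      (∀ x ∈ ball x₁ (d * (1 / 2 + (1 / 2) ^ (j + 2))), 1 ≤ η x) ∧
      (∀ x, x ∉ ball x₁ (d * (1 / 2 + (1 / 2) ^ (j + 1))) → η x = 0) ∧
      (∀ x, η x ≤ 64 * 4 ^ j) ∧ (∀ x, ‖fderiv ℝ η x‖ ≤ 64 * 4 ^ j / d) := by
  set w : ℝ := (1 / 2) ^ j with hw
  have hw0 : 0 < w := by positivity
  have hw1 : w ≤ 1 := pow_le_one₀ (by norm_num) (by norm_num)
  have h4 : (4:ℝ) ^ j = (w⁻¹) ^ 2 := by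
    rw [hw, ← inv_pow, ← pow_mul, mul_comm, pow_mul]; norm_num
  set r : ℝ := d * (1 / 2 + w / 2) with hr
  set r' : ℝ := d * (1 / 2 + w / 4) with hr'
  have er : d * (1 / 2 + (1 / 2) ^ (j + 1)) = r := by rw [hr, hw, pow_succ]; ring
  have er' : d * (1 / 2 + (1 / 2) ^ (j + 2)) = r' := by rw [hr', hw, pow_add]; ring
  rw [er, er', h4]
  have hr0 : 0 < r := by positivity
  have hr'0 : 0 < r' := by positivity
  have hrd : r ≤ d := by rw [hr]; nlinarith
  set D : ℝ := r ^ 2 - r' ^ 2 with hD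
  have hDlow : d ^ 2 * w / 4 ≤ D := by
    have : D = d ^ 2 * w / 4 * (1 + 3 * w / 4) := by rw [hD, hr, hr']; ring
    rw [this]
    have : 0 ≤ d ^ 2 * w / 4 := by positivity
    nlinarith
  have hDpos : 0 < D := lt_of_lt_of_le (by positivity) hDlow
  have hDinv : D⁻¹ ≤ 4 * w⁻¹ / d ^ 2 := by
    have : (d ^ 2 * w / 4)⁻¹ = 4 * w⁻¹ / d ^ 2 := by field_simp
    rw [← this]
    exact inv_anti₀ (by positivity) hDlow
  let h : EuclideanSpace ℝ (Fin n) → ℝ := fun x => r ^ 2 - ‖x - x₁‖ ^ 2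
  have hhd : ∀ x, HasFDerivAt h (-(2 • innerSL ℝ (x - x₁))) x := by
    intro x
    have h1 : HasFDerivAt (fun y : EuclideanSpace ℝ (Fin n) => y - x₁)
      (ContinuousLinearMap.id ℝ _) x := (hasFDerivAt_id x).sub_const x₁
    have h2 := h1.norm_sq.const_sub (r ^ 2)
    simpa using h2
  have hhc : ContDiff ℝ 1 h := by
    have : ContDiff ℝ 1 (fun y : EuclideanSpace ℝ (Fin n) => y - x₁) := contDiff_id.sub contDiff_const
    exact contDiff_const.sub (this.norm_sq ℝ)
  have hle : ∀ x, max (h x) 0 ≤ d ^ 2 := by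
    intro x
    refine max_le ?_ (by positivity)
    have : h x ≤ r ^ 2 := by simp only [h]; nlinarith [sq_nonneg ‖x - x₁‖]
    exact this.trans (pow_le_pow_left₀ hr0.le hrd 2)
  have hfd : ∀ x, HasFDerivAt (fun x => max (h x) 0 ^ 2 * (D⁻¹) ^ 2)
      ((D⁻¹) ^ 2 • ((2 * max (h x) 0) • (-(2 • innerSL ℝ (x - x₁)) :
        EuclideanSpace ℝ (Fin n) →L[ℝ] ℝ))) x := by
    intro x
    have h1 := (posPow_hasDerivAt 0 (h x)).comp_hasFDerivAt x (hhd x)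
    have h2 := h1.mul_const ((D⁻¹) ^ 2)
    simpa using h2
  refine ⟨fun x => max (h x) 0 ^ 2 * (D⁻¹) ^ 2, ?_, fun x => by positivity, ?_, ?_, ?_, ?_⟩
  · exact ((posPow_contDiff 0).comp hhc).mul contDiff_const
  · intro x hx
    rw [mem_ball, dist_eq_norm] at hx
    have h1 : D ≤ max (h x) 0 := by
      refine le_max_of_le_left ?_
      simp only [h, hD]
      nlinarith [norm_nonneg (x - x₁)]
    beta_reduce
    rw [← mul_pow]
    apply one_le_pow₀
    rw [← div_eq_mul_inv, one_le_div hDpos]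
    exact h1
  · intro x hx
    rw [mem_ball, dist_eq_norm, not_lt] at hx
    have h1 : max (h x) 0 = 0 := by
      refine max_eq_right ?_
      simp only [h]
      nlinarith [norm_nonneg (x - x₁)]
    simp [h1]
  · intro x
    beta_reduce
    rw [← mul_pow]
    have : max (h x) 0 * D⁻¹ ≤ 4 * w⁻¹ := by
      calc max (h x) 0 * D⁻¹ ≤ d ^ 2 * (4 * w⁻¹ / d ^ 2) := by
            gcongr
            exact hle x
        _ = 4 * w⁻¹ := by field_simp
    calc (max (h x) 0 * D⁻¹) ^ 2 ≤ (4 * w⁻¹) ^ 2 := by gcongr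
      _ ≤ 64 * w⁻¹ ^ 2 := by nlinarith [sq_nonneg w⁻¹]
  · intro x
    rw [(hfd x).fderiv]
    by_cases hx : r ≤ ‖x - x₁‖
    · have h1 : max (h x) 0 = 0 := by
        refine max_eq_right ?_
        simp only [h]
        nlinarith [norm_nonneg (x - x₁)]
      rw [h1]
      simp
      positivity
    · push Not at hx
      have hn : ‖(-(2 • innerSL ℝ (x - x₁)) : EuclideanSpace ℝ (Fin n) →L[ℝ] ℝ)‖ ≤ 2 * d := by
        rw [norm_neg]
        refine (norm_nsmul_le).trans ?_
        rw [innerSL_apply_norm]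
        norm_num
        linarith
      rw [norm_smul, norm_smul, Real.norm_of_nonneg (by positivity),
        Real.norm_of_nonneg (by positivity)]
      calc (D⁻¹) ^ 2 * (2 * max (h x) 0 * _) ≤ (4 * w⁻¹ / d ^ 2) ^ 2 * (2 * d ^ 2 * (2 * d)) := by
            gcongr
            exact hle x
        _ = 64 * w⁻¹ ^ 2 / d := by field_simp; norm_num

/-! ### The quadratic form -/

/-- The bilinear form with coefficients `a` on linear functionals. -/
noncomputable def Bf {n : ℕ} (a : Fin n → Fin n → ℝ)
    (L M : EuclideanSpace ℝ (Fin n) →L[ℝ] ℝ) : ℝ :=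
  ∑ i, ∑ j, a i j * L (EuclideanSpace.single i 1) * M (EuclideanSpace.single j 1)

lemma Bf_add_right {n : ℕ} (a : Fin n → Fin n → ℝ) (L M N : EuclideanSpace ℝ (Fin n) →L[ℝ] ℝ) :
    Bf a L (M + N) = Bf a L M + Bf a L N := by
  simp [Bf, mul_add, Finset.sum_add_distrib]

lemma Bf_smul_right {n : ℕ} (a : Fin n → Fin n → ℝ) (c : ℝ)
    (L M : EuclideanSpace ℝ (Fin n) →L[ℝ] ℝ) :
    Bf a L (c • M) = c * Bf a L M := by
  simp only [Bf, Finset.mul_sum]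
  refine Finset.sum_congr rfl fun i _ => Finset.sum_congr rfl fun j _ => ?_
  simp
  ring

lemma Bf_symm {n : ℕ} {a : Fin n → Fin n → ℝ} (ha : ∀ i j, a i j = a j i)
    (L M : EuclideanSpace ℝ (Fin n) →L[ℝ] ℝ) : Bf a L M = Bf a M L := by
  simp only [Bf]
  rw [Finset.sum_comm]
  refine Finset.sum_congr rfl fun i _ => Finset.sum_congr rfl fun j _ => ?_
  rw [ha]
  ring

lemma Bf_elliptic {n : ℕ} {a : Fin n → Fin n → ℝ} {Λ : ℝ}
    (hell : ∀ ξ : EuclideanSpace ℝ (Fin n),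
      Λ⁻¹ * ‖ξ‖ ^ 2 ≤ ∑ i : Fin n, ∑ j : Fin n, a i j * ξ i * ξ j ∧
      ∑ i : Fin n, ∑ j : Fin n, a i j * ξ i * ξ j ≤ Λ * ‖ξ‖ ^ 2)
    (L : EuclideanSpace ℝ (Fin n) →L[ℝ] ℝ) :
    Λ⁻¹ * ‖L‖ ^ 2 ≤ Bf a L L ∧ Bf a L L ≤ Λ * ‖L‖ ^ 2 := by
  set v := (InnerProductSpace.toDual ℝ (EuclideanSpace ℝ (Fin n))).symm L with hv
  have h1 : ∀ i, L (EuclideanSpace.single i 1) = v i := by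
    intro i
    have : inner ℝ v (EuclideanSpace.single i (1:ℝ)) = L (EuclideanSpace.single i 1) := by
      rw [hv, InnerProductSpace.toDual_symm_apply]
    rw [← this, EuclideanSpace.inner_single_right]
    simp
  have h2 : ‖v‖ = ‖L‖ := by rw [hv]; simp
  have := hell v
  simp only [Bf, h1]
  rw [← h2]
  exact this

lemma Bf_young {n : ℕ} {a : Fin n → Fin n → ℝ} {Λ : ℝ} (hΛ : 0 < Λ) (ha : ∀ i j, a i j = a j i)
    (hell : ∀ ξ : EuclideanSpace ℝ (Fin n),
      Λ⁻¹ * ‖ξ‖ ^ 2 ≤ ∑ i : Fin n, ∑ j : Fin n, a i j * ξ i * ξ j ∧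
      ∑ i : Fin n, ∑ j : Fin n, a i j * ξ i * ξ j ≤ Λ * ‖ξ‖ ^ 2)
    (L M : EuclideanSpace ℝ (Fin n) →L[ℝ] ℝ) (α β : ℝ) :
    0 ≤ α ^ 2 * Bf a L L + 2 * α * β * Bf a L M + β ^ 2 * Bf a M M := by
  have h := (Bf_elliptic hell (α • L + β • M)).1
  have h0 : 0 ≤ Bf a (α • L + β • M) (α • L + β • M) := le_trans (by positivity) h
  rw [Bf_add_right, Bf_smul_right, Bf_smul_right, Bf_symm ha _ L, Bf_symm ha _ M, Bf_add_right,
    Bf_add_right, Bf_smul_right, Bf_smul_right, Bf_smul_right, Bf_smul_right, Bf_symm ha M L] at h0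
  linarith

/-! ### Pointwise inequalities -/

lemma pointwise_energy {Λ η t e δ hh BDD BDH BHH R : ℝ} (m : ℕ) (hΛ : 1 ≤ Λ) (ht : 0 ≤ t)
    (he : 0 < e) (h1 : Λ⁻¹ * δ ^ 2 ≤ BDD) (h2 : BHH ≤ Λ * hh ^ 2)
    (hy : ∀ α β : ℝ, 0 ≤ α ^ 2 * BDD + 2 * α * β * BDH + β ^ 2 * BHH)
    (hR : R ≤ 2 * (2 + δ ^ 2)) :
    η ^ 2 * t ^ (m + 1) * e ^ 2 * δ ^ 2 ≤ Λ * ((2 * η * t ^ (m + 2) * e) * BDH +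
      ((m + 2) * η ^ 2 * t ^ (m + 1) * e ^ 2 + 2 * Λ * e * η ^ 2 * t ^ (m + 2)) * BDD
      - R * (η ^ 2 * t ^ (m + 2) * e)
      + 2 * Λ * t ^ (m + 3) * hh ^ 2 + 4 * η ^ 2 * t ^ (m + 2) * e) := by
  have hΛ0 : 0 < Λ := by linarith
  have hδ : δ ^ 2 ≤ Λ * BDD := by
    rw [inv_mul_le_iff₀ hΛ0] at h1
    exact h1
  have hB0 : 0 ≤ BDD := le_trans (by positivity) h1
  set s := t ^ (m + 1) with hs
  have hs0 : 0 ≤ s := by positivity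
  have e2 : t ^ (m + 2) = s * t := by rw [hs]; ring
  have e3 : t ^ (m + 3) = s * t ^ 2 := by rw [hs]; ring
  rw [e2, e3]
  have y1 := mul_nonneg (half_pos (one_pos : (0:ℝ) < 1)).le (mul_nonneg hs0 (hy (η * e) (2 * t)))
  have y2 : s * t ^ 2 * BHH ≤ s * t ^ 2 * (Λ * hh ^ 2) := by gcongr
  have y3 : R * (η ^ 2 * (s * t) * e) ≤ (4 + 2 * (Λ * BDD)) * (η ^ 2 * (s * t) * e) := by
    gcongr
    linarith
  have y4 : 0 ≤ (m:ℝ) * (η ^ 2 * s * e ^ 2 * BDD) := by positivity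
  have y5 : 0 ≤ η ^ 2 * s * e ^ 2 * BDD := by positivity
  have y6 : η ^ 2 * s * e ^ 2 * δ ^ 2 ≤ η ^ 2 * s * e ^ 2 * (Λ * BDD) := by gcongr
  refine y6.trans ?_
  have : η ^ 2 * s * e ^ 2 * (Λ * BDD) = Λ * (η ^ 2 * s * e ^ 2 * BDD) := by ring
  rw [this]
  apply mul_le_mul_of_nonneg_left _ hΛ0.le
  nlinarith

lemma pointwise_grad {Λ η t τ e δ hh N d Ex G : ℝ} (m : ℕ) (hΛ : 1 ≤ Λ) (ht : 0 ≤ t)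
    (htτ : t ≤ τ) (hη : 0 ≤ η) (hηN : η ≤ N) (hN : 1 ≤ N) (hd : 0 < d) (hhh : 0 ≤ hh)
    (hh2 : hh ≤ N / d)
    (he2 : e * t ^ (m + 2) ≤ 8 * Λ * N / d ^ 2 * τ ^ (m + 3))
    (hX : η ^ 2 * t ^ (m + 1) * e ^ 2 * δ ^ 2 ≤
      Λ * (Ex + 2 * Λ * t ^ (m + 3) * hh ^ 2 + 4 * η ^ 2 * t ^ (m + 2) * e))
    (hG : G ≤ 2 * η * t ^ (m + 3) * hh + (m + 3) * η ^ 2 * t ^ (m + 2) * e * δ) :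
    G ≤ (2 + 18 * (m + 3) * Λ ^ 2) * (N ^ 3 / d) * τ ^ (m + 3) +
      (m + 3) * Λ * d / (2 * N) * Ex := by
  have hN0 : 0 < N := by linarith
  have hτ0 : 0 ≤ τ := ht.trans htτ
  set T := τ ^ (m + 3) with hT
  have hT0 : 0 ≤ T := by positivity
  have htT : t ^ (m + 3) ≤ T := by rw [hT]; gcongr
  have a1 : 2 * η * t ^ (m + 3) * hh ≤ 2 * (N ^ 3 / d) * T := by
    calc 2 * η * t ^ (m + 3) * hh ≤ 2 * N * T * (N / d) := by gcongr
      _ = 2 * (N ^ 2 / d) * T := by ring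
      _ ≤ 2 * (N ^ 3 / d) * T := by
        gcongr
        norm_num
  have a2 : 2 * Λ * t ^ (m + 3) * hh ^ 2 ≤ 2 * Λ * (N ^ 3 / d ^ 2) * T := by
    calc 2 * Λ * t ^ (m + 3) * hh ^ 2 ≤ 2 * Λ * T * (N / d) ^ 2 := by gcongr
      _ = 2 * Λ * (N ^ 2 / d ^ 2) * T := by ring
      _ ≤ _ := by
        gcongr
        norm_num
  have a3 : 4 * η ^ 2 * t ^ (m + 2) * e ≤ 32 * Λ * (N ^ 3 / d ^ 2) * T := by
    calc 4 * η ^ 2 * t ^ (m + 2) * e = 4 * η ^ 2 * (e * t ^ (m + 2)) := by ring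
      _ ≤ 4 * η ^ 2 * (8 * Λ * N / d ^ 2 * T) := by gcongr
      _ ≤ 4 * N ^ 2 * (8 * Λ * N / d ^ 2 * T) := by gcongr
      _ = _ := by ring
  have a4 : η ^ 2 * t ^ (m + 1) * e ^ 2 * δ ^ 2 ≤ Λ * Ex + 34 * Λ ^ 2 * (N ^ 3 / d ^ 2) * T := by
    nlinarith
  have a5 : η ^ 2 * t ^ (m + 2) * e * δ ≤ 1 / 2 * (N / d * (η ^ 2 * t ^ (m + 3)) +
      d / N * (η ^ 2 * t ^ (m + 1) * e ^ 2 * δ ^ 2)) := by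
    have hl : 0 < N / d := by positivity
    have e1 : d / N = (N / d)⁻¹ := by rw [inv_div]
    rw [e1]
    set l := N / d
    have : 0 ≤ η ^ 2 * t ^ (m + 1) * l⁻¹ * (l * t - e * δ) ^ 2 := by positivity
    have e2 : η ^ 2 * t ^ (m + 1) * l⁻¹ * (l * t - e * δ) ^ 2 =
       l * (η ^ 2 * t ^ (m + 3)) + l⁻¹ * (η ^ 2 * t ^ (m + 1) * e ^ 2 * δ ^ 2)
        - 2 * (η ^ 2 * t ^ (m + 2) * e * δ) := by
      field_simp
      ring
    rw [e2] at this
    linarith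
  have a6 : N / d * (η ^ 2 * t ^ (m + 3)) ≤ N ^ 3 / d * T := by
    calc N / d * (η ^ 2 * t ^ (m + 3)) ≤ N / d * (N ^ 2 * T) := by gcongr
      _ = _ := by ring
  have a7 : d / N * (η ^ 2 * t ^ (m + 1) * e ^ 2 * δ ^ 2) ≤
      d / N * Λ * Ex + 34 * Λ ^ 2 * (N ^ 3 / d) * T := by
    calc _ ≤ d / N * (Λ * Ex + 34 * Λ ^ 2 * (N ^ 3 / d ^ 2) * T) := by gcongr
      _ = d / N * Λ * Ex + 34 * Λ ^ 2 * (N ^ 2 / d) * T := by field_simp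
      _ ≤ _ := by
        gcongr
        norm_num
  have a8 : η ^ 2 * t ^ (m + 2) * e * δ ≤ 18 * Λ ^ 2 * (N ^ 3 / d) * T + Λ * d / (2 * N) * Ex := by
    have hp : 0 ≤ N ^ 3 / d * T := by positivity
    have : N ^ 3 / d * T ≤ Λ ^ 2 * (N ^ 3 / d * T) := le_mul_of_one_le_left hp (one_le_pow₀ hΛ)
    have e4 : Λ * d / (2 * N) * Ex = 1 / 2 * (d / N * Λ * Ex) := by field_simp
    rw [e4]
    nlinarith
  calc G ≤ _ := hG
    _ = 2 * η * t ^ (m + 3) * hh + (m + 3) * (η ^ 2 * t ^ (m + 2) * e * δ) := by ring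
    _ ≤ 2 * (N ^ 3 / d) * T + (m + 3) * (18 * Λ ^ 2 * (N ^ 3 / d) * T + Λ * d / (2 * N) * Ex) := by
      gcongr
    _ = _ := by ring


/-! ### The energy estimate at one step -/

lemma tsupport_sub_closedBall {n : ℕ} {x₁ : EuclideanSpace ℝ (Fin n)} {r : ℝ}
    {f : EuclideanSpace ℝ (Fin n) → ℝ} (h : ∀ x, x ∉ ball x₁ r → f x = 0) :
    tsupport f ⊆ closedBall x₁ r := by
  refine closure_minimal ?_ isClosed_closedBall
  intro x hx
  by_contra hc
  exact hx (h x fun hb => hc (ball_subset_closedBall hb))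

lemma contDiff_cut {n : ℕ} {U : Set (EuclideanSpace ℝ (Fin n))} (hU : IsOpen U)
    {x₁ : EuclideanSpace ℝ (Fin n)} {r : ℝ} (hb : closedBall x₁ r ⊆ U)
    {η g : EuclideanSpace ℝ (Fin n) → ℝ} (hη : ContDiff ℝ 1 η) (hg : ContDiffOn ℝ 1 g U)
    (h0 : ∀ x, x ∉ ball x₁ r → η x = 0) :
    ContDiff ℝ 1 (fun x => η x ^ 2 * g x) ∧ HasCompactSupport (fun x => η x ^ 2 * g x) ∧
      tsupport (fun x => η x ^ 2 * g x) ⊆ closedBall x₁ r := by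
  have hs : tsupport (fun x => η x ^ 2 * g x) ⊆ closedBall x₁ r :=
    tsupport_sub_closedBall fun x hx => by simp [h0 x hx]
  refine ⟨?_, (isCompact_closedBall x₁ r).of_isClosed_subset (isClosed_tsupport _) hs, hs⟩
  rw [contDiff_iff_contDiffAt]
  intro x
  by_cases hx : x ∈ tsupport (fun x => η x ^ 2 * g x)
  · have hxU := hU.mem_nhds (hb (hs hx))
    exact (hη.contDiffAt.pow 2).mul (hg.contDiffAt hxU)
  · have : (fun x => η x ^ 2 * g x) =ᶠ[nhds x] fun _ => 0 :=
      notMem_tsupport_iff_eventuallyEq.1 hx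
    exact contDiffAt_const.congr_of_eventuallyEq this

lemma fderiv_eq_zero_of_nonneg {n : ℕ} {f : EuclideanSpace ℝ (Fin n) → ℝ} (h : ∀ x, 0 ≤ f x)
    {x : EuclideanSpace ℝ (Fin n)} (hx : f x = 0) : fderiv ℝ f x = 0 :=
  IsLocalMin.fderiv_eq_zero (Filter.Eventually.of_forall fun y => by rw [hx]; exact h y)

set_option maxHeartbeats 2000000 in
lemma energy_step {n : ℕ} {Λ : ℝ} (hΛ : 1 ≤ Λ) (m : ℕ) {U : Set (EuclideanSpace ℝ (Fin n))}
    (hU : IsOpen U) {φ : EuclideanSpace ℝ (Fin n) → ℝ} (hφ : ContDiffOn ℝ 1 φ U)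
    {a : EuclideanSpace ℝ (Fin n) → Fin n → Fin n → ℝ}
    (hsym : ∀ x, ∀ i j, a x i j = a x j i)
    (hell : ∀ x ∈ U, ∀ ξ : EuclideanSpace ℝ (Fin n),
      Λ⁻¹ * ‖ξ‖ ^ 2 ≤ ∑ i : Fin n, ∑ j : Fin n, a x i j * ξ i * ξ j ∧
      ∑ i : Fin n, ∑ j : Fin n, a x i j * ξ i * ξ j ≤ Λ * ‖ξ‖ ^ 2)
    {R : EuclideanSpace ℝ (Fin n) → ℝ} (hR : ∀ x ∈ U, R x ≤ 2 * (2 + ‖fderiv ℝ φ x‖ ^ 2))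
    (hweak : ∀ ψ : EuclideanSpace ℝ (Fin n) → ℝ, ContDiff ℝ 1 ψ → HasCompactSupport ψ →
      tsupport ψ ⊆ U →
      Integrable (fun x => Bf (a x) (fderiv ℝ φ x) (fderiv ℝ ψ x) - R x * ψ x) ∧
      ∫ x, (Bf (a x) (fderiv ℝ φ x) (fderiv ℝ ψ x) - R x * ψ x) = 0)
    {μ : ℝ} {W : EuclideanSpace ℝ (Fin n) → ℝ}
    (hW : ∀ x, W x = (Real.exp (2 * Λ * (φ x - μ)) - 1) / (2 * Λ))
    {x₁ : EuclideanSpace ℝ (Fin n)} {d K : ℝ} (hd : 0 < d) (hd1 : d ≤ 1)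
    (hball : closedBall x₁ d ⊆ U) (hK : d ^ 2 ≤ K) (j : ℕ) :
    ∃ u : EuclideanSpace ℝ (Fin n) → ℝ, ContDiff ℝ 1 u ∧ HasCompactSupport u ∧ (∀ x, 0 ≤ u x) ∧
      (∀ x ∈ ball x₁ (d * (1 / 2 + (1 / 2) ^ (j + 2))),
        max (W x - K * (1 - (1 / 2) ^ (j + 1))) 0 ^ (m + 3) ≤ u x) ∧
      (∀ x, x ∉ ball x₁ (d * (1 / 2 + (1 / 2) ^ (j + 1))) ∩
        {x | K * (1 - (1 / 2) ^ (j + 1)) < W x} → u x = 0) ∧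
      ∫ x, ‖fderiv ℝ u x‖ ≤ (2 + 18 * (m + 3) * Λ ^ 2) * ((64 * 4 ^ j) ^ 3 / d) *
        ∫ x in ball x₁ (d * (1 / 2 + (1 / 2) ^ (j + 1))),
          max (W x - K * (1 - (1 / 2) ^ j)) 0 ^ (m + 3) := by
  obtain ⟨η, hη, hη0, hη1, hηs, hηN, hηd⟩ := cutoff x₁ hd j
  have hΛ0 : 0 < Λ := by linarith
  have hK0 : 0 < K := lt_of_lt_of_le (by positivity) hK
  set w : ℝ := (1 / 2) ^ j with hw
  have hw0 : 0 < w := by positivity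
  have hw1 : w ≤ 1 := pow_le_one₀ (by norm_num) (by norm_num)
  have ew : (1 / 2 : ℝ) ^ (j + 1) = w / 2 := by rw [hw, pow_succ]; ring
  set N : ℝ := 64 * 4 ^ j with hN
  have hNw : w⁻¹ ≤ N := by
    rw [hw, hN, ← inv_pow]
    have : ((1 / 2 : ℝ)⁻¹) ^ j ≤ 4 ^ j := by gcongr; norm_num
    have h4 : (0:ℝ) < 4 ^ j := by positivity
    linarith
  have hN1 : 1 ≤ N := (one_le_inv₀ hw0 |>.2 hw1).trans hNw
  set k' := K * (1 - (1 / 2) ^ (j + 1)) with hk'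
  set k := K * (1 - w) with hk
  set r := d * (1 / 2 + (1 / 2) ^ (j + 1)) with hr
  have hrd : r ≤ d := by rw [hr, ew]; nlinarith
  have hrU : closedBall x₁ r ⊆ U := (closedBall_subset_closedBall hrd).trans hball
  let e : EuclideanSpace ℝ (Fin n) → ℝ := fun x => Real.exp (2 * Λ * (φ x - μ))
  have he0 : ∀ x, 0 < e x := fun x => Real.exp_pos _
  have heW : ∀ x, e x = 1 + 2 * Λ * W x := by
    intro x
    rw [hW]
    simp only [e]
    field_simp
    ring
  have heC : ContDiffOn ℝ 1 e U :=
    Real.contDiff_exp.comp_contDiffOn (contDiffOn_const.mul (hφ.sub contDiffOn_const))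
  have hWC : ContDiffOn ℝ 1 W U := by
    have : W = fun x => (e x - 1) / (2 * Λ) := by ext x; rw [hW]
    rw [this]
    exact (heC.sub contDiffOn_const).div_const _
  let t : EuclideanSpace ℝ (Fin n) → ℝ := fun x => max (W x - k') 0
  have ht0 : ∀ x, 0 ≤ t x := fun x => le_max_right _ _
  have htC : ∀ l : ℕ, ContDiffOn ℝ 1 (fun x => t x ^ (l + 2)) U := fun l =>
    (posPow_contDiff l).comp_contDiffOn (hWC.sub contDiffOn_const)
  let u : EuclideanSpace ℝ (Fin n) → ℝ := fun x => η x ^ 2 * t x ^ (m + 3)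
  let ψ : EuclideanSpace ℝ (Fin n) → ℝ := fun x => η x ^ 2 * (t x ^ (m + 2) * e x)
  obtain ⟨hu1, hu2, hu3⟩ := contDiff_cut hU hrU hη (htC (m + 1)) hηs
  obtain ⟨hψ1, hψ2, hψ3⟩ := contDiff_cut hU hrU hη ((htC m).mul heC) hηs
  change ContDiff ℝ 1 u at hu1
  change HasCompactSupport u at hu2
  change ContDiff ℝ 1 ψ at hψ1
  change HasCompactSupport ψ at hψ2
  change tsupport ψ ⊆ _ at hψ3
  have hu0 : ∀ x, 0 ≤ u x := fun x => mul_nonneg (sq_nonneg _) (pow_nonneg (ht0 x) _)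
  have hψ0 : ∀ x, 0 ≤ ψ x := fun x =>
    mul_nonneg (sq_nonneg _) (mul_nonneg (pow_nonneg (ht0 x) _) (he0 x).le)
  -- derivatives inside `U`
  have hφd : ∀ x ∈ U, HasFDerivAt φ (fderiv ℝ φ x) x := fun x hx =>
    ((hφ.contDiffAt (hU.mem_nhds hx)).differentiableAt one_ne_zero).hasFDerivAt
  have hed : ∀ x ∈ U, HasFDerivAt e ((2 * Λ * e x) • fderiv ℝ φ x) x := by
    intro x hx
    have h1 := (((hφd x hx).sub_const μ).const_mul (2 * Λ)).exp
    refine h1.congr_fderiv ?_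
    rw [smul_smul]
    congr 1
    simp only [e]
    ring
  have hWd : ∀ x ∈ U, HasFDerivAt W (e x • fderiv ℝ φ x) x := by
    intro x hx
    have : W = fun x => (e x - 1) * (2 * Λ)⁻¹ := by ext x; rw [hW, div_eq_mul_inv]
    rw [this]
    refine (((hed x hx).sub_const 1).mul_const (2 * Λ)⁻¹).congr_fderiv ?_
    rw [smul_smul]
    congr 1
    field_simp
  have htd : ∀ (l : ℕ), ∀ x ∈ U, HasFDerivAt (fun x => t x ^ (l + 2))
      ((((l : ℝ) + 2) * t x ^ (l + 1)) • (e x • fderiv ℝ φ x)) x := by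
    intro l x hx
    exact (posPow_hasDerivAt l (W x - k')).comp_hasFDerivAt x ((hWd x hx).sub_const k')
  have hηdd : ∀ x, HasFDerivAt (fun x => η x ^ 2) ((2 * η x) • fderiv ℝ η x) x := by
    intro x
    have h1 := ((hη.differentiable one_ne_zero) x).hasFDerivAt.pow 2
    refine h1.congr_fderiv ?_
    simp
  have hud : ∀ x ∈ U, fderiv ℝ u x = (2 * η x * t x ^ (m + 3)) • fderiv ℝ η x +
      ((m + 3) * η x ^ 2 * t x ^ (m + 2) * e x) • fderiv ℝ φ x := by
    intro x hx
    have h1 : HasFDerivAt u _ x := (hηdd x).mul (htd (m + 1) x hx)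
    rw [h1.fderiv]
    ext v
    simp
    ring
  have hψd : ∀ x ∈ U, fderiv ℝ ψ x = (2 * η x * t x ^ (m + 2) * e x) • fderiv ℝ η x +
      ((m + 2) * η x ^ 2 * t x ^ (m + 1) * e x ^ 2 + 2 * Λ * e x * η x ^ 2 * t x ^ (m + 2)) •
        fderiv ℝ φ x := by
    intro x hx
    have h1 : HasFDerivAt ψ _ x := (hηdd x).mul ((htd m x hx).mul (hed x hx))
    rw [h1.fderiv]
    ext v
    simp
    ring
  obtain ⟨hint, hzero⟩ := hweak ψ hψ1 hψ2 (hψ3.trans hrU)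
  refine ⟨u, hu1, hu2, hu0, ?_, ?_, ?_⟩
  · intro x hx
    have h1 := hη1 x hx
    have : 1 ≤ η x ^ 2 := one_le_pow₀ h1
    exact le_mul_of_one_le_left (pow_nonneg (ht0 x) _) this
  · intro x hx
    by_cases hb : x ∈ ball x₁ r
    · have h1 : ¬ (k' < W x) := fun h => hx ⟨hb, h⟩
      have h2 : t x = 0 := max_eq_right (by linarith)
      simp [u, h2]
    · simp [u, hηs x hb]
  · -- main estimate
    set c1 : ℝ := (2 + 18 * (m + 3) * Λ ^ 2) * (N ^ 3 / d) with hc1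
    set c2 : ℝ := (m + 3) * Λ * d / (2 * N) with hc2
    let τ : EuclideanSpace ℝ (Fin n) → ℝ := fun x => max (W x - k) 0
    have hτi : IntegrableOn (fun x => τ x ^ (m + 3)) (ball x₁ r) := by
      have : ContinuousOn (fun x => τ x ^ (m + 3)) (closedBall x₁ r) :=
        ((posPow_contDiff (m + 1)).continuous).comp_continuousOn
          ((hWC.continuousOn.mono hrU).sub continuousOn_const)
      exact (this.integrableOn_compact (isCompact_closedBall _ _)).mono_set ball_subset_closedBall
    have hpt : ∀ x, ‖fderiv ℝ u x‖ ≤ (ball x₁ r).indicator (fun x => c1 * τ x ^ (m + 3)) x +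
        c2 * (Bf (a x) (fderiv ℝ φ x) (fderiv ℝ ψ x) - R x * ψ x) := by
      intro x
      by_cases hb : x ∈ ball x₁ r
      · rw [indicator_of_mem hb]
        have hxU : x ∈ U := hrU (ball_subset_closedBall hb)
        have hkk : k' = k + K * w / 2 := by rw [hk', hk, ew]; ring
        have htτ : t x ≤ τ x := by
          refine max_le_max ?_ le_rfl
          rw [hkk]
          have : 0 ≤ K * w / 2 := by positivity
          linarith
        have hX := pointwise_energy (η := η x) (t := t x) (e := e x) m hΛ (ht0 x) (he0 x)
          (Bf_elliptic (hell x hxU) (fderiv ℝ φ x)).1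
          (Bf_elliptic (hell x hxU) (fderiv ℝ η x)).2
          (Bf_young hΛ0 (hsym x) (hell x hxU) (fderiv ℝ φ x) (fderiv ℝ η x)) (hR x hxU)
        refine pointwise_grad (η := η x) (t := t x) (τ := τ x) (e := e x) (δ := ‖fderiv ℝ φ x‖)
          (hh := ‖fderiv ℝ η x‖) m hΛ (ht0 x) htτ (hη0 x) (hηN x) hN1 hd (norm_nonneg _) (hηd x)
          ?_ ?_ ?_
        · by_cases htx : t x = 0
          · rw [htx]
            have : 0 ≤ τ x := le_max_right _ _
            simp
            positivity
          · have hWk : k' < W x := by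
              by_contra hcon
              exact htx (max_eq_right (by linarith))
            have hτe : τ x = W x - k := by
              refine max_eq_left ?_
              have : 0 ≤ K * w / 2 := by positivity
              linarith
            have hτl : K * w / 2 ≤ τ x := by rw [hτe]; linarith
            have hτ0 : 0 ≤ τ x := le_max_right _ _
            have hkK : k ≤ K := by rw [hk]; nlinarith
            have hKτ : K ≤ 2 * N * τ x := by
              have h1 : K = w⁻¹ * (K * w / 2) * 2 := by field_simp
              rw [h1]
              have : w⁻¹ * (K * w / 2) ≤ N * τ x := by gcongr
              linarith
            have hNd : 0 < N / d ^ 2 := by positivity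
            have h1τ : 1 ≤ 2 * (N / d ^ 2) * τ x := by
              have : d ^ 2 ≤ 2 * N * τ x := hK.trans hKτ
              calc (1:ℝ) = d ^ 2 / d ^ 2 := by field_simp
                _ ≤ 2 * N * τ x / d ^ 2 := by gcongr
                _ = _ := by ring
            have hdN : N ≤ N / d ^ 2 := by
              rw [le_div_iff₀ (by positivity)]
              have : d ^ 2 ≤ 1 := pow_le_one₀ hd.le hd1
              nlinarith
            have hee : e x ≤ 8 * Λ * N / d ^ 2 * τ x := by
              have h3 : W x ≤ τ x + K := by rw [hτe]; linarith
              have h4 : K ≤ 2 * (N / d ^ 2) * τ x := hKτ.trans (by gcongr)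
              have h5 : τ x ≤ (N / d ^ 2) * τ x :=
                le_mul_of_one_le_left hτ0 (hN1.trans hdN)
              have h6 : 0 ≤ N / d ^ 2 * τ x := by positivity
              have e8 : 8 * Λ * N / d ^ 2 * τ x = 8 * Λ * (N / d ^ 2 * τ x) := by ring
              rw [heW, e8]
              have h7 : Λ * W x ≤ Λ * (3 * (N / d ^ 2 * τ x)) := by
                gcongr
                linarith
              nlinarith
            calc e x * t x ^ (m + 2) ≤ (8 * Λ * N / d ^ 2 * τ x) * τ x ^ (m + 2) := by
                  gcongr
              _ = _ := by ring
        · refine hX.trans_eq ?_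
          rw [hψd x hxU, Bf_add_right, Bf_smul_right, Bf_smul_right]
          simp only [ψ]
          ring
        · rw [hud x hxU]
          refine (norm_add_le _ _).trans ?_
          have z1 : 0 ≤ 2 * η x * t x ^ (m + 3) :=
            mul_nonneg (mul_nonneg zero_le_two (hη0 x)) (pow_nonneg (ht0 x) _)
          have z2 : 0 ≤ (m + 3) * η x ^ 2 * t x ^ (m + 2) * e x :=
            mul_nonneg (mul_nonneg (by positivity) (pow_nonneg (ht0 x) _)) (he0 x).le
          rw [norm_smul, norm_smul, Real.norm_of_nonneg z1, Real.norm_of_nonneg z2]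
      · rw [indicator_of_notMem hb]
        have z1 : u x = 0 := by simp [u, hηs x hb]
        have z2 : ψ x = 0 := by simp [ψ, hηs x hb]
        rw [fderiv_eq_zero_of_nonneg hu0 z1, fderiv_eq_zero_of_nonneg hψ0 z2, z2]
        simp [Bf]
    have hind : Integrable ((ball x₁ r).indicator (fun x => c1 * τ x ^ (m + 3))) :=
      (integrable_indicator_iff measurableSet_ball).2 (hτi.const_mul c1)
    have hdi : Integrable (fun x => ‖fderiv ℝ u x‖) :=
      ((hu1.continuous_fderiv one_ne_zero).integrable_of_hasCompactSupport (hu2.fderiv ℝ)).norm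
    have := integral_mono hdi (hind.add (hint.const_mul c2)) hpt
    refine this.trans_eq ?_
    have e1 := integral_add hind (hint.const_mul c2)
    rw [integral_const_mul, hzero, mul_zero, add_zero, integral_indicator measurableSet_ball,
      integral_const_mul] at e1
    exact e1


/-! ### De Giorgi iteration -/

lemma fast_decay {Y : ℕ → ℝ} (hY : ∀ j, 0 ≤ Y j) {n : ℕ} (hn : n ≠ 0) {A β : ℝ} (hA : 0 ≤ A)
    (hβ : 1 ≤ β) (h : ∀ j, Y (j + 1) ^ n ≤ A * β ^ j * Y j ^ (n + 1))
    (h0 : A * β ^ n * Y 0 ≤ 1) (j : ℕ) : Y j ≤ Y 0 * (β⁻¹) ^ j := by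
  have hβ0 : 0 < β := by linarith
  induction j with
  | zero => simp
  | succ j ih =>
    have hY0 := hY 0
    refine le_of_pow_le_pow_left₀ hn (by positivity) ?_
    have e0 : A * Y 0 ≤ (β⁻¹) ^ n := by
      rw [inv_pow, ← one_div, le_div_iff₀ (by positivity)]
      linarith
    calc Y (j + 1) ^ n ≤ A * β ^ j * Y j ^ (n + 1) := h j
      _ ≤ A * β ^ j * (Y 0 * (β⁻¹) ^ j) ^ (n + 1) := by
        gcongr
        exact hY j
      _ = (A * Y 0) * (Y 0 * (β⁻¹) ^ j) ^ n * (β * β⁻¹) ^ j := by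
        rw [pow_succ, mul_pow β]; ring
      _ ≤ (β⁻¹) ^ n * (Y 0 * (β⁻¹) ^ j) ^ n * (β * β⁻¹) ^ j := by gcongr
      _ = (Y 0 * (β⁻¹) ^ (j + 1)) ^ n := by
        rw [mul_inv_cancel₀ hβ0.ne', one_pow, mul_one, ← mul_pow, pow_succ]; ring

set_option maxHeartbeats 1000000 in
lemma center_estimate (n : ℕ) (hn : 2 ≤ n) (Λ : ℝ) (hΛ : 1 ≤ Λ) (m : ℕ) :
    ∃ C > (0:ℝ), ∀ (U : Set (EuclideanSpace ℝ (Fin n))) (_ : IsOpen U)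
    (φ : EuclideanSpace ℝ (Fin n) → ℝ) (_ : ContDiffOn ℝ 1 φ U)
    (a : EuclideanSpace ℝ (Fin n) → Fin n → Fin n → ℝ)
    (_ : ∀ x, ∀ i j, a x i j = a x j i)
    (_ : ∀ x ∈ U, ∀ ξ : EuclideanSpace ℝ (Fin n),
      Λ⁻¹ * ‖ξ‖ ^ 2 ≤ ∑ i : Fin n, ∑ j : Fin n, a x i j * ξ i * ξ j ∧
      ∑ i : Fin n, ∑ j : Fin n, a x i j * ξ i * ξ j ≤ Λ * ‖ξ‖ ^ 2)
    (R : EuclideanSpace ℝ (Fin n) → ℝ) (_ : ∀ x ∈ U, R x ≤ 2 * (2 + ‖fderiv ℝ φ x‖ ^ 2))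
    (_ : ∀ ψ : EuclideanSpace ℝ (Fin n) → ℝ, ContDiff ℝ 1 ψ → HasCompactSupport ψ →
      tsupport ψ ⊆ U →
      Integrable (fun x => Bf (a x) (fderiv ℝ φ x) (fderiv ℝ ψ x) - R x * ψ x) ∧
      ∫ x, (Bf (a x) (fderiv ℝ φ x) (fderiv ℝ ψ x) - R x * ψ x) = 0)
    (μ : ℝ) (W : EuclideanSpace ℝ (Fin n) → ℝ)
    (_ : ∀ x, W x = (Real.exp (2 * Λ * (φ x - μ)) - 1) / (2 * Λ))
    (x₁ : EuclideanSpace ℝ (Fin n)) (d K : ℝ) (_ : 0 < d) (_ : d ≤ 1)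
    (_ : closedBall x₁ d ⊆ U) (_ : d ^ 2 ≤ K)
    (_ : C * ∫ x in ball x₁ d, max (W x) 0 ^ (m + 3) ≤ d ^ n * K ^ (m + 3)), W x₁ ≤ K := by
  obtain ⟨S, hS, hsob⟩ := sobolev_set n hn
  have hΛ0 : 0 < Λ := by linarith
  set C5 : ℝ := 2 + 18 * (m + 3) * Λ ^ 2 with hC5
  have hC50 : 0 < C5 := by positivity
  set β : ℝ := 64 ^ n * 2 ^ (m + 3) with hβ
  have hβ1 : 1 ≤ β := by
    have h1 : (1:ℝ) ≤ 64 ^ n := one_le_pow₀ (by norm_num)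
    have h2 : (1:ℝ) ≤ 2 ^ (m + 3) := one_le_pow₀ (by norm_num)
    rw [hβ]
    nlinarith
  set C0 : ℝ := S * (C5 * 64 ^ 3) ^ n * 2 ^ (m + 3) with hC0
  have hC00 : 0 < C0 := by positivity
  refine ⟨C0 * β ^ n, by positivity, ?_⟩
  intro U hU φ hφ a hsym hell R hR hweak μ W hW x₁ d K hd hd1 hball hK hsmall
  have hK0 : 0 < K := lt_of_lt_of_le (by positivity) hK
  have hWC : ContinuousOn W U := by
    have : W = fun x => (Real.exp (2 * Λ * (φ x - μ)) - 1) / (2 * Λ) := by ext x; rw [hW]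
    rw [this]
    exact ((Real.continuous_exp.comp_continuousOn
      (continuousOn_const.mul (hφ.continuousOn.sub continuousOn_const))).sub
        continuousOn_const).div_const _
  set r : ℕ → ℝ := fun j => d * (1 / 2 + (1 / 2) ^ (j + 1)) with hr
  set k : ℕ → ℝ := fun j => K * (1 - (1 / 2) ^ j) with hk
  have hhalf : ∀ j : ℕ, (1 / 2 : ℝ) ^ j ≤ 1 := fun j => pow_le_one₀ (by norm_num) (by norm_num)
  have hrd : ∀ j, r j ≤ d := by
    intro j
    have h1 : (1 / 2 : ℝ) ^ (j + 1) ≤ 1 / 2 := by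
      rw [pow_succ]; nlinarith [hhalf j]
    simp only [hr]
    nlinarith
  have hrU : ∀ j, closedBall x₁ (r j) ⊆ U := fun j =>
    (closedBall_subset_closedBall (hrd j)).trans hball
  set Y : ℕ → ℝ := fun j => ∫ x in ball x₁ (r j), max (W x - k j) 0 ^ (m + 3) with hY
  have hpos : ∀ (x : EuclideanSpace ℝ (Fin n)) (c : ℝ), 0 ≤ max (W x - c) 0 ^ (m + 3) := fun x c =>
    pow_nonneg (le_max_right _ _) _
  have hY0 : ∀ j, 0 ≤ Y j := fun j => integral_nonneg fun x => hpos x _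
  have hint : ∀ (c ρ : ℝ), closedBall x₁ ρ ⊆ U →
      IntegrableOn (fun x => max (W x - c) 0 ^ (m + 3)) (ball x₁ ρ) := by
    intro c ρ hρ
    have : ContinuousOn (fun x => max (W x - c) 0 ^ (m + 3)) (closedBall x₁ ρ) :=
      ((posPow_contDiff (m + 1)).continuous).comp_continuousOn
        ((hWC.mono hρ).sub continuousOn_const)
    exact (this.integrableOn_compact (isCompact_closedBall _ _)).mono_set ball_subset_closedBall
  have hrec : ∀ j, Y (j + 1) ^ n ≤ C0 / (d ^ n * K ^ (m + 3)) * β ^ j * Y j ^ (n + 1) := by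
    intro j
    obtain ⟨u, hu1, hu2, hu0, hu3, hu4, hu5⟩ :=
      energy_step hΛ m hU hφ hsym hell hR hweak hW hd hd1 hball hK j
    set A : Set (EuclideanSpace ℝ (Fin n)) := ball x₁ (r j) ∩ {x | k (j + 1) < W x} with hA
    have hAo : IsOpen A :=
      (hWC.mono (ball_subset_closedBall.trans (hrU j))).isOpen_inter_preimage isOpen_ball isOpen_Ioi
    have hAfin : volume A ≠ ⊤ :=
      ((measure_mono inter_subset_left).trans_lt (measure_ball_lt_top)).ne
    have hs := hsob u hu1 hu2 hu0 A hAo.measurableSet hAfin hu4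
    have hui : Integrable u := hu1.continuous.integrable_of_hasCompactSupport hu2
    have h1 : Y (j + 1) ≤ ∫ x, u x := by
      calc Y (j + 1) ≤ ∫ x in ball x₁ (r (j + 1)), u x := by
            refine setIntegral_mono_on (hint _ _ (hrU _)) hui.integrableOn measurableSet_ball ?_
            exact hu3
        _ ≤ ∫ x, u x := setIntegral_le_integral hui (Filter.Eventually.of_forall hu0)
    have h2 : ∫ x, ‖fderiv ℝ u x‖ ≤ C5 * ((64 * 4 ^ j) ^ 3 / d) * Y j := hu5
    set w : ℝ := (1 / 2) ^ j with hw
    have hw0 : 0 < w := by positivity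
    have hkk : k (j + 1) = k j + K * w / 2 := by simp only [hk, hw, pow_succ]; ring
    have h3 : (K * w / 2) ^ (m + 3) * (volume A).toReal ≤ Y j := by
      calc (K * w / 2) ^ (m + 3) * (volume A).toReal = ∫ x in A, (K * w / 2) ^ (m + 3) := by
            rw [setIntegral_const, smul_eq_mul, mul_comm]; rfl
        _ ≤ ∫ x in A, max (W x - k j) 0 ^ (m + 3) := by
            refine setIntegral_mono_on (integrableOn_const hAfin)
              ((hint _ _ (hrU j)).mono_set inter_subset_left) hAo.measurableSet ?_
            intro x hx
            have : k (j + 1) < W x := hx.2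
            refine pow_le_pow_left₀ (by positivity) (le_max_of_le_left ?_) _
            linarith
        _ ≤ Y j := setIntegral_mono_set (hint _ _ (hrU j))
            (Filter.Eventually.of_forall fun x => hpos x _)
            (Filter.Eventually.of_forall inter_subset_left)
    have h4 : (volume A).toReal ≤ (2 / (K * w)) ^ (m + 3) * Y j := by
      have e : (2 / (K * w)) ^ (m + 3) = ((K * w / 2) ^ (m + 3))⁻¹ := by
        rw [← inv_pow, inv_div]
      rw [e, ← div_eq_inv_mul, le_div_iff₀ (by positivity), mul_comm]
      exact h3
    have hd0 : 0 ≤ ∫ x, ‖fderiv ℝ u x‖ := integral_nonneg fun x => norm_nonneg _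
    have hYj := hY0 j
    calc Y (j + 1) ^ n ≤ (∫ x, u x) ^ n := pow_le_pow_left₀ (hY0 _) h1 n
      _ ≤ S * (∫ x, ‖fderiv ℝ u x‖) ^ n * (volume A).toReal := hs
      _ ≤ S * (C5 * ((64 * 4 ^ j) ^ 3 / d) * Y j) ^ n * ((2 / (K * w)) ^ (m + 3) * Y j) := by
        gcongr
      _ = C0 / (d ^ n * K ^ (m + 3)) * β ^ j * Y j ^ (n + 1) := by
        have e1 : (2 / (K * w)) ^ (m + 3) = 2 ^ (m + 3) / K ^ (m + 3) * (2 ^ (m + 3)) ^ j := by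
          have : 2 / (K * w) = 2 / K * 2 ^ j := by
            rw [hw, one_div, inv_pow]; field_simp
          rw [this, mul_pow, div_pow, ← pow_mul, ← pow_mul, mul_comm j]
        have e2 : (64 * (4:ℝ) ^ j) ^ 3 = 64 ^ 3 * 64 ^ j := by
          rw [mul_pow, ← pow_mul, mul_comm j, pow_mul]; norm_num
        rw [e1, e2, hβ, hC0, mul_pow (64 ^ n) (2 ^ (m + 3)) j, ← pow_mul 64 n j, mul_comm n j,
          pow_mul]
        have e3 : (C5 * (64 ^ 3 * 64 ^ j / d) * Y j) ^ n
            = (C5 * 64 ^ 3) ^ n * (64 ^ j) ^ n / d ^ n * Y j ^ n := by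
          rw [← mul_pow, ← div_pow, ← mul_pow]; congr 1; ring
        rw [e3]
        field_simp
        exact (pow_succ _ _).symm
  have hsm : C0 / (d ^ n * K ^ (m + 3)) * β ^ n * Y 0 ≤ 1 := by
    have e1 : Y 0 = ∫ x in ball x₁ d, max (W x) 0 ^ (m + 3) := by
      have hr0 : r 0 = d := by simp only [hr]; norm_num
      have hk0 : k 0 = 0 := by simp [hk]
      simp only [hY, hr0, hk0, sub_zero]
    rw [e1, div_mul_eq_mul_div, div_mul_eq_mul_div, div_le_one (by positivity)]
    exact hsmall
  have hdecay := fast_decay hY0 (by omega : n ≠ 0) (by positivity) hβ1 hrec hsm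
  by_contra hcon
  push Not at hcon
  -- a small ball where `W` exceeds `K`
  set ε := (W x₁ - K) / 2 with hε
  have hε0 : 0 < ε := by rw [hε]; linarith
  have hx₁U : x₁ ∈ U := hball (mem_closedBall_self hd.le)
  have hnhds : ∀ᶠ x in nhds x₁, K + ε < W x := by
    have := hWC.continuousAt (hU.mem_nhds hx₁U)
    exact this.eventually_const_lt (by rw [hε]; linarith)
  obtain ⟨ρ, hρ0, hρ⟩ := Metric.eventually_nhds_iff_ball.1 hnhds
  set ρ' := min ρ (d / 2) with hρ'
  have hρ'0 : 0 < ρ' := lt_min hρ0 (by positivity)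
  have hlow : ∀ j, ε ^ (m + 3) * (volume (ball x₁ ρ')).toReal ≤ Y j := by
    intro j
    have hsub : ball x₁ ρ' ⊆ ball x₁ (r j) := by
      apply ball_subset_ball
      refine (min_le_right _ _).trans ?_
      simp only [hr]
      have : (0:ℝ) < (1 / 2) ^ (j + 1) := by positivity
      nlinarith
    calc ε ^ (m + 3) * (volume (ball x₁ ρ')).toReal = ∫ x in ball x₁ ρ', ε ^ (m + 3) := by
          rw [setIntegral_const, smul_eq_mul, mul_comm]; rfl
      _ ≤ ∫ x in ball x₁ ρ', max (W x - k j) 0 ^ (m + 3) := by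
          refine setIntegral_mono_on (integrableOn_const measure_ball_lt_top.ne)
            ((hint _ _ (hrU j)).mono_set hsub) measurableSet_ball ?_
          intro x hx
          have h1 := hρ x (ball_subset_ball (min_le_left _ _) hx)
          refine pow_le_pow_left₀ hε0.le (le_max_of_le_left ?_) _
          have : k j ≤ K := by
            simp only [hk]
            have : (0:ℝ) < (1 / 2) ^ j := by positivity
            nlinarith
          linarith
      _ ≤ Y j := setIntegral_mono_set (hint _ _ (hrU j))
            (Filter.Eventually.of_forall fun x => hpos x _)
            (Filter.Eventually.of_forall hsub)
  have hvpos : 0 < (volume (ball x₁ ρ')).toReal :=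
    ENNReal.toReal_pos (measure_ball_pos _ _ hρ'0).ne' measure_ball_lt_top.ne
  have hβ2 : 1 < β := by
    have h1 : (1:ℝ) ≤ 64 ^ n := one_le_pow₀ (by norm_num)
    have h2 : (1:ℝ) < 2 ^ (m + 3) := one_lt_pow₀ (by norm_num) (by omega)
    rw [hβ]
    nlinarith
  have hlim : Filter.Tendsto (fun j => Y 0 * (β⁻¹) ^ j) Filter.atTop (nhds 0) := by
    have := (tendsto_pow_atTop_nhds_zero_of_lt_one (r := β⁻¹) (by positivity)
      (inv_lt_one_of_one_lt₀ hβ2)).const_mul (Y 0)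
    simpa using this
  have := ge_of_tendsto' hlim (fun j => (hlow j).trans (hdecay j))
  have hp : 0 < ε ^ (m + 3) * (volume (ball x₁ ρ')).toReal := by positivity
  linarith


lemma schoen_trick (n : ℕ) (p : ℝ) (hp : 0 < p) (q : ℕ) (hq : p ≤ q) (C : ℝ) (hC : 0 < C) :
    ∃ C' > (0:ℝ), ∀ (W : EuclideanSpace ℝ (Fin n) → ℝ) (x₀ : EuclideanSpace ℝ (Fin n)) (s : ℝ),
      0 < s → s < 1 → ContinuousOn W (ball x₀ s) → ∀ B : ℝ,
      (∀ x ∈ ball x₀ s, 0 ≤ W x ∧ W x ≤ B) →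
      (∀ x₁ d K, 0 < d → d ≤ 1 → closedBall x₁ d ⊆ ball x₀ s → d ^ 2 ≤ K →
        C * ∫ x in ball x₁ d, max (W x) 0 ^ q ≤ d ^ n * K ^ q → W x₁ ≤ K) →
      ∀ x ∈ ball x₀ (s / 2),
        W x ≤ C' * (s ^ (-(n:ℝ) / p) * (∫ y in ball x₀ s, W y ^ p) ^ (1 / p) + s ^ 2) := by
  set γ : ℝ := (n:ℝ) / p with hγ
  have hγ0 : 0 ≤ γ := by positivity
  set c0 : ℝ := 1 / (2 * 2 ^ γ) with hc0
  have hc00 : 0 < c0 := by positivity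
  set D : ℝ := C * (2 / c0) ^ q with hD
  have hD0 : 0 < D := by positivity
  refine ⟨2 ^ γ * (2 / c0 + D ^ (1 / p)), by positivity, ?_⟩
  intro W x₀ s hs hs1 hWc B hWB hce x hx
  have hxs : x ∈ ball x₀ s := ball_subset_ball (by linarith) hx
  set I : ℝ := ∫ y in ball x₀ s, W y ^ p with hI
  have hI0 : 0 ≤ I := setIntegral_nonneg measurableSet_ball
    fun y hy => rpow_nonneg (hWB y hy).1 p
  have hWp : IntegrableOn (fun y => W y ^ p) (ball x₀ s) := by
    have : IsFiniteMeasure (volume.restrict (ball x₀ s)) :=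
      ⟨by rw [Measure.restrict_apply_univ]; exact measure_ball_lt_top⟩
    refine Integrable.of_bound ?_ (B ^ p) ?_
    · exact (hWc.rpow_const fun x hx => Or.inr hp.le).aestronglyMeasurable measurableSet_ball
    · refine (ae_restrict_iff' measurableSet_ball).2 (Filter.Eventually.of_forall fun y hy => ?_)
      rw [Real.norm_of_nonneg (rpow_nonneg (hWB y hy).1 p)]
      exact rpow_le_rpow (hWB y hy).1 (hWB y hy).2 hp.le
  have hB0 : 0 ≤ B := (hWB x hxs).1.trans (hWB x hxs).2
  have hneg : s ^ (-(n:ℝ) / p) = (s ^ γ)⁻¹ := by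
    rw [neg_div, rpow_neg hs.le]
  have hsg : 0 < s ^ γ := rpow_pos_of_pos hs γ
  set g : EuclideanSpace ℝ (Fin n) → ℝ := fun y => (s - dist y x₀) ^ γ * W y with hg
  have hpd : ∀ y ∈ ball x₀ s, 0 < s - dist y x₀ := fun y hy => by
    have := mem_ball.1 hy; linarith
  have hbdd : BddAbove (g '' ball x₀ s) := by
    refine ⟨s ^ γ * B, ?_⟩
    rintro _ ⟨y, hy, rfl⟩
    have := hpd y hy
    have h1 : (s - dist y x₀) ^ γ ≤ s ^ γ :=
      rpow_le_rpow this.le (by linarith [dist_nonneg (x := y) (y := x₀)]) hγ0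
    exact mul_le_mul h1 (hWB y hy).2 (hWB y hy).1 hsg.le
  set M : ℝ := sSup (g '' ball x₀ s) with hM
  have hgM : ∀ y ∈ ball x₀ s, g y ≤ M := fun y hy => le_csSup hbdd ⟨y, hy, rfl⟩
  have key : M ≤ 2 / c0 * s ^ 2 * s ^ γ + D ^ (1 / p) * I ^ (1 / p) := by
    rcases le_or_gt M 0 with hM0 | hM0
    · exact hM0.trans (by positivity)
    obtain ⟨_, ⟨x₁, hx₁, rfl⟩, hgx⟩ := exists_lt_of_lt_csSup
      (⟨g x, x, hxs, rfl⟩ : (g '' ball x₀ s).Nonempty) (show M / 2 < M by linarith)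
    set d : ℝ := (s - dist x₁ x₀) / 2 with hd
    have hd0 : 0 < d := by have := hpd x₁ hx₁; simp only [hd]; linarith
    have hds : d ≤ s := by
      have := dist_nonneg (x := x₁) (y := x₀); simp only [hd]; linarith
    have hdist : ∀ y ∈ closedBall x₁ d, d ≤ s - dist y x₀ := by
      intro y hy
      have h1 := mem_closedBall.1 hy
      have h2 := dist_triangle y x₁ x₀
      simp only [hd] at h1 ⊢; linarith
    have hsub : closedBall x₁ d ⊆ ball x₀ s := fun y hy => by
      have := hdist y hy; rw [mem_ball]; linarith
    have hdg : 0 < d ^ γ := rpow_pos_of_pos hd0 γ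
    set T : ℝ := M / d ^ γ with hT
    have hT0 : 0 < T := by positivity
    have hMT : M = T * d ^ γ := by rw [hT]; field_simp
    have hWT : ∀ y ∈ closedBall x₁ d, W y ≤ T := by
      intro y hy
      rw [hT, le_div_iff₀ hdg, mul_comm]
      refine le_trans ?_ (hgM y (hsub hy))
      exact mul_le_mul_of_nonneg_right (rpow_le_rpow hd0.le (hdist y hy) hγ0)
        (hWB y (hsub hy)).1
    have hW1 : c0 * T < W x₁ := by
      have e : s - dist x₁ x₀ = 2 * d := by simp only [hd]; ring
      simp only [hg] at hgx
      rw [e, mul_rpow (by norm_num) hd0.le, hMT] at hgx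
      have h2 : (0:ℝ) < 2 ^ γ := by positivity
      rw [hc0, div_mul_eq_mul_div, div_lt_iff₀ (by positivity)]
      have : d ^ γ * (1 * T) < d ^ γ * (W x₁ * (2 * 2 ^ γ)) := by linarith
      exact lt_of_mul_lt_mul_left this hdg.le
    rcases lt_or_ge (c0 * T / 2) (d ^ 2) with hK | hK
    · have h1 : T ≤ 2 / c0 * d ^ 2 := by
        rw [div_mul_eq_mul_div, le_div_iff₀ hc00]; linarith
      have h2 : M ≤ 2 / c0 * s ^ 2 * s ^ γ := by
        rw [hMT]
        have h3 : d ^ γ ≤ s ^ γ := rpow_le_rpow hd0.le hds hγ0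
        have h4 : d ^ 2 ≤ s ^ 2 := pow_le_pow_left₀ hd0.le hds 2
        calc T * d ^ γ ≤ (2 / c0 * d ^ 2) * s ^ γ := by gcongr
          _ ≤ _ := by gcongr
      have : 0 ≤ D ^ (1 / p) * I ^ (1 / p) := by positivity
      linarith
    · have h1 : d ^ n * (c0 * T / 2) ^ q < C * ∫ x in ball x₁ d, max (W x) 0 ^ q := by
        by_contra hcon
        have := hce x₁ d (c0 * T / 2) hd0 (by linarith) hsub hK (not_lt.1 hcon)
        have : 0 < c0 * T := by positivity
        linarith
      have hsub' : ball x₁ d ⊆ ball x₀ s := ball_subset_closedBall.trans hsub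
      have h2 : ∫ x in ball x₁ d, max (W x) 0 ^ q ≤ T ^ ((q:ℝ) - p) * I := by
        calc ∫ x in ball x₁ d, max (W x) 0 ^ q
            ≤ ∫ x in ball x₁ d, T ^ ((q:ℝ) - p) * W x ^ p := by
              refine integral_mono_of_nonneg
                (Filter.Eventually.of_forall fun y => by positivity)
                ((hWp.mono_set hsub').const_mul _) ?_
              refine (ae_restrict_iff' measurableSet_ball).2
                (Filter.Eventually.of_forall fun y hy => ?_)
              have hy0 := (hWB y (hsub' hy)).1
              have hyT := hWT y (ball_subset_closedBall hy)
              simp only [max_eq_left hy0]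
              rw [← rpow_natCast (W y) q]
              have e : (q:ℝ) = ((q:ℝ) - p) + p := by ring
              have e2 : W y ^ (q:ℝ) = W y ^ ((q:ℝ) - p) * W y ^ p := by
                rw [← rpow_add_of_nonneg hy0 (by linarith) hp.le]
                congr 1
              rw [e2]
              exact mul_le_mul_of_nonneg_right (rpow_le_rpow hy0 hyT (by linarith))
                (rpow_nonneg hy0 p)
          _ = T ^ ((q:ℝ) - p) * ∫ x in ball x₁ d, W x ^ p := integral_const_mul _ _
          _ ≤ T ^ ((q:ℝ) - p) * I := by
              refine mul_le_mul_of_nonneg_left ?_ (by positivity)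
              refine setIntegral_mono_set hWp ?_ (Filter.Eventually.of_forall hsub')
              exact (ae_restrict_iff' measurableSet_ball).2
                (Filter.Eventually.of_forall fun y hy => rpow_nonneg (hWB y hy).1 p)
      have hTq : T ^ q = T ^ ((q:ℝ) - p) * T ^ p := by
        rw [← rpow_natCast T q, ← rpow_add hT0]; congr 1; ring
      have hTp : 0 < T ^ ((q:ℝ) - p) := by positivity
      have hMp : M ^ p = T ^ p * d ^ n := by
        rw [hMT, mul_rpow hT0.le hdg.le, ← rpow_mul hd0.le, hγ, div_mul_cancel₀ _ hp.ne',
          rpow_natCast]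
      have h3 : M ^ p ≤ D * I := by
        have h4 : T ^ ((q:ℝ) - p) * (M ^ p * (c0 / 2) ^ q) ≤ T ^ ((q:ℝ) - p) * (C * I) := by
          calc T ^ ((q:ℝ) - p) * (M ^ p * (c0 / 2) ^ q) = d ^ n * (c0 * T / 2) ^ q := by
                rw [hMp, mul_div_right_comm, mul_pow (c0 / 2) T q, hTq]; ring
            _ ≤ C * (T ^ ((q:ℝ) - p) * I) := h1.le.trans (mul_le_mul_of_nonneg_left h2 hC.le)
            _ = _ := by ring
        have h5 := le_of_mul_le_mul_left h4 hTp
        have e : (c0 / 2) ^ q * (2 / c0) ^ q = 1 := by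
          rw [← mul_pow]; field_simp; simp
        calc M ^ p = M ^ p * (c0 / 2) ^ q * (2 / c0) ^ q := by rw [mul_assoc, e, mul_one]
          _ ≤ C * I * (2 / c0) ^ q := by gcongr
          _ = D * I := by rw [hD]; ring
      have h6 : M ≤ D ^ (1 / p) * I ^ (1 / p) := by
        rw [← mul_rpow hD0.le hI0]
        calc M = (M ^ p) ^ (1 / p) := by
              rw [← rpow_mul hM0.le, mul_one_div_cancel hp.ne', rpow_one]
          _ ≤ _ := rpow_le_rpow (by positivity) h3 (by positivity)
      have : 0 ≤ 2 / c0 * s ^ 2 * s ^ γ := by positivity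
      linarith
  have hfin : (s / 2) ^ γ * W x ≤ M := by
    refine le_trans ?_ (hgM x hxs)
    have h1 := mem_ball.1 hx
    exact mul_le_mul_of_nonneg_right (rpow_le_rpow (by positivity) (by linarith) hγ0)
      (hWB x hxs).1
  rw [div_rpow hs.le (by norm_num)] at hfin
  rw [hneg]
  have h2 : (0:ℝ) < 2 ^ γ := by positivity
  have h3 : W x ≤ 2 ^ γ * (s ^ γ)⁻¹ * (2 / c0 * s ^ 2 * s ^ γ + D ^ (1 / p) * I ^ (1 / p)) := by
    calc W x = 2 ^ γ * (s ^ γ)⁻¹ * (s ^ γ / 2 ^ γ * W x) := by field_simp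
      _ ≤ _ := mul_le_mul_of_nonneg_left (hfin.trans key) (by positivity)
  refine h3.trans ?_
  have e : 2 ^ γ * (s ^ γ)⁻¹ * (2 / c0 * s ^ 2 * s ^ γ + D ^ (1 / p) * I ^ (1 / p))
      = 2 ^ γ * (2 / c0 * s ^ 2 + D ^ (1 / p) * ((s ^ γ)⁻¹ * I ^ (1 / p))) := by
    field_simp
  rw [e, mul_assoc]
  refine mul_le_mul_of_nonneg_left ?_ h2.le
  have i1 : 0 ≤ (s ^ γ)⁻¹ * I ^ (1 / p) := by positivity
  have i2 : 0 ≤ D ^ (1 / p) := by positivity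
  have i3 : 0 ≤ 2 / c0 := by positivity
  have i4 : 0 ≤ s ^ 2 := by positivity
  nlinarith [mul_nonneg i2 i4, mul_nonneg i3 i1]

lemma sol_reduce {n : ℕ} {Λ κ : ℝ}
    {a : Fin n → Fin n → EuclideanSpace ℝ (Fin n) → ℝ → ℝ}
    {ρ : EuclideanSpace ℝ (Fin n) → ℝ → ℝ}
    {f : EuclideanSpace ℝ (Fin n) → ℝ}
    {F : EuclideanSpace ℝ (Fin n) → ℝ → EuclideanSpace ℝ (Fin n) → ℝ}
    (hG : GoodCoeffs n Λ a ρ f F) {φ : EuclideanSpace ℝ (Fin n) → ℝ}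
    (hS : IsSolution n κ a ρ f F φ) :
    ∃ R : EuclideanSpace ℝ (Fin n) → ℝ,
      (∀ x ∈ ball (0 : EuclideanSpace ℝ (Fin n)) 1, R x ≤ 2 * (2 + ‖fderiv ℝ φ x‖ ^ 2)) ∧
      ∀ ψ : EuclideanSpace ℝ (Fin n) → ℝ, ContDiff ℝ 1 ψ → HasCompactSupport ψ →
        tsupport ψ ⊆ ball (0 : EuclideanSpace ℝ (Fin n)) 1 →
        Integrable (fun x => Bf (fun i j => a i j x (φ x)) (fderiv ℝ φ x) (fderiv ℝ ψ x)
          - R x * ψ x) ∧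
        ∫ x, (Bf (fun i j => a i j x (φ x)) (fderiv ℝ φ x) (fderiv ℝ ψ x) - R x * ψ x) = 0 := by
  obtain ⟨hac, -, -, hρc, hρ, hfc, hf, hFc, hF⟩ := hG
  obtain ⟨hφ, -, hweak⟩ := hS
  set U := ball (0 : EuclideanSpace ℝ (Fin n)) 1 with hU
  have hUo : IsOpen U := isOpen_ball
  have hφc : ContinuousOn φ U := hφ.continuousOn
  have hdc : ContinuousOn (fderiv ℝ φ) U := hφ.continuousOn_fderiv_of_isOpen hUo le_rfl
  have hgc : ContinuousOn (gradient φ) U :=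
    (InnerProductSpace.toDual ℝ (EuclideanSpace ℝ (Fin n))).symm.continuous.comp_continuousOn hdc
  have hgn : ∀ x, ‖gradient φ x‖ = ‖fderiv ℝ φ x‖ := fun x =>
    (InnerProductSpace.toDual ℝ (EuclideanSpace ℝ (Fin n))).symm.norm_map _
  have hpair : ContinuousOn (fun x => (x, φ x)) U := continuousOn_id.prodMk hφc
  have hpm : MapsTo (fun x => (x, φ x)) U (U ×ˢ (Set.univ : Set ℝ)) := fun x hx => ⟨hx, trivial⟩
  set V : Fin n → EuclideanSpace ℝ (Fin n) → ℝ :=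
    fun j x => ∑ i, a i j x (φ x) * fderiv ℝ φ x (EuclideanSpace.single i 1) with hV
  set R : EuclideanSpace ℝ (Fin n) → ℝ := fun x =>
    ρ x (φ x) * (1 - (1/2) * f x * Real.exp (φ x) + F x (φ x) (gradient φ x)) with hR
  have hVc : ∀ j, ContinuousOn (V j) U := fun j =>
    continuousOn_finsetSum _ fun i _ =>
      ((hac i j).comp hpair hpm).mul (hdc.clm_apply continuousOn_const)
  have hRc : ContinuousOn R U := by
    refine (hρc.comp hpair hpm).mul ((continuousOn_const.sub
      ((continuousOn_const.mul hfc).mul hφc.rexp)).add ?_)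
    exact hFc.comp (g := fun p : EuclideanSpace ℝ (Fin n) × ℝ × EuclideanSpace ℝ (Fin n) =>
      F p.1 p.2.1 p.2.2) (f := fun x => (x, φ x, gradient φ x))
      (continuousOn_id.prodMk (hφc.prodMk hgc)) (fun x hx => ⟨hx, trivial⟩)
  have hsum : ∀ (ψ : EuclideanSpace ℝ (Fin n) → ℝ) x,
      ∑ i : Fin n, ∑ j : Fin n,
          a i j x (φ x) * fderiv ℝ φ x (EuclideanSpace.single i 1) *
            fderiv ℝ ψ x (EuclideanSpace.single j 1)
        = ∑ j, V j x * fderiv ℝ ψ x (EuclideanSpace.single j 1) := by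
    intro ψ x
    rw [Finset.sum_comm]
    simp only [hV, Finset.sum_mul]
  refine ⟨R, ?_, ?_⟩
  · intro x hx
    have h1 := hρ x hx (φ x)
    have h2 := hf x hx
    have h3 := (abs_le.1 (hF x hx (φ x) (gradient φ x))).2
    rw [hgn] at h3
    have h4 : 0 ≤ f x * Real.exp (φ x) := mul_nonneg h2.1 (Real.exp_pos _).le
    have h5 : 1 - (1/2) * f x * Real.exp (φ x) + F x (φ x) (gradient φ x)
        ≤ 2 + ‖fderiv ℝ φ x‖ ^ 2 := by linarith
    have h6 : 0 ≤ 2 + ‖fderiv ℝ φ x‖ ^ 2 := by positivity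
    calc R x ≤ ρ x (φ x) * (2 + ‖fderiv ℝ φ x‖ ^ 2) :=
          mul_le_mul_of_nonneg_left h5 (by linarith)
      _ ≤ _ := mul_le_mul_of_nonneg_right h1.2 h6
  · intro ψ h hc hs
    have hB : ∀ x, Bf (fun i j => a i j x (φ x)) (fderiv ℝ φ x) (fderiv ℝ ψ x)
        = ∑ j, V j x * fderiv ℝ ψ x (EuclideanSpace.single j 1) := fun x => hsum ψ x
    simp only [hB]
    have hi := weak_integrable hUo hVc hRc h hc hs
    refine ⟨hi.1.sub hi.2, ?_⟩
    refine test_C1 hUo hVc hRc (fun ψ' h' hc' hs' => ?_) h hc hs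
    have := hweak ψ' h' hc' hs'
    simp only [hsum] at this
    exact this

/-- **Local boundedness** (the estimate `(4.8)` in the proof of Theorem 4.2):
for every `p > 0` there is a constant `C > 0` depending only on `n`, `Λ` and `p` such that
for every solution `φ`, every ball `B_s(x₀) ⊆ B₁` with `s ∈ (0,1)`, the function
`v = φ - inf_{B_s(x₀)} φ` satisfies
`sup_{B_{s/2}(x₀)} v ≤ C e^{2Λκ} (s^{-n/p} ‖v‖_{L^p(B_s(x₀))} + s²)`. -/
theorem local_boundedness (n : ℕ) (hn : 2 ≤ n) (Λ : ℝ) (hΛ : 1 ≤ Λ)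
    (p : ℝ) (hp : 0 < p) :
    ∃ C > (0:ℝ),
      ∀ κ : ℝ, 1 ≤ κ →
      ∀ (a : Fin n → Fin n → EuclideanSpace ℝ (Fin n) → ℝ → ℝ)
        (ρ : EuclideanSpace ℝ (Fin n) → ℝ → ℝ)
        (f : EuclideanSpace ℝ (Fin n) → ℝ)
        (F : EuclideanSpace ℝ (Fin n) → ℝ → EuclideanSpace ℝ (Fin n) → ℝ),
        GoodCoeffs n Λ a ρ f F →
        ∀ φ : EuclideanSpace ℝ (Fin n) → ℝ, IsSolution n κ a ρ f F φ →
        ∀ (x₀ : EuclideanSpace ℝ (Fin n)) (s : ℝ), s ∈ Set.Ioo (0:ℝ) 1 →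
          ball x₀ s ⊆ ball (0 : EuclideanSpace ℝ (Fin n)) 1 →
          ∀ x ∈ ball x₀ (s/2),
            φ x - sInf (φ '' ball x₀ s) ≤
              C * Real.exp (2 * Λ * κ) *
                (s ^ (-(n:ℝ)/p) *
                    (∫ y in ball x₀ s, (φ y - sInf (φ '' ball x₀ s)) ^ p) ^ (1/p)
                  + s ^ 2) := by
  obtain ⟨m, hm⟩ := exists_nat_ge p
  obtain ⟨C, hC, hce⟩ := center_estimate n hn Λ hΛ m
  obtain ⟨C', hC', hsch⟩ := schoen_trick n p hp (m + 3) (by push_cast; linarith) C hC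
  refine ⟨C', hC', ?_⟩
  intro κ hκ a ρ f F hG φ hS x₀ s hs hsub x hx
  obtain ⟨R, hR, hweak⟩ := sol_reduce hG hS
  have hΛ0 : 0 < Λ := by linarith
  have hφ := hS.1
  have hφb := hS.2.1
  set μ := sInf (φ '' ball x₀ s) with hμ
  have hbb : BddBelow (φ '' ball x₀ s) := ⟨0, by
    rintro _ ⟨y, hy, rfl⟩; exact (hφb y (hsub hy)).1⟩
  have hx₀ : x₀ ∈ ball x₀ s := mem_ball_self hs.1
  have hμ0 : 0 ≤ μ := le_csInf ⟨_, x₀, hx₀, rfl⟩ (by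
    rintro _ ⟨y, hy, rfl⟩; exact (hφb y (hsub hy)).1)
  have hv0 : ∀ y ∈ ball x₀ s, 0 ≤ φ y - μ := fun y hy =>
    sub_nonneg.2 (csInf_le hbb ⟨y, hy, rfl⟩)
  have hvκ : ∀ y ∈ ball x₀ s, φ y - μ ≤ κ := fun y hy => by
    have := (hφb y (hsub hy)).2; linarith
  set E := Real.exp (2 * Λ * κ) with hE
  have hE1 : 1 ≤ E := Real.one_le_exp (by positivity)
  set W : EuclideanSpace ℝ (Fin n) → ℝ :=
    fun y => (Real.exp (2 * Λ * (φ y - μ)) - 1) / (2 * Λ) with hW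
  have hvW : ∀ y ∈ ball x₀ s, φ y - μ ≤ W y := fun y hy => by
    simp only [hW]
    rw [le_div_iff₀ (by positivity)]
    have := Real.add_one_le_exp (2 * Λ * (φ y - μ))
    linarith
  have hWv : ∀ y ∈ ball x₀ s, W y ≤ E * (φ y - μ) := fun y hy => by
    simp only [hW]
    rw [div_le_iff₀ (by positivity)]
    set t := 2 * Λ * (φ y - μ) with ht
    have ht0 : 0 ≤ t := mul_nonneg (by positivity) (hv0 y hy)
    have h1 := Real.add_one_le_exp (-t)
    have h2 : Real.exp t - 1 ≤ Real.exp t * t := by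
      have e : Real.exp t * Real.exp (-t) = 1 := by rw [← Real.exp_add]; simp
      nlinarith [mul_le_mul_of_nonneg_left h1 (Real.exp_pos t).le]
    have h3 : Real.exp t ≤ E := Real.exp_le_exp.2
      (mul_le_mul_of_nonneg_left (hvκ y hy) (by positivity))
    calc Real.exp t - 1 ≤ E * t := h2.trans (mul_le_mul_of_nonneg_right h3 ht0)
      _ = E * (φ y - μ) * (2 * Λ) := by rw [ht]; ring
  have hW0 : ∀ y ∈ ball x₀ s, 0 ≤ W y := fun y hy => (hv0 y hy).trans (hvW y hy)
  have hφc : ContinuousOn φ (ball x₀ s) := hφ.continuousOn.mono hsub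
  have hWc : ContinuousOn W (ball x₀ s) := by
    simp only [hW]
    exact (((continuousOn_const.mul (hφc.sub continuousOn_const)).rexp).sub
      continuousOn_const).div_const _
  have main := hsch W x₀ s hs.1 hs.2 hWc (E * κ)
    (fun y hy => ⟨hW0 y hy, (hWv y hy).trans
      (mul_le_mul_of_nonneg_left (hvκ y hy) (by linarith))⟩)
    (fun x₁ d K hd hd1 hb hK hs' => hce (ball 0 1) isOpen_ball φ hφ
      (fun x i j => a i j x (φ x)) (fun x i j => hG.2.1 i j x (φ x))
      (fun x hx ξ => hG.2.2.1 x hx (φ x) ξ) R hR hweak μ W (fun _ => rfl) x₁ d K hd hd1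
      (hb.trans hsub) hK hs') x hx
  have hxs : x ∈ ball x₀ s := ball_subset_ball (by linarith [hs.1]) hx
  have hvp : IntegrableOn (fun y => (E * (φ y - μ)) ^ p) (ball x₀ s) := by
    have : IsFiniteMeasure (volume.restrict (ball x₀ s)) :=
      ⟨by rw [Measure.restrict_apply_univ]; exact measure_ball_lt_top⟩
    refine Integrable.of_bound ?_ ((E * κ) ^ p) ?_
    · exact ((continuousOn_const.mul (hφc.sub continuousOn_const)).rpow_const
        fun x hx => Or.inr hp.le).aestronglyMeasurable measurableSet_ball
    · refine (ae_restrict_iff' measurableSet_ball).2 (Filter.Eventually.of_forall fun y hy => ?_)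
      have h0 : 0 ≤ E * (φ y - μ) := mul_nonneg (by linarith) (hv0 y hy)
      rw [Real.norm_of_nonneg (rpow_nonneg h0 p)]
      exact rpow_le_rpow h0 (mul_le_mul_of_nonneg_left (hvκ y hy) (by linarith)) hp.le
  set J := ∫ y in ball x₀ s, (φ y - μ) ^ p with hJ
  have hJ0 : 0 ≤ J := setIntegral_nonneg measurableSet_ball
    fun y hy => rpow_nonneg (hv0 y hy) p
  have hI0 : 0 ≤ ∫ y in ball x₀ s, W y ^ p := setIntegral_nonneg measurableSet_ball
    fun y hy => rpow_nonneg (hW0 y hy) p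
  have hIJ : ∫ y in ball x₀ s, W y ^ p ≤ E ^ p * J := by
    calc ∫ y in ball x₀ s, W y ^ p ≤ ∫ y in ball x₀ s, (E * (φ y - μ)) ^ p := by
          refine integral_mono_of_nonneg ?_ hvp ?_
          · exact (ae_restrict_iff' measurableSet_ball).2
              (Filter.Eventually.of_forall fun y hy => rpow_nonneg (hW0 y hy) p)
          · exact (ae_restrict_iff' measurableSet_ball).2
              (Filter.Eventually.of_forall fun y hy =>
                rpow_le_rpow (hW0 y hy) (hWv y hy) hp.le)
      _ = ∫ y in ball x₀ s, E ^ p * (φ y - μ) ^ p :=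
          setIntegral_congr_fun measurableSet_ball
            fun y hy => mul_rpow (by linarith) (hv0 y hy)
      _ = E ^ p * J := integral_const_mul _ _
  have hroot : (∫ y in ball x₀ s, W y ^ p) ^ (1 / p) ≤ E * J ^ (1 / p) := by
    calc (∫ y in ball x₀ s, W y ^ p) ^ (1 / p) ≤ (E ^ p * J) ^ (1 / p) :=
          rpow_le_rpow hI0 hIJ (by positivity)
      _ = E * J ^ (1 / p) := by
          rw [mul_rpow (by positivity) hJ0, ← rpow_mul (by positivity),
            mul_one_div_cancel hp.ne', rpow_one]
  have hs0 := hs.1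
  have hsn : 0 ≤ s ^ (-(n:ℝ) / p) := by positivity
  calc φ x - μ ≤ W x := hvW x hxs
    _ ≤ _ := main
    _ ≤ C' * (s ^ (-(n:ℝ) / p) * (E * J ^ (1 / p)) + E * s ^ 2) := by
        have : s ^ 2 ≤ E * s ^ 2 := le_mul_of_one_le_left (by positivity) hE1
        gcongr
    _ = C' * E * (s ^ (-(n:ℝ) / p) * J ^ (1 / p) + s ^ 2) := by ring
end

section
/- Assume additionally that each a_{ij} is continuously differentiable on B₁ × ℝ with |∇_x a_{ij}| + |∂_z a_{ij}| ≤ Λ₁ for some constant Λ₁ > 0. Then there exists a constant C > 0, depending only on n, Λ and Λ₁, with the following property. Let φ be a solution, let x₀ and s ∈ (0,1) be such that B_s(x₀) ⊆ B₁, and let ŵ ∈ C²(B_s(x₀)) ∩ C⁰(closure of B_s(x₀)) satisfy the frozen-coefficient equation Σ_{i,j} a_{ij}(x₀, φ(x₀)) ∂ᵢ∂ⱼŵ = 0 in B_s(x₀), ŵ = φ on ∂B_s(x₀), and ∫_{B_s(x₀)} |∇ŵ|² dx < ∞. Then, with h := osc_{B_s(x₀)} φ (the oscillation of φ over B_s(x₀)),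 one has ∫_{B_s(x₀)} |∇(φ − ŵ)|² dx ≤ C (h + h² + s²) ∫_{B_s(x₀)} |∇φ|² dx + C e^{2κ} s^{n+2}. -/
open MeasureTheory Metric Real Set

/-- The coefficients `aᵢⱼ` are continuously differentiable on `B₁ × ℝ` with
`|∇ₓ aᵢⱼ| + |∂_z aᵢⱼ| ≤ Λ₁`. -/
def C1Bound (n : ℕ) (Λ₁ : ℝ)
    (a : Fin n → Fin n → EuclideanSpace ℝ (Fin n) → ℝ → ℝ) : Prop :=
  (∀ i j, ContDiffOn ℝ 1 (fun p : EuclideanSpace ℝ (Fin n) × ℝ => a i j p.1 p.2)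
      ((ball (0 : EuclideanSpace ℝ (Fin n)) 1) ×ˢ (Set.univ : Set ℝ))) ∧
  (∀ i j, ∀ x ∈ ball (0 : EuclideanSpace ℝ (Fin n)) 1, ∀ z : ℝ,
      ‖fderiv ℝ (fun y => a i j y z) x‖ + |deriv (fun w => a i j x w) z| ≤ Λ₁)

section Helpers
open Filter Topology

variable {E : Type*} [NormedAddCommGroup E] [InnerProductSpace ℝ E] [FiniteDimensional ℝ E]
  [MeasurableSpace E] [BorelSpace E] {μ : Measure E} [μ.IsAddHaarMeasure]

/-- Uniform `C¹` approximation of compactly supported `C¹` functions by smooth ones. -/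
lemma exists_smooth_approx {U : Set E} (hU : IsOpen U) {ψ : E → ℝ} (hψ : ContDiff ℝ 1 ψ)
    (hc : HasCompactSupport ψ) (hs : tsupport ψ ⊆ U) :
    ∃ K : Set E, IsCompact K ∧ K ⊆ U ∧ tsupport ψ ⊆ K ∧ ∀ ε > 0, ∃ ψ' : E → ℝ,
      ContDiff ℝ (⊤ : ℕ∞) ψ' ∧ tsupport ψ' ⊆ K ∧ (∀ x, |ψ' x - ψ x| ≤ ε) ∧
      ∀ x, ‖fderiv ℝ ψ' x - fderiv ℝ ψ x‖ ≤ ε := by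
  let μ : Measure E := Measure.addHaar
  obtain ⟨δ, hδ, hδU⟩ := IsCompact.exists_cthickening_subset_open hc hU hs
  have hK : IsCompact (cthickening δ (tsupport ψ)) := IsCompact.cthickening hc
  refine ⟨cthickening δ (tsupport ψ), hK, hδU, self_subset_cthickening _, fun ε hε => ?_⟩
  have hcont := hψ.continuous_fderiv one_ne_zero
  have u1 : UniformContinuous ψ := hc.uniformContinuous_of_continuous hψ.continuous
  have u2 : UniformContinuous (fderiv ℝ ψ) :=
    (hc.fderiv ℝ).uniformContinuous_of_continuous hcont
  obtain ⟨d1, hd1, h1⟩ := Metric.uniformContinuous_iff.1 u1 ε hε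
  obtain ⟨d2, hd2, h2⟩ := Metric.uniformContinuous_iff.1 u2 ε hε
  set r := min δ (min d1 d2) with hr
  have hr0 : 0 < r := lt_min hδ (lt_min hd1 hd2)
  let b : ContDiffBump (0 : E) := ⟨r / 2, r, by linarith, by linarith⟩
  have hb : b.rOut = r := rfl
  let ψ' : E → ℝ := convolution (b.normed μ) ψ (ContinuousLinearMap.lsmul ℝ ℝ) μ
  have hL : (ContinuousLinearMap.lsmul ℝ ℝ : ℝ →L[ℝ] ℝ →L[ℝ] ℝ).precompR E
      = (ContinuousLinearMap.lsmul ℝ ℝ : ℝ →L[ℝ] (E →L[ℝ] ℝ) →L[ℝ] (E →L[ℝ] ℝ)) := by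
    ext a L
    simp [ContinuousLinearMap.precompR_apply]
  have hfd : ∀ x, fderiv ℝ ψ' x
      = convolution (b.normed μ) (fderiv ℝ ψ) (ContinuousLinearMap.lsmul ℝ ℝ) μ x := by
    intro x
    have := (hc.hasFDerivAt_convolution_right (ContinuousLinearMap.lsmul ℝ ℝ)
      ((b.continuous_normed (μ := μ)).locallyIntegrable (μ := μ)) hψ x).fderiv
    rw [hL] at this
    exact this
  refine ⟨ψ', ?_, ?_, ?_, ?_⟩
  · exact b.hasCompactSupport_normed.contDiff_convolution_left _ b.contDiff_normed
      (hψ.continuous.locallyIntegrable)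
  · apply closure_minimal _ isClosed_cthickening
    refine (support_convolution_subset _).trans ?_
    rintro x ⟨y, hy, z, hz, rfl⟩
    rw [b.support_normed_eq, hb] at hy
    have hyr : ‖y‖ < r := by simpa using hy
    apply thickening_subset_cthickening
    rw [mem_thickening_iff]
    refine ⟨z, subset_tsupport _ hz, ?_⟩
    simp only [dist_eq_norm, add_sub_cancel_right]
    exact hyr.trans_le (min_le_left _ _)
  · intro x
    have := b.dist_normed_convolution_le (μ := μ) (g := ψ) (x₀ := x) (ε := ε)
      hψ.continuous.aestronglyMeasurable (fun y hy => (h1 (lt_of_lt_of_le hy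
        ((min_le_right _ _).trans (min_le_left _ _)))).le)
    simpa [Real.dist_eq] using this
  · intro x
    have := b.dist_normed_convolution_le (μ := μ) (g := fderiv ℝ ψ) (x₀ := x) (ε := ε)
      hcont.aestronglyMeasurable (fun y hy => (h2 (lt_of_lt_of_le hy
        ((min_le_right _ _).trans (min_le_right _ _)))).le)
    rw [hfd x, ← dist_eq_norm]
    exact this

/-- Weak divergence equation tested against compactly supported `C¹` functions. -/
def WeakEq (μ : Measure E) (U : Set E) (X : E → E) (g : E → ℝ) : Prop :=
  ∀ ψ : E → ℝ, ContDiff ℝ 1 ψ → HasCompactSupport ψ → tsupport ψ ⊆ U →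
    ∫ x in U, fderiv ℝ ψ x (X x) ∂μ = ∫ x in U, g x * ψ x ∂μ

lemma integrableOn_test {U : Set E} (hU : IsOpen U) {f h : E → ℝ}
    (hf : ContinuousOn f U) {K : Set E} (hK : IsCompact K) (hKU : K ⊆ U)
    (hfh : ∀ x ∈ U, h x = f x) (h0 : ∀ x ∉ K, h x = 0) : Integrable h μ := by
  have : IntegrableOn h K μ :=
    (hf.mono hKU).integrableOn_compact hK |>.congr_fun (fun x hx => (hfh x (hKU hx)).symm)
      hK.measurableSet
  rwa [integrableOn_iff_integrable_of_support_subset] at this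
  intro x hx
  by_contra hxK
  exact hx (h0 x hxK)

lemma fderiv_zero_off {ψ : E → ℝ} {x : E} (hx : x ∉ tsupport ψ) : fderiv ℝ ψ x = 0 := by
  by_contra h
  exact hx (support_fderiv_subset ℝ h)

lemma weakEq_of_smooth {U : Set E} (hU : IsOpen U) {X : E → E} {g : E → ℝ}
    (hX : ContinuousOn X U) (hg : ContinuousOn g U)
    (h : ∀ ψ : E → ℝ, ContDiff ℝ (⊤ : ℕ∞) ψ → HasCompactSupport ψ → tsupport ψ ⊆ U →
      ∫ x in U, fderiv ℝ ψ x (X x) ∂μ = ∫ x in U, g x * ψ x ∂μ) : WeakEq μ U X g := by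
  intro ψ hψ hc hs
  obtain ⟨K, hK, hKU, hψK, happ⟩ := exists_smooth_approx hU hψ hc hs
  have key : ∀ χ : E → ℝ, ContDiff ℝ 1 χ → tsupport χ ⊆ K →
      (Integrable (fun x => fderiv ℝ χ x (X x)) μ ∧ Integrable (fun x => g x * χ x) μ) ∧
      (∫ x in U, fderiv ℝ χ x (X x) ∂μ = ∫ x in K, fderiv ℝ χ x (X x) ∂μ) ∧
      (∫ x in U, g x * χ x ∂μ = ∫ x in K, g x * χ x ∂μ) := by
    intro χ hχ hχK
    have z1 : ∀ x ∉ K, fderiv ℝ χ x (X x) = 0 := fun x hx => by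
      rw [fderiv_zero_off (fun h => hx (hχK h))]; rfl
    have z2 : ∀ x ∉ K, g x * χ x = 0 := fun x hx => by
      rw [image_eq_zero_of_notMem_tsupport (fun h => hx (hχK h)), mul_zero]
    refine ⟨⟨integrableOn_test hU (f := fun x => fderiv ℝ χ x (X x)) ?_ hK hKU
      (fun _ _ => rfl) z1, integrableOn_test hU (f := fun x => g x * χ x) ?_ hK hKU
      (fun _ _ => rfl) z2⟩, ?_, ?_⟩
    · exact (hχ.continuous_fderiv one_ne_zero).continuousOn.clm_apply hX
    · exact hg.mul hχ.continuous.continuousOn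
    · exact setIntegral_eq_of_subset_of_forall_sdiff_eq_zero hU.measurableSet hKU
        (fun x hx => z1 x hx.2)
    · exact setIntegral_eq_of_subset_of_forall_sdiff_eq_zero hU.measurableSet hKU
        (fun x hx => z2 x hx.2)
  obtain ⟨⟨i1, i2⟩, e1, e2⟩ := key ψ hψ hψK
  set M1 := ∫ x in K, ‖X x‖ ∂μ
  set M2 := ∫ x in K, |g x| ∂μ
  have hM1i : IntegrableOn (fun x => ‖X x‖) K μ := (hX.mono hKU).norm.integrableOn_compact hK
  have hM2i : IntegrableOn (fun x => |g x|) K μ := (hg.mono hKU).abs.integrableOn_compact hK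
  have hM1 : 0 ≤ M1 := integral_nonneg fun _ => norm_nonneg _
  have hM2 : 0 ≤ M2 := integral_nonneg fun _ => abs_nonneg _
  rw [← sub_eq_zero]
  apply abs_eq_zero.1
  apply le_antisymm _ (abs_nonneg _)
  apply le_of_forall_pos_le_add
  intro ε hε
  obtain ⟨χ, hχ, hχK, a1, a2⟩ := happ (ε / (M1 + M2 + 1)) (by positivity)
  set τ := ε / (M1 + M2 + 1) with hτ
  have hχ1 : ContDiff ℝ 1 χ := hχ.of_le (by exact_mod_cast le_top)
  obtain ⟨⟨j1, j2⟩, f1, f2⟩ := key χ hχ1 hχK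
  have hh := h χ hχ (hK.of_isClosed_subset (isClosed_tsupport _) hχK) (hχK.trans hKU)
  rw [f1, f2] at hh
  rw [e1, e2]
  have b1 : |∫ x in K, fderiv ℝ ψ x (X x) ∂μ - ∫ x in K, fderiv ℝ χ x (X x) ∂μ| ≤ τ * M1 := by
    rw [← integral_sub i1.integrableOn j1.integrableOn, ← integral_const_mul, ← Real.norm_eq_abs]
    apply norm_integral_le_of_norm_le (hM1i.const_mul τ)
    filter_upwards with x
    rw [← sub_apply]
    refine (ContinuousLinearMap.le_opNorm _ _).trans ?_
    gcongr
    rw [norm_sub_rev]; exact a2 x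
  have b2 : |∫ x in K, g x * ψ x ∂μ - ∫ x in K, g x * χ x ∂μ| ≤ τ * M2 := by
    rw [← integral_sub i2.integrableOn j2.integrableOn, ← integral_const_mul, ← Real.norm_eq_abs]
    apply norm_integral_le_of_norm_le (hM2i.const_mul τ)
    filter_upwards with x
    rw [← mul_sub, Real.norm_eq_abs, abs_mul, mul_comm]
    gcongr
    rw [abs_sub_comm]; exact a1 x
  have : τ * M1 + τ * M2 ≤ ε := by
    have : τ * (M1 + M2 + 1) = ε := by rw [hτ]; field_simp
    have hτ0 : 0 ≤ τ := by positivity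
    nlinarith
  rw [abs_le] at *
  constructor <;> linarith [b1.1, b1.2, b2.1, b2.2]

lemma WeakEq.mono {U V : Set E} (hU : IsOpen U) (hVU : V ⊆ U) {X : E → E} {g : E → ℝ}
    (h : WeakEq μ U X g) : WeakEq μ V X g := by
  intro ψ hψ hc hs
  have := h ψ hψ hc (hs.trans hVU)
  rwa [setIntegral_eq_of_subset_of_forall_sdiff_eq_zero hU.measurableSet hVU,
    setIntegral_eq_of_subset_of_forall_sdiff_eq_zero hU.measurableSet hVU] at this
  · intro x hx
    rw [image_eq_zero_of_notMem_tsupport (fun h => hx.2 (hs h)), mul_zero]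
  · intro x hx
    rw [fderiv_zero_off (fun h => hx.2 (hs h))]; rfl

/-- Weak equation by integration by parts, one direction. -/
lemma weakEq_smul {U : Set E} (hU : IsOpen U) {u : E → ℝ} (hu : ContDiffOn ℝ 1 u U) (e : E) :
    WeakEq μ U (fun x => u x • e) (fun x => - fderiv ℝ u x e) := by
  intro ψ hψ hc hs
  have hcd : ContinuousOn (fderiv ℝ u) U := hu.continuousOn_fderiv_of_isOpen hU le_rfl
  have z1 : ∀ x ∉ tsupport ψ, u x * fderiv ℝ ψ x e = 0 := fun x hx => by
    rw [fderiv_zero_off hx]; simp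
  have z2 : ∀ x ∉ tsupport ψ, fderiv ℝ u x e * ψ x = 0 := fun x hx => by
    rw [image_eq_zero_of_notMem_tsupport hx]; simp
  have hibp := integral_mul_fderiv_eq_neg_fderiv_mul_of_integrable (μ := μ) (f := u) (g := ψ)
    (v := e)
    (integrableOn_test hU (f := fun x => fderiv ℝ u x e * ψ x)
      ((hcd.clm_apply continuousOn_const).mul hψ.continuous.continuousOn) hc hs
      (fun _ _ => rfl) z2)
    (integrableOn_test hU (f := fun x => u x * fderiv ℝ ψ x e)
      (hu.continuousOn.mul ((hψ.continuous_fderiv one_ne_zero).clm_apply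
        continuous_const).continuousOn) hc hs (fun _ _ => rfl) z1)
    (integrableOn_test hU (f := fun x => u x * ψ x)
      (hu.continuousOn.mul hψ.continuous.continuousOn) hc hs (fun _ _ => rfl)
      (fun x hx => by rw [image_eq_zero_of_notMem_tsupport hx]; simp))
    (fun x hx => (hu.differentiableOn one_ne_zero).differentiableAt (hU.mem_nhds (hs hx)))
    (fun x _ => hψ.differentiable one_ne_zero x)
  simp only [map_smul, smul_eq_mul, neg_mul, integral_neg]
  rw [setIntegral_eq_integral_of_forall_compl_eq_zero (fun x hx => z1 x (fun h => hx (hs h))),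
    setIntegral_eq_integral_of_forall_compl_eq_zero (fun x hx => z2 x (fun h => hx (hs h)))]
  exact hibp

lemma WeakEq.integrable {U : Set E} (hU : IsOpen U) {X : E → E} {g : E → ℝ}
    (hX : ContinuousOn X U) (hg : ContinuousOn g U) {ψ : E → ℝ} (hψ : ContDiff ℝ 1 ψ)
    (hc : HasCompactSupport ψ) (hs : tsupport ψ ⊆ U) :
    Integrable (fun x => fderiv ℝ ψ x (X x)) μ ∧ Integrable (fun x => g x * ψ x) μ := by
  refine ⟨integrableOn_test hU (f := fun x => fderiv ℝ ψ x (X x)) ?_ hc hs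
      (fun _ _ => rfl) ?_, integrableOn_test hU (f := fun x => g x * ψ x) ?_ hc hs
      (fun _ _ => rfl) ?_⟩
  · exact (hψ.continuous_fderiv one_ne_zero).continuousOn.clm_apply hX
  · intro x hx
    rw [fderiv_zero_off hx]; rfl
  · exact hg.mul hψ.continuous.continuousOn
  · intro x hx
    rw [image_eq_zero_of_notMem_tsupport hx, mul_zero]

lemma WeakEq.sub {U : Set E} (hU : IsOpen U) {X Y : E → E} {g k : E → ℝ}
    (hX : ContinuousOn X U) (hg : ContinuousOn g U) (hY : ContinuousOn Y U)
    (hk : ContinuousOn k U)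
    (h1 : WeakEq μ U X g) (h2 : WeakEq μ U Y k) :
    WeakEq μ U (fun x => X x - Y x) (fun x => g x - k x) := by
  intro ψ hψ hc hs
  obtain ⟨i1, i2⟩ := WeakEq.integrable (μ := μ) hU hX hg hψ hc hs
  obtain ⟨i3, i4⟩ := WeakEq.integrable (μ := μ) hU hY hk hψ hc hs
  simp only [map_sub, sub_mul]
  rw [integral_sub i1.integrableOn i3.integrableOn, integral_sub i2.integrableOn i4.integrableOn,
    h1 ψ hψ hc hs, h2 ψ hψ hc hs]

lemma WeakEq.finset_sum {U : Set E} (hU : IsOpen U) {ι : Type*} (t : Finset ι)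
    {X : ι → E → E} {g : ι → E → ℝ}
    (hX : ∀ i ∈ t, ContinuousOn (X i) U) (hg : ∀ i ∈ t, ContinuousOn (g i) U)
    (h1 : ∀ i ∈ t, WeakEq μ U (X i) (g i)) :
    WeakEq μ U (fun x => ∑ i ∈ t, X i x) (fun x => ∑ i ∈ t, g i x) := by
  intro ψ hψ hc hs
  have := fun i hi => WeakEq.integrable (μ := μ) hU (hX i hi) (hg i hi) hψ hc hs
  simp only [map_sum, Finset.sum_mul]
  rw [integral_finsetSum _ fun i hi => (this i hi).1.integrableOn,
    integral_finsetSum _ fun i hi => (this i hi).2.integrableOn]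
  exact Finset.sum_congr rfl fun i hi => h1 i hi ψ hψ hc hs

end Helpers

section Helpers2
open Filter Topology

variable {E : Type*} [NormedAddCommGroup E] [InnerProductSpace ℝ E] [FiniteDimensional ℝ E]
  [MeasurableSpace E] [BorelSpace E] {μ : Measure E} [μ.IsAddHaarMeasure]

lemma indicator_test {U : Set E} (hU : IsOpen U) (hb : Bornology.IsBounded U) {θ : E → ℝ}
    (hθ : ContDiffOn ℝ 1 θ U) (h0 : ∀ q ∈ closure U \ U, ∀ᶠ x in 𝓝[U] q, θ x = 0) :
    ContDiff ℝ 1 (U.indicator θ) ∧ HasCompactSupport (U.indicator θ) ∧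
      tsupport (U.indicator θ) ⊆ U ∧ ∀ x ∈ U, fderiv ℝ (U.indicator θ) x = fderiv ℝ θ x := by
  have hcl : tsupport (U.indicator θ) ⊆ closure U :=
    closure_mono (by intro x hx; by_contra h; exact hx (indicator_of_notMem h _))
  have hts : tsupport (U.indicator θ) ⊆ U := by
    intro q hq
    by_contra hqU
    have := h0 q ⟨hcl hq, hqU⟩
    rw [eventually_nhdsWithin_iff] at this
    refine (notMem_tsupport_iff_eventuallyEq.2 ?_) hq
    filter_upwards [this] with x hx
    by_cases hxU : x ∈ U
    · simp [hxU, hx hxU]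
    · simp [hxU]
  have hev : ∀ x ∈ U, U.indicator θ =ᶠ[𝓝 x] θ := fun x hx => by
    filter_upwards [hU.mem_nhds hx] with y hy
    simp [hy]
  refine ⟨?_, ?_, hts, fun x hx => (hev x hx).fderiv_eq⟩
  · rw [contDiff_iff_contDiffAt]
    intro x
    by_cases hx : x ∈ U
    · exact ((hθ x hx).contDiffAt (hU.mem_nhds hx)).congr_of_eventuallyEq (hev x hx)
    · have : U.indicator θ =ᶠ[𝓝 x] 0 :=
        notMem_tsupport_iff_eventuallyEq.1 (fun h => hx (hts h))
      exact (contDiffAt_const (c := (0:ℝ))).congr_of_eventuallyEq this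
  · exact (hb.isCompact_closure).of_isClosed_subset (isClosed_tsupport _) hcl

lemma ae_fderiv_zero_of_level [Nontrivial E] {U : Set E} (hU : IsOpen U) {v : E → ℝ}
    (hv : ContDiffOn ℝ 1 v U) : ∀ᵐ x ∂(μ.restrict U), v x = 0 → fderiv ℝ v x = 0 := by
  classical
  set s := U ∩ v ⁻¹' {0}
  have hs : MeasurableSet s := by
    have := hv.continuousOn.measurable_piecewise (f := v) (g := fun _ => (1:ℝ))
      continuousOn_const hU.measurableSet
    have h2 := this (measurableSet_singleton (0:ℝ))
    convert h2 using 1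
    ext x
    by_cases hx : x ∈ U <;> simp [s, hx]
  obtain ⟨e, he⟩ := exists_ne (0 : E)
  have hd : ∀ x ∈ s, HasFDerivWithinAt (fun x => v x • e) ((fderiv ℝ v x).smulRight e) s x :=
    fun x hx => (((hv.differentiableOn one_ne_zero).differentiableAt
      (hU.mem_nhds hx.1)).hasFDerivAt.smul_const e).hasFDerivWithinAt
  have happ : ApproximatesLinearOn (fun x => v x • e) (0 : E →L[ℝ] E) s 0 := by
    intro x hx y hy
    have h1 : v x = 0 := hx.2
    have h2 : v y = 0 := hy.2
    simp [h1, h2]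
  have := happ.norm_fderiv_sub_le μ hs _ hd
  rw [ae_restrict_iff' hs] at this
  rw [ae_restrict_iff' hU.measurableSet]
  filter_upwards [this] with x hx hxU hvx
  have h3 := hx ⟨hxU, hvx⟩
  simp only [sub_zero, nonpos_iff_eq_zero, nnnorm_eq_zero] at h3
  ext y
  have := DFunLike.congr_fun h3 y
  simpa [he] using this

lemma exists_trunc : ∃ T : ℝ → ℝ, ∃ C > 0, ContDiff ℝ 1 T ∧ (∀ t, |t| ≤ 1 → T t = 0) ∧
    (∀ t, 2 ≤ |t| → T t = t) ∧ (∀ t, |T t| ≤ |t|) ∧ (∀ t, |deriv T t| ≤ C) ∧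
    ∀ t, 2 < |t| → deriv T t = 1 := by
  let T : ℝ → ℝ := fun t => t * Real.smoothTransition (t ^ 2 - 1)
  have hT : ContDiff ℝ 1 T :=
    contDiff_id.mul (Real.smoothTransition.contDiff.comp (by fun_prop))
  have h2 : ∀ t, 2 ≤ |t| → T t = t := by
    intro t ht
    have : 1 ≤ t ^ 2 - 1 := by rw [← sq_abs]; nlinarith
    simp [T, Real.smoothTransition.one_of_one_le this]
  have h3 : ∀ t, 2 < |t| → deriv T t = 1 := by
    intro t ht
    have : T =ᶠ[𝓝 t] id := by
      filter_upwards [(continuous_abs.tendsto t).eventually (lt_mem_nhds ht)] with y hy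
      exact h2 y hy.le
    rw [this.deriv_eq]; simp
  have hcont : Continuous (deriv T) := hT.continuous_deriv le_rfl
  obtain ⟨C, hC⟩ := (isCompact_Icc (a := (-2:ℝ)) (b := 2)).exists_bound_of_continuousOn
    hcont.continuousOn
  refine ⟨T, max C 1, by positivity, hT, ?_, h2, ?_, ?_, h3⟩
  · intro t ht
    have : t ^ 2 - 1 ≤ 0 := by rw [← sq_abs]; nlinarith [abs_nonneg t]
    simp [T, Real.smoothTransition.zero_of_nonpos this]
  · intro t
    simp only [T, abs_mul, abs_of_nonneg (Real.smoothTransition.nonneg _)]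
    exact mul_le_of_le_one_right (abs_nonneg _) (Real.smoothTransition.le_one _)
  · intro t
    by_cases ht : 2 < |t|
    · rw [h3 t ht]; simp
    · exact (hC t (abs_le.1 (not_lt.1 ht))).trans (le_max_left _ _)

lemma exists_cutoff : ∃ η : E → ℝ, ∃ C > 0, ContDiff ℝ 1 η ∧ (∀ x, ‖x‖ ≤ 1 → η x = 0) ∧
    (∀ x, 2 ≤ ‖x‖ → η x = 1) ∧ (∀ x, |η x| ≤ 1) ∧ (∀ x, ‖fderiv ℝ η x‖ ≤ C) ∧
    ∀ x, 2 < ‖x‖ → fderiv ℝ η x = 0 := by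
  let b : ContDiffBump (0 : E) := ⟨1, 2, by norm_num, by norm_num⟩
  have hb : ContDiff ℝ 1 (fun x => b x) := b.contDiff
  obtain ⟨C, hC⟩ := (hb.continuous_fderiv one_ne_zero).bounded_above_of_compact_support
    (b.hasCompactSupport.fderiv ℝ)
  have h2 : ∀ x, 2 ≤ ‖x‖ → (fun x => 1 - b x) x = 1 := by
    intro x hx
    have : b x = 0 := b.zero_of_le_dist (by simpa using hx)
    simp [this]
  refine ⟨fun x => 1 - b x, max C 1, by positivity, contDiff_const.sub hb, ?_, h2, ?_, ?_, ?_⟩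
  · intro x hx
    have : b x = 1 := b.one_of_mem_closedBall (by simpa using hx)
    simp [this]
  · intro x
    have h1 := b.nonneg' x
    have h3 := b.le_one (x := x)
    rw [abs_le]; constructor <;> simp only <;> linarith
  · intro x
    rw [fderiv_const_sub, norm_neg]
    exact (hC x).trans (le_max_left _ _)
  · intro x hx
    have : (fun x => 1 - b x) =ᶠ[𝓝 x] fun _ => 1 := by
      filter_upwards [(continuous_norm.tendsto x).eventually (lt_mem_nhds hx)] with y hy
      exact h2 y hy.le
    rw [this.fderiv_eq]; simp

end Helpers2

section Helpers3
open Filter Topology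

variable {E : Type*} [NormedAddCommGroup E] [InnerProductSpace ℝ E] [FiniteDimensional ℝ E]
  [MeasurableSpace E] [BorelSpace E] {μ : Measure E} [μ.IsAddHaarMeasure]

lemma tendsto_cutoff_term {U : Set E} (hU : IsOpen U) (hb : Bornology.IsBounded U)
    (hdim : 2 ≤ Module.finrank ℝ E) (p : E) {X : E → E} (hX : ContinuousOn X U)
    (hX2 : IntegrableOn (fun x => ‖X x‖ ^ 2) U μ) {C : ℝ} (hC : 0 ≤ C) (B : ℕ → E → ℝ)
    (hB : ∀ k : ℕ, ∀ x ∈ U, |B k x| ≤ (closedBall p (2 / ((k:ℝ) + 1))).indicator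
      (fun x => C * (((k:ℝ) + 1) * ‖X x‖)) x)
    (hBm : ∀ k, AEStronglyMeasurable (B k) (μ.restrict U)) :
    (∀ k, IntegrableOn (B k) U μ) ∧ Tendsto (fun k => ∫ x in U, B k x ∂μ) atTop (𝓝 0) := by
  have : Nontrivial E := Module.nontrivial_of_finrank_pos (R := ℝ) (by omega)
  let c : ℕ → ℝ := fun k => (k:ℝ) + 1
  have hc0 : ∀ k, 0 < c k := fun k => by positivity
  have hc1 : ∀ k, 1 ≤ c k := fun k => by simp [c]
  let S : ℕ → Set E := fun k => closedBall p (2 / c k)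
  have hSm : ∀ k, MeasurableSet (S k) := fun k => isClosed_closedBall.measurableSet
  have hclim : Tendsto (fun k => 2 / c k) atTop (𝓝 0) := by
    have := (tendsto_one_div_add_atTop_nhds_zero_nat (𝕜 := ℝ)).const_mul 2
    simpa [c, div_eq_mul_inv] using this
  let J : ℕ → ℝ := fun k => ∫ x in U, (S k).indicator (fun x => ‖X x‖ ^ 2) x ∂μ
  have hJi : ∀ k, IntegrableOn ((S k).indicator (fun x => ‖X x‖ ^ 2)) U μ :=
    fun k => Integrable.indicator hX2 (hSm k)
  have hJ0 : ∀ k, 0 ≤ J k := fun k =>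
    integral_nonneg fun x => indicator_nonneg (fun _ _ => by positivity) _
  have hJ : Tendsto J atTop (𝓝 0) := by
    have : Tendsto J atTop (𝓝 (∫ x in U, (0:ℝ) ∂μ)) := by
      apply tendsto_integral_of_dominated_convergence (fun x => ‖X x‖ ^ 2)
        (fun k => (hJi k).aestronglyMeasurable) hX2
      · intro k
        filter_upwards with x
        refine (norm_indicator_le_norm_self _ _).trans ?_
        simp
      · have hne : ∀ᵐ x ∂(μ.restrict U), x ≠ p := ae_restrict_of_ae (by
          simp [ae_iff])
        filter_upwards [hne] with x hx
        have hd : 0 < dist x p := dist_pos.2 hx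
        apply tendsto_const_nhds.congr'
        filter_upwards [hclim.eventually (gt_mem_nhds hd)] with k hk
        rw [indicator_of_notMem]
        simp [S, hk]
    simpa using this
  set N := Module.finrank ℝ E
  set ω := (μ (ball (0:E) 1)).toReal with hω
  have hW : ∀ k, c k ^ 2 * (μ (S k)).toReal ≤ 2 ^ N * ω := by
    intro k
    have h1 : (μ (S k)).toReal = (2 / c k) ^ N * ω := by
      simp only [S]
      rw [Measure.addHaar_closedBall _ _ (by have := hc0 k; positivity), ENNReal.toReal_mul,
        ENNReal.toReal_ofReal (by have := hc0 k; positivity)]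
    rw [h1, div_pow]
    have h2 : c k ^ 2 ≤ c k ^ N := pow_le_pow_right₀ (hc1 k) hdim
    have h3 : 0 < c k ^ N := pow_pos (hc0 k) _
    have h4 : 0 ≤ ω := ENNReal.toReal_nonneg
    calc c k ^ 2 * (2 ^ N / c k ^ N * ω) = (c k ^ 2 / c k ^ N) * (2 ^ N * ω) := by ring
      _ ≤ 1 * (2 ^ N * ω) := by
        gcongr
        exact (div_le_one h3).2 h2
      _ = _ := one_mul _
  have hSi : ∀ k (a : ℝ), IntegrableOn ((S k).indicator (fun _ => a)) U μ := fun k a => by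
    rw [IntegrableOn, integrable_indicator_iff (hSm k), IntegrableOn,
      integrable_const_iff]
    right
    constructor
    rw [Measure.restrict_apply_univ]
    exact (Measure.restrict_apply_le _ _).trans_lt (isCompact_closedBall _ _).measure_lt_top
  have hmain : ∀ k (δ : ℝ), 0 < δ → ∀ x ∈ U, |B k x| ≤
      C * (δ⁻¹ * (S k).indicator (fun x => ‖X x‖ ^ 2) x +
        (S k).indicator (fun _ => δ * c k ^ 2) x) := by
    intro k δ hδ x hx
    refine (hB k x hx).trans ?_
    by_cases hxS : x ∈ S k
    · rw [indicator_of_mem hxS, indicator_of_mem hxS, indicator_of_mem hxS]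
      gcongr
      change c k * ‖X x‖ ≤ _
      have : δ⁻¹ * ‖X x‖ ^ 2 + δ * c k ^ 2 - c k * ‖X x‖
        = δ⁻¹ * ((‖X x‖ - δ * c k / 2) ^ 2 + 3 / 4 * (δ * c k) ^ 2) := by field_simp; ring
      have : 0 ≤ δ⁻¹ * ((‖X x‖ - δ * c k / 2) ^ 2 + 3 / 4 * (δ * c k) ^ 2) := by positivity
      linarith
    · rw [indicator_of_notMem hxS, indicator_of_notMem hxS, indicator_of_notMem hxS]
      simp
  have hbi : ∀ k (δ : ℝ), Integrable (fun x => C * (δ⁻¹ * (S k).indicator (fun x => ‖X x‖ ^ 2) x +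
        (S k).indicator (fun _ => δ * c k ^ 2) x)) (μ.restrict U) := fun k δ =>
    (((hJi k).const_mul _).add (hSi k _)).const_mul _
  refine ⟨fun k => (hbi k 1).mono' (hBm k) ?_, ?_⟩
  · filter_upwards [ae_restrict_mem hU.measurableSet] with x hx
    exact hmain k 1 one_pos x hx
  have hbound : ∀ k (δ : ℝ), 0 < δ → ‖∫ x in U, B k x ∂μ‖ ≤
      C * (δ⁻¹ * J k + δ * (2 ^ N * ω)) := by
    intro k δ hδ
    refine (norm_integral_le_of_norm_le (hbi k δ) ?_).trans ?_
    · filter_upwards [ae_restrict_mem hU.measurableSet] with x hx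
      exact hmain k δ hδ x hx
    · rw [integral_const_mul, integral_add ((hJi k).const_mul _) (hSi k _), integral_const_mul]
      gcongr
      rw [integral_indicator_const _ (hSm k), smul_eq_mul]
      have : (μ.restrict U).real (S k) ≤ (μ (S k)).toReal :=
        ENNReal.toReal_mono (isCompact_closedBall _ _).measure_lt_top.ne
          (Measure.restrict_apply_le _ _)
      calc _ ≤ (μ (S k)).toReal * (δ * c k ^ 2) := by gcongr
        _ = δ * (c k ^ 2 * (μ (S k)).toReal) := by ring
        _ ≤ _ := mul_le_mul_of_nonneg_left (hW k) hδ.le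
  apply squeeze_zero_norm (a := fun k => C * (√(J k) + (√(J k) + 2 / c k) * (2 ^ N * ω)))
  · intro k
    have hck : 0 < 2 / c k := by have := hc0 k; positivity
    refine (hbound k (√(J k) + 2 / c k) (by positivity)).trans ?_
    gcongr
    rw [inv_mul_le_iff₀ (by positivity)]
    nlinarith [Real.mul_self_sqrt (hJ0 k), Real.sqrt_nonneg (J k)]
  · have h1 : Tendsto (fun k => √(J k)) atTop (𝓝 0) := by
      simpa [Function.comp_def] using (Real.continuous_sqrt.tendsto 0).comp hJ
    have := (h1.add ((h1.add hclim).mul_const (2 ^ N * ω))).const_mul C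
    simpa using this

/-- Key lemma: a bounded `C¹` function of finite energy vanishing on the boundary except
possibly at one point is an admissible test function. -/
lemma weakEq_test {U : Set E} (hU : IsOpen U) (hb : Bornology.IsBounded U)
    (hdim : 2 ≤ Module.finrank ℝ E) (p : E) {X : E → E} {g : E → ℝ} (hX : ContinuousOn X U)
    (hX2 : IntegrableOn (fun x => ‖X x‖ ^ 2) U μ) (hg : ContinuousOn g U)
    (hg1 : IntegrableOn g U μ) (hw : WeakEq μ U X g) {v : E → ℝ} (hv : ContDiffOn ℝ 1 v U)
    {M : ℝ} (hM : ∀ x ∈ U, |v x| ≤ M) (hv2 : IntegrableOn (fun x => ‖fderiv ℝ v x‖ ^ 2) U μ)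
    (hlim : ∀ q ∈ closure U \ U, q ≠ p → Tendsto v (𝓝[U] q) (𝓝 0)) :
    ∫ x in U, fderiv ℝ v x (X x) ∂μ = ∫ x in U, g x * v x ∂μ := by
  have : Nontrivial E := Module.nontrivial_of_finrank_pos (R := ℝ) (by omega)
  rcases U.eq_empty_or_nonempty with rfl | ⟨x₁, hx₁⟩
  · simp
  have hM0 : 0 ≤ M := (abs_nonneg _).trans (hM x₁ hx₁)
  obtain ⟨T, CT, hCT, hT, hT0, hT2, hTle, hTd, hTd1⟩ := exists_trunc
  obtain ⟨η, Cη, hCη, hη, hη0, hη1, hηle, hηd, hηd0⟩ := exists_cutoff (E := E)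
  let c : ℕ → ℝ := fun k => (k:ℝ) + 1
  have hc0 : ∀ k, 0 < c k := fun k => by positivity
  have hclim : Tendsto c atTop atTop := tendsto_atTop_add_const_right _ _ tendsto_natCast_atTop_atTop
  let ηk : ℕ → E → ℝ := fun k x => η (c k • (x - p))
  let Tk : ℕ → E → ℝ := fun k x => (c k)⁻¹ * T (c k * v x)
  let θ : ℕ → E → ℝ := fun k x => ηk k x * Tk k x
  have hηk : ∀ k, ContDiff ℝ 1 (ηk k) := fun k => hη.comp (by fun_prop)
  have hTk : ∀ k, ContDiffOn ℝ 1 (Tk k) U := fun k =>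
    contDiffOn_const.mul (hT.comp_contDiffOn (contDiffOn_const.mul hv))
  have hθ : ∀ k, ContDiffOn ℝ 1 (θ k) U := fun k => (hηk k).contDiffOn.mul (hTk k)
  have hθ0 : ∀ k, ∀ q ∈ closure U \ U, ∀ᶠ x in 𝓝[U] q, θ k x = 0 := by
    intro k q hq
    by_cases hqp : q = p
    · apply mem_nhdsWithin_of_mem_nhds
      rw [hqp]
      filter_upwards [ball_mem_nhds p (inv_pos.2 (hc0 k))] with x hx
      have : ηk k x = 0 := by
        apply hη0
        rw [norm_smul, Real.norm_of_nonneg (hc0 k).le, ← dist_eq_norm]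
        have h2 : dist x p < (c k)⁻¹ := hx
        rw [← mul_inv_cancel₀ (hc0 k).ne']
        exact mul_le_mul_of_nonneg_left h2.le (hc0 k).le
      simp [θ, this]
    · have := (hlim q hq hqp).abs
      rw [abs_zero] at this
      filter_upwards [this.eventually (gt_mem_nhds (inv_pos.2 (hc0 k)))] with x hx
      have : T (c k * v x) = 0 := by
        apply hT0
        rw [abs_mul, abs_of_pos (hc0 k), ← mul_inv_cancel₀ (hc0 k).ne']
        exact mul_le_mul_of_nonneg_left hx.le (hc0 k).le
      simp [θ, Tk, this]
  let A : ℕ → E → ℝ := fun k x => ηk k x * (deriv T (c k * v x) * fderiv ℝ v x (X x))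
  let B : ℕ → E → ℝ := fun k x => Tk k x * (c k * fderiv ℝ η (c k • (x - p)) (X x))
  have hfd : ∀ k, ∀ x ∈ U, fderiv ℝ (θ k) x (X x) = A k x + B k x := by
    intro k x hx
    have hvx : HasFDerivAt v (fderiv ℝ v x) x :=
      ((hv.differentiableOn one_ne_zero).differentiableAt (hU.mem_nhds hx)).hasFDerivAt
    have h1 : HasFDerivAt (ηk k) ((fderiv ℝ η (c k • (x - p))).comp
        (c k • ContinuousLinearMap.id ℝ E)) x := by
      have hi : HasFDerivAt (fun x => c k • (x - p)) (c k • ContinuousLinearMap.id ℝ E) x :=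
        ((hasFDerivAt_id x).sub_const p).const_smul (c k)
      exact (hη.differentiable one_ne_zero _).hasFDerivAt.comp x hi
    have h2 : HasFDerivAt (Tk k) ((c k)⁻¹ • (deriv T (c k * v x) • (c k • fderiv ℝ v x))) x := by
      have h3 : HasDerivAt T (deriv T (c k * v x)) (c k * v x) :=
        (hT.differentiable one_ne_zero _).hasDerivAt
      exact (h3.comp_hasFDerivAt x (hvx.const_mul (c k))).const_mul _
    have h4 := (h1.mul h2).fderiv
    change fderiv ℝ (θ k) x = _ at h4
    rw [h4]
    have := (hc0 k).ne'
    simp [A, B]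
    field_simp
    simp
  have hTkle : ∀ k x, |Tk k x| ≤ |v x| := by
    intro k x
    simp only [Tk, abs_mul, abs_of_pos (inv_pos.2 (hc0 k))]
    rw [inv_mul_le_iff₀ (hc0 k)]
    exact (hTle _).trans_eq (by rw [abs_mul, abs_of_pos (hc0 k)])
  have hvd : ContinuousOn (fderiv ℝ v) U := hv.continuousOn_fderiv_of_isOpen hU le_rfl
  have hBB := tendsto_cutoff_term (μ := μ) hU hb hdim p hX hX2 (C := M * Cη) (by positivity) B (by
    intro k x hx
    by_cases hxS : x ∈ closedBall p (2 / ((k:ℝ) + 1))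
    · rw [indicator_of_mem hxS]
      simp only [B, abs_mul]
      rw [abs_of_pos (hc0 k)]
      have h5 : |fderiv ℝ η (c k • (x - p)) (X x)| ≤ Cη * ‖X x‖ :=
        ((fderiv ℝ η (c k • (x - p))).le_opNorm (X x)).trans
          (mul_le_mul_of_nonneg_right (hηd _) (norm_nonneg _))
      have h6 := (hTkle k x).trans (hM x hx)
      have := hc0 k
      calc _ ≤ M * (c k * (Cη * ‖X x‖)) := by gcongr
        _ = _ := by simp only [c]; ring
    · rw [indicator_of_notMem hxS]
      have h7 : fderiv ℝ η (c k • (x - p)) = 0 := by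
        apply hηd0
        rw [norm_smul, Real.norm_of_nonneg (hc0 k).le, ← dist_eq_norm]
        have h8 : 2 / c k < dist x p := by simpa using hxS
        rw [div_lt_iff₀ (hc0 k)] at h8
        linarith
      simp [B, h7]) (by
    intro k
    refine ContinuousOn.aestronglyMeasurable ?_ hU.measurableSet
    refine (hTk k).continuousOn.mul (continuousOn_const.mul (ContinuousOn.clm_apply ?_ hX))
    exact ((hη.continuous_fderiv one_ne_zero).comp (by fun_prop)).continuousOn)
  have hAm : ∀ k, AEStronglyMeasurable (A k) (μ.restrict U) := by
    intro k
    refine ContinuousOn.aestronglyMeasurable ?_ hU.measurableSet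
    refine (hηk k).continuous.continuousOn.mul (ContinuousOn.mul ?_ (hvd.clm_apply hX))
    exact (hT.continuous_deriv le_rfl).comp_continuousOn (continuousOn_const.mul hv.continuousOn)
  have hbi : Integrable (fun x => CT * (‖fderiv ℝ v x‖ ^ 2 + ‖X x‖ ^ 2)) (μ.restrict U) :=
    (hv2.add hX2).const_mul CT
  have hAb : ∀ k x, ‖A k x‖ ≤ CT * (‖fderiv ℝ v x‖ ^ 2 + ‖X x‖ ^ 2) := by
    intro k x
    simp only [A, Real.norm_eq_abs, abs_mul]
    have h5 : |fderiv ℝ v x (X x)| ≤ ‖fderiv ℝ v x‖ * ‖X x‖ :=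
      (fderiv ℝ v x).le_opNorm (X x)
    have h6 : ‖fderiv ℝ v x‖ * ‖X x‖ ≤ ‖fderiv ℝ v x‖ ^ 2 + ‖X x‖ ^ 2 := by
      nlinarith [sq_nonneg (‖fderiv ℝ v x‖ - ‖X x‖), sq_nonneg (‖fderiv ℝ v x‖),
        sq_nonneg (‖X x‖)]
    calc _ ≤ 1 * (CT * (‖fderiv ℝ v x‖ ^ 2 + ‖X x‖ ^ 2)) := by
          gcongr
          · exact hηle _
          · exact hTd _
          · exact h5.trans h6
      _ = _ := one_mul _
  have hAi : ∀ k, IntegrableOn (A k) U μ := fun k =>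
    hbi.mono' (hAm k) (Eventually.of_forall (hAb k))
  have hne : ∀ᵐ x ∂(μ.restrict U), x ≠ p := ae_restrict_of_ae (by simp [ae_iff])
  have hηev : ∀ x, x ≠ p → ∀ᶠ k in atTop, ηk k x = 1 := by
    intro x hx
    have hd : 0 < dist x p := dist_pos.2 hx
    filter_upwards [hclim.eventually_ge_atTop (2 / dist x p)] with k hk
    apply hη1
    rw [norm_smul, Real.norm_of_nonneg (hc0 k).le, ← dist_eq_norm]
    rwa [div_le_iff₀ hd] at hk
  have hvev : ∀ x, v x ≠ 0 → ∀ᶠ k in atTop, 2 < |c k * v x| := by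
    intro x hx
    have hd : 0 < |v x| := abs_pos.2 hx
    filter_upwards [hclim.eventually_gt_atTop (2 / |v x|)] with k hk
    rw [abs_mul, abs_of_pos (hc0 k)]
    rwa [div_lt_iff₀ hd] at hk
  have hAlim : Tendsto (fun k => ∫ x in U, A k x ∂μ) atTop
      (𝓝 (∫ x in U, fderiv ℝ v x (X x) ∂μ)) := by
    apply tendsto_integral_of_dominated_convergence _ hAm hbi
    · exact fun k => Eventually.of_forall (hAb k)
    · filter_upwards [hne, ae_fderiv_zero_of_level (μ := μ) hU hv] with x hx hx0
      by_cases hvx : v x = 0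
      · simp [A, hx0 hvx]
      · apply tendsto_const_nhds.congr'
        filter_upwards [hηev x hx, hvev x hvx] with k h1 h2
        simp [A, h1, hTd1 _ h2]
  have hglim : Tendsto (fun k => ∫ x in U, g x * θ k x ∂μ) atTop
      (𝓝 (∫ x in U, g x * v x ∂μ)) := by
    apply tendsto_integral_of_dominated_convergence (fun x => M * |g x|)
    · exact fun k => (hg.mul (hθ k).continuousOn).aestronglyMeasurable hU.measurableSet
    · exact hg1.abs.const_mul M
    · intro k
      filter_upwards [ae_restrict_mem hU.measurableSet] with x hx
      rw [Real.norm_eq_abs, abs_mul, mul_comm]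
      gcongr
      simp only [θ, abs_mul]
      calc _ ≤ 1 * M := by
            gcongr
            · exact hηle _
            · exact (hTkle k x).trans (hM x hx)
        _ = M := one_mul _
    · filter_upwards [hne] with x hx
      by_cases hvx : v x = 0
      · have : ∀ k, Tk k x = 0 := fun k => by
          simp only [Tk]
          rw [hvx, hT0 _ (by simp)]; simp
        simp [θ, this, hvx]
      · apply tendsto_const_nhds.congr'
        filter_upwards [hηev x hx, hvev x hvx] with k h1 h2
        simp only [θ, h1, Tk, hT2 _ h2.le]
        have := (hc0 k).ne'
        field_simp
  have heq : ∀ k, ∫ x in U, g x * θ k x ∂μ = ∫ x in U, A k x ∂μ + ∫ x in U, B k x ∂μ := by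
    intro k
    obtain ⟨t1, t2, t3, t4⟩ := indicator_test hU hb (hθ k) (hθ0 k)
    have := hw _ t1 t2 t3
    rw [← integral_add (hAi k) (hBB.1 k)]
    rw [setIntegral_congr_fun (g := fun x => A k x + B k x) hU.measurableSet
      (fun x hx => by simp only; rw [t4 x hx, hfd k x hx])] at this
    rw [this]
    exact setIntegral_congr_fun hU.measurableSet (fun x hx => by simp [hx])
  have hfin := hAlim.add hBB.2
  rw [add_zero] at hfin
  refine tendsto_nhds_unique hfin ?_
  exact hglim.congr heq

end Helpers3

section Helpers4
open Filter Topology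

variable {E : Type*} [NormedAddCommGroup E] [InnerProductSpace ℝ E] [FiniteDimensional ℝ E]
  [MeasurableSpace E] [BorelSpace E] {μ : Measure E} [μ.IsAddHaarMeasure]

lemma weak_max [Nontrivial E] {U : Set E} (hU : IsOpen U) (hb : Bornology.IsBounded U)
    {X : E → E} (hX : ContinuousOn X U) {w : E → ℝ} (hw : ContDiffOn ℝ 1 w U)
    (hweak : WeakEq μ U X (fun _ => 0))
    (hpos : ∀ x ∈ U, 0 ≤ fderiv ℝ w x (X x))
    (hzero : ∀ x ∈ U, fderiv ℝ w x (X x) = 0 → fderiv ℝ w x = 0) {m : ℝ}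
    (hbd : ∀ q ∈ closure U \ U, ∃ b ≤ m, Tendsto w (𝓝[U] q) (𝓝 b)) :
    ∀ x ∈ U, w x ≤ m := by
  intro x₁ hx₁
  apply le_of_forall_pos_le_add
  intro ε hε
  have hS : ContDiff ℝ 1 expNegInvGlue := expNegInvGlue.contDiff (n := 1)
  let θ : E → ℝ := fun x => expNegInvGlue (w x - (m + ε))
  have hθ : ContDiffOn ℝ 1 θ U := hS.comp_contDiffOn (hw.sub contDiffOn_const)
  have hθ0 : ∀ q ∈ closure U \ U, ∀ᶠ x in 𝓝[U] q, θ x = 0 := by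
    intro q hq
    obtain ⟨b, hbm, hbt⟩ := hbd q hq
    filter_upwards [hbt.eventually (gt_mem_nhds (show b < m + ε by linarith))] with x hx
    exact expNegInvGlue.zero_of_nonpos (by linarith)
  obtain ⟨t1, t2, t3, t4⟩ := indicator_test hU hb hθ hθ0
  set ψ := U.indicator θ
  have hfd : ∀ x ∈ U, fderiv ℝ ψ x = deriv expNegInvGlue (w x - (m + ε)) • fderiv ℝ w x := by
    intro x hx
    rw [t4 x hx]
    have hvx : HasFDerivAt w (fderiv ℝ w x) x :=
      ((hw.differentiableOn one_ne_zero).differentiableAt (hU.mem_nhds hx)).hasFDerivAt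
    have h3 : HasDerivAt expNegInvGlue (deriv expNegInvGlue (w x - (m + ε))) (w x - (m + ε)) :=
      (hS.differentiable one_ne_zero _).hasDerivAt
    exact (h3.comp_hasFDerivAt x (hvx.sub_const _)).fderiv
  have hd0 : ∀ t, 0 ≤ deriv expNegInvGlue t := fun t => expNegInvGlue.monotone.deriv_nonneg
  have hinteq := hweak ψ t1 t2 t3
  simp only [zero_mul, integral_zero] at hinteq
  have hii := (WeakEq.integrable (μ := μ) hU hX (continuousOn_const (c := (0:ℝ))) t1 t2 t3).1
  have hnn : 0 ≤ᵐ[μ.restrict U] fun x => fderiv ℝ ψ x (X x) := by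
    filter_upwards [ae_restrict_mem hU.measurableSet] with x hx
    rw [hfd x hx]
    exact mul_nonneg (hd0 _) (hpos x hx)
  have hae := (integral_eq_zero_iff_of_nonneg_ae hnn hii.integrableOn).1 hinteq
  have heq := Measure.eqOn_open_of_ae_eq hae hU
    ((t1.continuous_fderiv one_ne_zero).continuousOn.clm_apply hX) continuousOn_const
  have hall : ∀ x, fderiv ℝ ψ x = 0 := by
    intro x
    by_cases hx : x ∈ U
    · have this : fderiv ℝ ψ x (X x) = 0 := heq hx
      rw [hfd x hx] at this ⊢
      replace this : deriv expNegInvGlue (w x - (m + ε)) * fderiv ℝ w x (X x) = 0 := this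
      rw [mul_eq_zero] at this
      rcases this with h | h
      · rw [h, zero_smul]
      · rw [hzero x hx h, smul_zero]
    · exact fderiv_zero_off (fun h => hx (t3 h))
  obtain ⟨y, hy⟩ : ∃ y, y ∉ U := by
    by_contra! h
    exact NormedSpace.unbounded_univ ℝ E (hb.subset (fun x _ => h x))
  have := is_const_of_fderiv_eq_zero (t1.differentiable one_ne_zero) hall x₁ y
  simp only [ψ, indicator_of_mem hx₁, indicator_of_notMem hy, θ] at this
  have := expNegInvGlue.zero_iff_nonpos.1 this
  linarith

lemma poincare {U : Set E} (hU : IsOpen U) {x₀ : E} {s : ℝ} (hs : 0 < s) (hUs : U ⊆ ball x₀ s)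
    (hdim : 2 ≤ Module.finrank ℝ E) (p : E) {v : E → ℝ} (hv : ContDiffOn ℝ 1 v U)
    {M : ℝ} (hM : ∀ x ∈ U, |v x| ≤ M) (hv2 : IntegrableOn (fun x => ‖fderiv ℝ v x‖ ^ 2) U μ)
    (hlim : ∀ q ∈ closure U \ U, q ≠ p → Tendsto v (𝓝[U] q) (𝓝 0)) :
    ∫ x in U, v x ^ 2 ∂μ ≤ 4 * s ^ 2 * ∫ x in U, ‖fderiv ℝ v x‖ ^ 2 ∂μ := by
  have : Nontrivial E := Module.nontrivial_of_finrank_pos (R := ℝ) (by omega)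
  have hb : Bornology.IsBounded U := isBounded_ball.subset hUs
  rcases U.eq_empty_or_nonempty with rfl | ⟨x₁, hx₁⟩
  · simp
  have hM0 : 0 ≤ M := (abs_nonneg _).trans (hM x₁ hx₁)
  have hfin : IsFiniteMeasure (μ.restrict U) := ⟨by
    rw [Measure.restrict_apply_univ]; exact hb.measure_lt_top⟩
  obtain ⟨e, he⟩ := exists_norm_eq E (zero_le_one' ℝ)
  let l : E → ℝ := fun x => inner ℝ e (x - x₀)
  have hl : ContDiff ℝ 1 l := contDiff_const.inner ℝ (contDiff_id.sub contDiff_const)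
  have hld : ∀ x, HasFDerivAt l (innerSL ℝ e) x := fun x => by
    exact (innerSL ℝ e).hasFDerivAt.comp x ((hasFDerivAt_id x).sub_const x₀)
  have hls : ∀ x ∈ U, |l x| ≤ s := by
    intro x hx
    refine (abs_real_inner_le_norm _ _).trans ?_
    rw [he, one_mul, ← dist_eq_norm]
    exact (hUs hx).le
  have hu : ContDiffOn ℝ 1 (fun x => v x * l x) U := hv.mul hl.contDiffOn
  have hvd : ContinuousOn (fderiv ℝ v) U := hv.continuousOn_fderiv_of_isOpen hU le_rfl
  have hweak := weakEq_smul (μ := μ) hU hu e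
  have hfd : ∀ x ∈ U, fderiv ℝ (fun x => v x * l x) x e = v x + l x * fderiv ℝ v x e := by
    intro x hx
    have hvx : HasFDerivAt v (fderiv ℝ v x) x :=
      ((hv.differentiableOn one_ne_zero).differentiableAt (hU.mem_nhds hx)).hasFDerivAt
    have h := (hvx.mul (hld x)).fderiv
    change fderiv ℝ (fun x => v x * l x) x = _ at h
    rw [h]
    simp [he]
  have hde : ∀ x, |fderiv ℝ v x e| ≤ ‖fderiv ℝ v x‖ := fun x => by
    simpa [he] using (fderiv ℝ v x).le_opNorm e
  have hgc : ContinuousOn (fun x => -fderiv ℝ (fun x => v x * l x) x e) U :=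
    ((hu.continuousOn_fderiv_of_isOpen hU le_rfl).clm_apply continuousOn_const).neg
  have hv2i : IntegrableOn (fun x => v x ^ 2) U μ := by
    refine (integrable_const (M ^ 2)).mono'
      ((hv.continuousOn.pow 2).aestronglyMeasurable hU.measurableSet) ?_
    filter_upwards [ae_restrict_mem hU.measurableSet] with x hx
    rw [Real.norm_eq_abs, abs_pow]
    gcongr
    exact hM x hx
  have hKi : IntegrableOn (fun x => v x * l x * fderiv ℝ v x e) U μ := by
    refine (hv2i.add (hv2.const_mul (s ^ 2))).mono'
      ((hu.continuousOn.mul (hvd.clm_apply continuousOn_const)).aestronglyMeasurable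
        hU.measurableSet) ?_
    filter_upwards [ae_restrict_mem hU.measurableSet] with x hx
    simp only [Real.norm_eq_abs, abs_mul, Pi.add_apply]
    have h1 : |l x| * |fderiv ℝ v x e| ≤ s * ‖fderiv ℝ v x‖ := by
      gcongr
      · exact hls x hx
      · exact hde x
    have h2 : 0 ≤ |l x| * |fderiv ℝ v x e| := by positivity
    rw [← sq_abs (v x)]
    nlinarith [sq_nonneg (|v x| - s * ‖fderiv ℝ v x‖), abs_nonneg (v x),
      mul_le_mul_of_nonneg_left h1 (abs_nonneg (v x)), sq_nonneg (|v x|),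
      sq_nonneg (s * ‖fderiv ℝ v x‖)]
  have key := weakEq_test hU hb hdim p (X := fun x => (v x * l x) • e)
    (hu.continuousOn.smul continuousOn_const) (by
      refine (integrable_const ((M * s) ^ 2)).mono' (((hu.continuousOn.smul
        continuousOn_const).norm.pow 2).aestronglyMeasurable hU.measurableSet) ?_
      filter_upwards [ae_restrict_mem hU.measurableSet] with x hx
      rw [norm_pow, norm_norm, norm_smul, he, mul_one, norm_mul]
      gcongr
      · exact hM x hx
      · exact hls x hx) hgc (by
      refine ((integrable_const (M + s)).add (hv2.const_mul s)).mono'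
        (hgc.aestronglyMeasurable hU.measurableSet) ?_
      filter_upwards [ae_restrict_mem hU.measurableSet] with x hx
      rw [norm_neg, hfd x hx]
      refine (norm_add_le _ _).trans ?_
      have h1 : |l x| * |fderiv ℝ v x e| ≤ s * ‖fderiv ℝ v x‖ := by
        gcongr
        · exact hls x hx
        · exact hde x
      simp only [Real.norm_eq_abs, abs_mul, Pi.add_apply]
      have := hM x hx
      have h3 : ‖fderiv ℝ v x‖ ≤ 1 + ‖fderiv ℝ v x‖ ^ 2 := by
        nlinarith [sq_nonneg (‖fderiv ℝ v x‖ - 1)]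
      nlinarith) hweak hv hM hv2 hlim
  have e1 : ∫ x in U, fderiv ℝ v x ((v x * l x) • e) ∂μ
      = ∫ x in U, v x * l x * fderiv ℝ v x e ∂μ := by
    simp only [map_smul, smul_eq_mul]
  have e2 : ∫ x in U, -fderiv ℝ (fun x => v x * l x) x e * v x ∂μ
      = - ∫ x in U, v x ^ 2 ∂μ - ∫ x in U, v x * l x * fderiv ℝ v x e ∂μ := by
    have hn : IntegrableOn (fun x => -(v x ^ 2)) U μ := hv2i.neg
    rw [← integral_neg, ← integral_sub hn hKi]
    apply setIntegral_congr_fun hU.measurableSet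
    intro x hx
    simp only
    rw [hfd x hx]; ring
  rw [e1, e2] at key
  have e3 : -2 * ∫ x in U, v x * l x * fderiv ℝ v x e ∂μ ≤
      (1/2) * ∫ x in U, v x ^ 2 ∂μ + 2 * s ^ 2 * ∫ x in U, ‖fderiv ℝ v x‖ ^ 2 ∂μ := by
    rw [← integral_const_mul, ← integral_const_mul, ← integral_const_mul,
      ← integral_add (hv2i.const_mul _) (hv2.const_mul _)]
    apply setIntegral_mono_on (hKi.const_mul _)
      ((hv2i.const_mul _).add (hv2.const_mul _)) hU.measurableSet
    intro x hx
    have h1 : |l x| * |fderiv ℝ v x e| ≤ s * ‖fderiv ℝ v x‖ := by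
      gcongr
      · exact hls x hx
      · exact hde x
    have h2 : -(v x * l x * fderiv ℝ v x e) ≤ |v x| * (s * ‖fderiv ℝ v x‖) := by
      refine (neg_le_abs _).trans ?_
      rw [abs_mul, abs_mul, mul_assoc]
      gcongr
    simp only [Pi.add_apply]
    rw [← sq_abs (v x)]
    nlinarith [sq_nonneg (|v x| - 2 * (s * ‖fderiv ℝ v x‖))]
  nlinarith

end Helpers4

section Helpers5
open Filter Topology

variable {E : Type*} [NormedAddCommGroup E] [InnerProductSpace ℝ E] [FiniteDimensional ℝ E]
  [MeasurableSpace E] [BorelSpace E] {μ : Measure E} [μ.IsAddHaarMeasure]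

lemma energy_estimate {x₀ : E} {s : ℝ} (hs : 0 < s) (hdim : 2 ≤ Module.finrank ℝ E) (p : E)
    {v P g : E → ℝ} {X : E → E} {h Λ K D c : ℝ} (hΛ : 1 ≤ Λ) (hK : 0 ≤ K) (hD : 1 ≤ D)
    (hv : ContDiffOn ℝ 1 v (ball x₀ s)) (hM : ∀ x ∈ ball x₀ s, |v x| ≤ h)
    (hv2 : IntegrableOn (fun x => ‖fderiv ℝ v x‖ ^ 2) (ball x₀ s) μ)
    (hlim : ∀ q ∈ closure (ball x₀ s) \ ball x₀ s, q ≠ p →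
      Tendsto v (𝓝[ball x₀ s] q) (𝓝 0))
    (hP0 : ∀ x, 0 ≤ P x)
    (hP2 : IntegrableOn (fun x => P x ^ 2) (ball x₀ s) μ)
    (hX : ContinuousOn X (ball x₀ s)) (hg : ContinuousOn g (ball x₀ s))
    (hXb : ∀ x ∈ ball x₀ s, ‖X x‖ ≤ c * (P x + ‖fderiv ℝ v x‖))
    (hgb : ∀ x ∈ ball x₀ s, |g x| ≤ 4 * D + 2 * P x ^ 2)
    (hweak : WeakEq μ (ball x₀ s) X g)
    (hell : ∀ x ∈ ball x₀ s, Λ⁻¹ * ‖fderiv ℝ v x‖ ^ 2 ≤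
      fderiv ℝ v x (X x) + K * (s + h) * P x * ‖fderiv ℝ v x‖) :
    ∫ x in ball x₀ s, ‖fderiv ℝ v x‖ ^ 2 ∂μ ≤
      (4 * Λ + 4 * Λ ^ 2 * K ^ 2 + 128 * Λ ^ 2 * μ.real (ball (0:E) 1)) * (h + h ^ 2 + s ^ 2) *
        ∫ x in ball x₀ s, P x ^ 2 ∂μ +
      (4 * Λ + 4 * Λ ^ 2 * K ^ 2 + 128 * Λ ^ 2 * μ.real (ball (0:E) 1)) * D ^ 2 *
        s ^ (Module.finrank ℝ E + 2) := by
  have : Nontrivial E := Module.nontrivial_of_finrank_pos (R := ℝ) (by omega)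
  set B := ball x₀ s with hB
  have hU : IsOpen B := isOpen_ball
  have hb : Bornology.IsBounded B := isBounded_ball
  have hfin : IsFiniteMeasure (μ.restrict B) := ⟨by
    rw [Measure.restrict_apply_univ]; exact hb.measure_lt_top⟩
  have hΛ0 : 0 < Λ := by linarith
  have hh : 0 ≤ h := (abs_nonneg _).trans (hM x₀ (mem_ball_self hs))
  have hvd : ContinuousOn (fderiv ℝ v) B := hv.continuousOn_fderiv_of_isOpen hU le_rfl
  have hX2 : IntegrableOn (fun x => ‖X x‖ ^ 2) B μ := by
    refine ((hP2.const_mul (2 * c ^ 2)).add (hv2.const_mul (2 * c ^ 2))).mono'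
      ((hX.norm.pow 2).aestronglyMeasurable hU.measurableSet) ?_
    filter_upwards [ae_restrict_mem hU.measurableSet] with x hx
    rw [norm_pow, norm_norm]
    simp only [Pi.add_apply]
    have h1 := hXb x hx
    have h2 : ‖X x‖ ^ 2 ≤ (c * (P x + ‖fderiv ℝ v x‖)) ^ 2 := by gcongr
    have h3 : 0 ≤ c ^ 2 * (P x - ‖fderiv ℝ v x‖) ^ 2 := by positivity
    nlinarith
  have hg1 : IntegrableOn g B μ := by
    refine ((integrable_const (4 * D)).add (hP2.const_mul 2)).mono'
      (hg.aestronglyMeasurable hU.measurableSet) ?_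
    filter_upwards [ae_restrict_mem hU.measurableSet] with x hx
    simpa using hgb x hx
  have key := weakEq_test hU hb hdim p hX hX2 hg hg1 hweak hv hM hv2 hlim
  have poin := poincare (μ := μ) hU hs subset_rfl hdim p hv hM hv2 hlim
  have hv2i : IntegrableOn (fun x => v x ^ 2) B μ := by
    refine (integrable_const (h ^ 2)).mono'
      ((hv.continuousOn.pow 2).aestronglyMeasurable hU.measurableSet) ?_
    filter_upwards [ae_restrict_mem hU.measurableSet] with x hx
    rw [Real.norm_eq_abs, abs_pow]
    gcongr
    exact hM x hx
  have hgv : IntegrableOn (fun x => g x * v x) B μ := by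
    refine (hg1.norm.const_mul h).mono'
      ((hg.mul hv.continuousOn).aestronglyMeasurable hU.measurableSet) ?_
    filter_upwards [ae_restrict_mem hU.measurableSet] with x hx
    rw [norm_mul, mul_comm]
    gcongr
    exact hM x hx
  have hvX : IntegrableOn (fun x => fderiv ℝ v x (X x)) B μ := by
    refine (hv2.add hX2).mono'
      ((hvd.clm_apply hX).aestronglyMeasurable hU.measurableSet) ?_
    filter_upwards [ae_restrict_mem hU.measurableSet] with x hx
    refine ((fderiv ℝ v x).le_opNorm _).trans ?_
    simp only [Pi.add_apply]
    nlinarith [sq_nonneg (‖fderiv ℝ v x‖ - ‖X x‖), sq_nonneg (‖fderiv ℝ v x‖),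
      sq_nonneg (‖X x‖)]
  set I := ∫ x in B, ‖fderiv ℝ v x‖ ^ 2 ∂μ with hI
  set J := ∫ x in B, P x ^ 2 ∂μ with hJ
  set Q := ∫ x in B, v x ^ 2 ∂μ with hQ
  have hJ0 : 0 ≤ J := integral_nonneg fun x => by positivity
  -- pointwise lower bound
  have s1 : (3/4) * I ≤ Λ * (∫ x in B, fderiv ℝ v x (X x) ∂μ) + Λ ^ 2 * K ^ 2 * (s + h) ^ 2 * J := by
    rw [hI, hJ, ← integral_const_mul, ← integral_const_mul, ← integral_const_mul,
      ← integral_add (hvX.const_mul _) (hP2.const_mul _)]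
    apply setIntegral_mono_on (hv2.const_mul _)
      ((hvX.const_mul _).add (hP2.const_mul _)) hU.measurableSet
    intro x hx
    simp only [Pi.add_apply]
    have h1 := mul_le_mul_of_nonneg_left (hell x hx) hΛ0.le
    rw [← mul_assoc, mul_inv_cancel₀ hΛ0.ne', one_mul] at h1
    nlinarith [sq_nonneg (‖fderiv ℝ v x‖ / 2 - Λ * K * (s + h) * P x)]
  have s2 : Λ * (∫ x in B, g x * v x ∂μ) ≤
      2 * Λ * h * J + ((1 / (16 * s ^ 2)) * Q + ∫ x in B, 64 * Λ ^ 2 * D ^ 2 * s ^ 2 ∂μ) := by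
    have hvc : IntegrableOn (fun x => 1 / (16 * s ^ 2) * v x ^ 2 + 64 * Λ ^ 2 * D ^ 2 * s ^ 2) B μ :=
      (hv2i.const_mul _).add (integrable_const _)
    rw [hJ, hQ, ← integral_const_mul, ← integral_const_mul, ← integral_const_mul,
      ← integral_add (hv2i.const_mul _) (integrable_const _),
      ← integral_add (hP2.const_mul _) hvc]
    apply setIntegral_mono_on (hgv.const_mul _)
      ((hP2.const_mul _).add hvc) hU.measurableSet
    intro x hx
    simp only [Pi.add_apply]
    have h1 : g x * v x ≤ |v x| * (4 * D) + 2 * h * P x ^ 2 := by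
      refine (le_abs_self _).trans ?_
      rw [abs_mul]
      have a1 := mul_le_mul_of_nonneg_right (hgb x hx) (abs_nonneg (v x))
      have a2 := mul_le_mul_of_nonneg_right (hM x hx) (sq_nonneg (P x))
      nlinarith
    have h2 : Λ * (|v x| * (4 * D)) ≤ 1 / (16 * s ^ 2) * v x ^ 2 + 64 * Λ ^ 2 * D ^ 2 * s ^ 2 := by
      have e : 1 / (16 * s ^ 2) * v x ^ 2 + 64 * Λ ^ 2 * D ^ 2 * s ^ 2 - Λ * (|v x| * (4 * D))
          = (|v x| / (4 * s) - 8 * Λ * D * s) ^ 2 := by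
        rw [← sq_abs (v x)]
        field_simp
        ring
      nlinarith [sq_nonneg (|v x| / (4 * s) - 8 * Λ * D * s)]
    have h3 := mul_le_mul_of_nonneg_left h1 hΛ0.le
    nlinarith
  have hvol : ∫ x in B, 64 * Λ ^ 2 * D ^ 2 * s ^ 2 ∂μ =
      64 * Λ ^ 2 * D ^ 2 * s ^ (Module.finrank ℝ E + 2) * μ.real (ball (0:E) 1) := by
    rw [setIntegral_const, smul_eq_mul, hB, measureReal_def, Measure.addHaar_ball μ x₀ hs.le,
      ENNReal.toReal_mul, ENNReal.toReal_ofReal (by positivity), ← measureReal_def]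
    ring
  have s3 : (1 / (16 * s ^ 2)) * Q ≤ (1/4) * I := by
    have := mul_le_mul_of_nonneg_left poin (show 0 ≤ 1 / (16 * s ^ 2) by positivity)
    refine this.trans (le_of_eq ?_)
    field_simp
    norm_num
  rw [hvol] at s2
  rw [← key] at s2
  have s4 : (1/2) * I ≤ (2 * Λ * h + Λ ^ 2 * K ^ 2 * (s + h) ^ 2) * J +
      64 * Λ ^ 2 * D ^ 2 * s ^ (Module.finrank ℝ E + 2) * μ.real (ball (0:E) 1) := by
    nlinarith
  set ω := μ.real (ball (0:E) 1) with hω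
  have hω0 : 0 ≤ ω := measureReal_nonneg
  set S := s ^ (Module.finrank ℝ E + 2) with hS
  have hS0 : 0 ≤ S := by positivity
  have t1 : (4 * Λ * h + 2 * Λ ^ 2 * K ^ 2 * (s + h) ^ 2) ≤
      (4 * Λ + 4 * Λ ^ 2 * K ^ 2 + 128 * Λ ^ 2 * ω) * (h + h ^ 2 + s ^ 2) := by
    have u1 : (s + h) ^ 2 ≤ 2 * (h + h ^ 2 + s ^ 2) := by nlinarith [sq_nonneg (s - h)]
    have u2 : h ≤ h + h ^ 2 + s ^ 2 := by nlinarith [sq_nonneg s, sq_nonneg h]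
    have u3 := mul_le_mul_of_nonneg_left u1 (show 0 ≤ 2 * Λ ^ 2 * K ^ 2 by positivity)
    have u4 := mul_le_mul_of_nonneg_left u2 (show 0 ≤ 4 * Λ by positivity)
    have u5 : 0 ≤ 128 * Λ ^ 2 * ω * (h + h ^ 2 + s ^ 2) := by positivity
    linarith
  have t2 := mul_le_mul_of_nonneg_right t1 hJ0
  have t3 : 0 ≤ (4 * Λ + 4 * Λ ^ 2 * K ^ 2) * D ^ 2 * S := by positivity
  linarith

end Helpers5

section Helpers6
open Filter Topology

variable {E : Type*} [NormedAddCommGroup E] [InnerProductSpace ℝ E] [FiniteDimensional ℝ E]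

lemma exists_touch {x₀ : E} {s : ℝ} (hs : 0 < s) (hs1 : s < 1)
    (hsub : ball x₀ s ⊆ ball (0 : E) 1) :
    ∃ p : E, ∀ q ∈ sphere x₀ s, q ≠ p → q ∈ ball (0 : E) 1 := by
  have hcl : closedBall x₀ s ⊆ closedBall (0 : E) 1 := by
    rw [← closure_ball x₀ hs.ne', ← closure_ball (0:E) one_ne_zero]
    exact closure_mono hsub
  have key : ∀ q ∈ sphere x₀ s, q ∉ ball (0:E) 1 → x₀ ≠ 0 ∧ SameRay ℝ x₀ (q - x₀) := by
    intro q hq hq1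
    have hqs : ‖q - x₀‖ = s := by rw [← dist_eq_norm]; exact hq
    have hqn : ‖q‖ = 1 := by
      apply le_antisymm
      · simpa using hcl (sphere_subset_closedBall hq)
      · simpa using hq1
    have h0 : x₀ ≠ 0 := by
      rintro rfl
      rw [sub_zero] at hqs
      linarith
    refine ⟨h0, ?_⟩
    have hn : 0 < ‖x₀‖ := norm_pos_iff.2 h0
    have h1 : ‖x₀‖ + s ≤ 1 := by
      have hm : x₀ + (s / ‖x₀‖) • x₀ ∈ closedBall x₀ s := by
        rw [mem_closedBall, dist_eq_norm, add_sub_cancel_left, norm_smul, norm_div, norm_norm,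
          div_mul_cancel₀ _ hn.ne', Real.norm_of_nonneg hs.le]
      have h2 := hcl hm
      have e : x₀ + (s / ‖x₀‖) • x₀ = (1 + s / ‖x₀‖) • x₀ := by rw [add_smul, one_smul]
      rw [mem_closedBall, dist_zero_right, e, norm_smul, Real.norm_of_nonneg (by positivity)] at h2
      have : (1 + s / ‖x₀‖) * ‖x₀‖ = ‖x₀‖ + s := by field_simp
      linarith
    rw [sameRay_iff_norm_add]
    apply le_antisymm (norm_add_le _ _)
    rw [add_sub_cancel, hqn, hqs]
    exact h1
  by_cases hex : ∃ q ∈ sphere x₀ s, q ∉ ball (0:E) 1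
  · obtain ⟨p, hp, hp1⟩ := hex
    refine ⟨p, fun q hq hqp => ?_⟩
    by_contra hq1
    obtain ⟨h0, r1⟩ := key p hp hp1
    obtain ⟨_, r2⟩ := key q hq hq1
    have r3 : SameRay ℝ (q - x₀) (p - x₀) := r2.symm.trans r1 (fun h => absurd h h0)
    have : q - x₀ = p - x₀ := r3.eq_of_norm_eq (by
      rw [← dist_eq_norm, ← dist_eq_norm, mem_sphere.1 hq, mem_sphere.1 hp])
    exact hqp (sub_left_inj.1 this)
  · push Not at hex
    exact ⟨0, fun q hq _ => hex q hq⟩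

lemma sphere_acc (hdim : 2 ≤ Module.finrank ℝ E) {x₀ : E} {s : ℝ} (hs : 0 < s) {q : E}
    (hq : q ∈ sphere x₀ s) : q ∈ closure (sphere x₀ s \ {q}) := by
  have hr : 1 < Module.rank ℝ E := by
    rw [← Module.finrank_eq_rank]
    exact_mod_cast hdim
  have : Nontrivial E := Module.nontrivial_of_finrank_pos (R := ℝ) (by omega)
  have hc := isPreconnected_sphere hr x₀ s
  have hnt : (sphere x₀ s).Nontrivial := by
    refine ⟨q, hq, x₀ - (q - x₀), ?_, ?_⟩
    · rw [mem_sphere, dist_eq_norm, sub_sub_cancel_left, norm_neg, ← dist_eq_norm]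
      exact hq
    · intro h
      have h2 : (2:ℝ) • (q - x₀) = 0 := by
        rw [two_smul]
        nth_rewrite 1 [h]
        abel
      have h3 : q - x₀ = 0 := by simpa using h2
      have h4 := mem_sphere.1 hq
      rw [dist_eq_norm, h3, norm_zero] at h4
      linarith
  have := hc.preperfect_of_nontrivial hnt q hq
  exact mem_closure_iff_clusterPt.2 (accPt_principal_iff_clusterPt.1 this)

lemma sphere_le (hdim : 2 ≤ Module.finrank ℝ E) {x₀ : E} {s : ℝ} (hs : 0 < s) {p : E}
    (hp : ∀ q ∈ sphere x₀ s, q ≠ p → q ∈ ball (0 : E) 1) {φ w : E → ℝ}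
    (hφ : ContinuousOn φ (ball (0:E) 1)) (hw : ContinuousOn w (closedBall x₀ s))
    (hwφ : ∀ x ∈ sphere x₀ s, w x = φ x) {m : ℝ} (hm : ∀ x ∈ ball x₀ s, φ x ≤ m) :
    ∀ q ∈ sphere x₀ s, w q ≤ m := by
  have h1 : ∀ q ∈ sphere x₀ s, q ≠ p → w q ≤ m := by
    intro q hq hqp
    rw [hwφ q hq]
    have hc : ContinuousAt φ q := hφ.continuousAt (isOpen_ball.mem_nhds (hp q hq hqp))
    have hqc : q ∈ closure (ball x₀ s) := by
      rw [closure_ball _ hs.ne']; exact sphere_subset_closedBall hq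
    have : (𝓝[ball x₀ s] q).NeBot := mem_closure_iff_nhdsWithin_neBot.1 hqc
    exact le_of_tendsto (hc.mono_left nhdsWithin_le_nhds) (by
      filter_upwards [self_mem_nhdsWithin] with x hx using hm x hx)
  intro q hq
  by_cases hqp : q = p
  · subst hqp
    have : (𝓝[sphere x₀ s \ {q}] q).NeBot :=
      mem_closure_iff_nhdsWithin_neBot.1 (sphere_acc hdim hs hq)
    have hc : Tendsto w (𝓝[sphere x₀ s \ {q}] q) (𝓝 (w q)) :=
      (hw q (sphere_subset_closedBall hq)).mono_left
        (nhdsWithin_mono _ (sdiff_subset.trans sphere_subset_closedBall))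
    exact le_of_tendsto hc (by
      filter_upwards [self_mem_nhdsWithin] with x hx using h1 x hx.1 hx.2)
  · exact h1 q hq hqp

lemma coeff_lip {b : E → ℝ → ℝ} {L : ℝ}
    (hb : ContDiffOn ℝ 1 (fun p : E × ℝ => b p.1 p.2) (ball (0:E) 1 ×ˢ univ))
    (hL : ∀ x ∈ ball (0:E) 1, ∀ z, ‖fderiv ℝ (fun y => b y z) x‖ + |deriv (fun w => b x w) z| ≤ L)
    {x y : E} (hx : x ∈ ball (0:E) 1) (hy : y ∈ ball (0:E) 1) (z t : ℝ) :
    |b y t - b x z| ≤ L * (‖y - x‖ + |t - z|) := by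
  have hdiff : ∀ x ∈ ball (0:E) 1, ∀ z, DifferentiableAt ℝ (fun p : E × ℝ => b p.1 p.2) (x, z) :=
    fun x hx z => (hb.differentiableOn one_ne_zero).differentiableAt
      ((isOpen_ball.prod isOpen_univ).mem_nhds ⟨hx, mem_univ _⟩)
  have h1 : ‖b y z - b x z‖ ≤ L * ‖y - x‖ := by
    refine (convex_ball (0:E) 1).norm_image_sub_le_of_norm_fderiv_le (f := fun y => b y z) (𝕜 := ℝ)
      (fun u hu => ?_) (fun u hu => ?_) hx hy
    · have hm : DifferentiableAt ℝ (fun y : E => (y, z)) u :=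
        differentiableAt_id.prodMk (differentiableAt_const z)
      exact DifferentiableAt.comp u (hdiff u hu z) hm
    · have := hL u hu z
      have := abs_nonneg (deriv (fun w => b u w) z)
      linarith
  have h2 : ‖b y t - b y z‖ ≤ L * ‖t - z‖ := by
    refine (convex_univ (𝕜 := ℝ) (E := ℝ)).norm_image_sub_le_of_norm_deriv_le (f := fun w => b y w)
      (fun u hu => ?_) (fun u hu => ?_) (mem_univ z) (mem_univ t)
    · have hm : DifferentiableAt ℝ (fun t : ℝ => (y, t)) u :=
        (differentiableAt_const y).prodMk differentiableAt_id
      exact DifferentiableAt.comp (g := fun p : E × ℝ => b p.1 p.2) u (hdiff y hy u) hm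
    · have := hL y hy u
      have := norm_nonneg (fderiv ℝ (fun y => b y u) y)
      rw [Real.norm_eq_abs]
      linarith
  rw [Real.norm_eq_abs] at h1 h2
  rw [Real.norm_eq_abs] at h2
  calc |b y t - b x z| = |(b y t - b y z) + (b y z - b x z)| := by ring_nf
    _ ≤ |b y t - b y z| + |b y z - b x z| := abs_add_le _ _
    _ ≤ _ := by linarith

end Helpers6

section Helpers7
open Filter Topology

variable {n : ℕ}

/-- The flux vector `(∑ᵢ Aᵢⱼ lᵢ)ⱼ`. -/
noncomputable def flux (A : Fin n → Fin n → ℝ) (l : EuclideanSpace ℝ (Fin n) →L[ℝ] ℝ) :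
    EuclideanSpace ℝ (Fin n) :=
  ∑ j, (∑ i, A i j * l (EuclideanSpace.single i 1)) • EuclideanSpace.single j (1:ℝ)

lemma apply_flux (A : Fin n → Fin n → ℝ) (l m : EuclideanSpace ℝ (Fin n) →L[ℝ] ℝ) :
    m (flux A l) = ∑ i, ∑ j, A i j * l (EuclideanSpace.single i 1) *
      m (EuclideanSpace.single j 1) := by
  unfold flux
  rw [map_sum, Finset.sum_comm]
  refine Finset.sum_congr rfl fun j _ => ?_
  rw [map_smul, smul_eq_mul, Finset.sum_mul]

lemma norm_grad {f : EuclideanSpace ℝ (Fin n) → ℝ} (x) : ‖gradient f x‖ = ‖fderiv ℝ f x‖ := by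
  unfold gradient
  rw [LinearIsometryEquiv.norm_map]

lemma norm_grad_sub {f g : EuclideanSpace ℝ (Fin n) → ℝ} (x) :
    ‖gradient f x - gradient g x‖ = ‖fderiv ℝ f x - fderiv ℝ g x‖ := by
  unfold gradient
  rw [← map_sub, LinearIsometryEquiv.norm_map]

lemma flux_ell {A : Fin n → Fin n → ℝ} {Λ : ℝ}
    (hA : ∀ ξ : EuclideanSpace ℝ (Fin n), Λ⁻¹ * ‖ξ‖ ^ 2 ≤ ∑ i, ∑ j, A i j * ξ i * ξ j)
    (l : EuclideanSpace ℝ (Fin n) →L[ℝ] ℝ) : Λ⁻¹ * ‖l‖ ^ 2 ≤ l (flux A l) := by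
  have h := hA ((InnerProductSpace.toDual ℝ (EuclideanSpace ℝ (Fin n))).symm l)
  rw [LinearIsometryEquiv.norm_map] at h
  have e : ∀ i, ((InnerProductSpace.toDual ℝ (EuclideanSpace ℝ (Fin n))).symm l) i
      = l (EuclideanSpace.single i 1) := by
    intro i
    have h1 := InnerProductSpace.toDual_symm_apply (𝕜 := ℝ)
      (x := EuclideanSpace.single i (1:ℝ)) (y := l)
    rw [← h1, EuclideanSpace.inner_single_right]
    simp
  simp only [e] at h
  rw [apply_flux]
  exact h

lemma flux_bound {A : Fin n → Fin n → ℝ} {c : ℝ} (hc : ∀ i j, |A i j| ≤ c)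
    (l : EuclideanSpace ℝ (Fin n) →L[ℝ] ℝ) : ‖flux A l‖ ≤ (n:ℝ) ^ 2 * c * ‖l‖ := by
  unfold flux
  have h1 : ∀ i, |l (EuclideanSpace.single i 1)| ≤ ‖l‖ := fun i => by
    simpa using l.le_opNorm (EuclideanSpace.single i (1:ℝ))
  calc _ ≤ ∑ j : Fin n, ‖(∑ i, A i j * l (EuclideanSpace.single i 1)) •
        EuclideanSpace.single j (1:ℝ)‖ := norm_sum_le _ _
    _ ≤ ∑ j : Fin n, ∑ i : Fin n, c * ‖l‖ := by
      refine Finset.sum_le_sum fun j _ => ?_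
      rw [norm_smul, PiLp.norm_single, norm_one, mul_one]
      refine (norm_sum_le _ _).trans (Finset.sum_le_sum fun i _ => ?_)
      rw [norm_mul]
      exact mul_le_mul (hc i j) (h1 i) (abs_nonneg _) ((abs_nonneg _).trans (hc i j))
    _ = _ := by simp; ring

lemma flux_decomp (A B : Fin n → Fin n → ℝ) (l m : EuclideanSpace ℝ (Fin n) →L[ℝ] ℝ) :
    flux A l - flux B m = flux B (l - m) + flux (fun i j => A i j - B i j) l := by
  unfold flux
  rw [← Finset.sum_sub_distrib, ← Finset.sum_add_distrib]
  refine Finset.sum_congr rfl fun j _ => ?_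
  rw [← sub_smul, ← add_smul]
  congr 1
  rw [← Finset.sum_sub_distrib, ← Finset.sum_add_distrib]
  refine Finset.sum_congr rfl fun i _ => ?_
  simp only [sub_apply]
  ring

lemma flux_continuousOn {U : Set (EuclideanSpace ℝ (Fin n))}
    {A : EuclideanSpace ℝ (Fin n) → Fin n → Fin n → ℝ}
    {l : EuclideanSpace ℝ (Fin n) → EuclideanSpace ℝ (Fin n) →L[ℝ] ℝ}
    (hA : ∀ i j, ContinuousOn (fun x => A x i j) U) (hl : ContinuousOn l U) :
    ContinuousOn (fun x => flux (A x) (l x)) U := by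
  unfold flux
  refine continuousOn_finsetSum _ fun j _ => ContinuousOn.fun_smul ?_ continuousOn_const
  exact continuousOn_finsetSum _ fun i _ => (hA i j).mul (hl.clm_apply continuousOn_const)

lemma weakEq_frozen {U : Set (EuclideanSpace ℝ (Fin n))} (hU : IsOpen U)
    {w : EuclideanSpace ℝ (Fin n) → ℝ} (hw : ContDiffOn ℝ 2 w U) (A : Fin n → Fin n → ℝ)
    (heq : ∀ x ∈ U, (∑ i : Fin n, ∑ j : Fin n, A i j *
      fderiv ℝ (fun y => fderiv ℝ w y (EuclideanSpace.single i 1)) x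
                    (EuclideanSpace.single j 1)) = 0) :
    WeakEq volume U (fun x => flux A (fderiv ℝ w x)) (fun _ => 0) := by
  have hd : ∀ i, ContDiffOn ℝ 1 (fun y => fderiv ℝ w y (EuclideanSpace.single i 1)) U := fun i =>
    (hw.fderiv_of_isOpen hU (m := 1) (by norm_num)).clm_apply contDiffOn_const
  let u : Fin n → EuclideanSpace ℝ (Fin n) → ℝ := fun j y =>
    ∑ i, A i j * fderiv ℝ w y (EuclideanSpace.single i 1)
  have hu : ∀ j, ContDiffOn ℝ 1 (u j) U := fun j =>
    ContDiffOn.sum fun i _ => contDiffOn_const.mul (hd i)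
  have hfu : ∀ j, ∀ x ∈ U, fderiv ℝ (u j) x (EuclideanSpace.single j 1) =
      ∑ i, A i j * fderiv ℝ (fun y => fderiv ℝ w y (EuclideanSpace.single i 1)) x
                    (EuclideanSpace.single j 1) := by
    intro j x hx
    have hdx : ∀ i, DifferentiableAt ℝ (fun y => fderiv ℝ w y (EuclideanSpace.single i 1)) x :=
      fun i => ((hd i).differentiableOn one_ne_zero).differentiableAt (hU.mem_nhds hx)
    have h : HasFDerivAt (u j) (∑ i, A i j •
        fderiv ℝ (fun y => fderiv ℝ w y (EuclideanSpace.single i 1)) x) x :=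
      HasFDerivAt.fun_sum fun i _ => (hdx i).hasFDerivAt.const_mul (A i j)
    rw [h.fderiv]
    simp
  have hs := WeakEq.finset_sum (μ := volume) hU (Finset.univ : Finset (Fin n))
    (X := fun j x => u j x • EuclideanSpace.single j (1:ℝ))
    (g := fun j x => - fderiv ℝ (u j) x (EuclideanSpace.single j 1))
    (fun j _ => (hu j).continuousOn.smul continuousOn_const)
    (fun j _ => (((hu j).continuousOn_fderiv_of_isOpen hU le_rfl).clm_apply continuousOn_const).neg)
    (fun j _ => weakEq_smul hU (hu j) _)
  intro ψ h1 h2 h3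
  have h4 := hs ψ h1 h2 h3
  refine h4.trans (setIntegral_congr_fun hU.measurableSet fun x hx => ?_)
  simp only
  congr 1
  rw [Finset.sum_neg_distrib, neg_eq_zero, ← heq x hx, Finset.sum_comm]
  exact Finset.sum_congr rfl fun j _ => hfu j x hx

end Helpers7

/-- **Comparison with the frozen-coefficient harmonic replacement**
(the estimate `(4.30)` in the proof of Theorem 4.3): there is a constant `C > 0`
depending only on `n`, `Λ` and `Λ₁` such that for every solution `φ`, every ball
`B_s(x₀) ⊆ B₁` with `s ∈ (0,1)`, and every `ŵ ∈ C²(B_s(x₀)) ∩ C⁰(cl B_s(x₀))` solving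
`Σ aᵢⱼ(x₀,φ(x₀)) ∂ᵢ∂ⱼŵ = 0` in `B_s(x₀)` with `ŵ = φ` on `∂B_s(x₀)` and
`∫_{B_s(x₀)} |∇ŵ|² < ∞`, one has, with `h = osc_{B_s(x₀)} φ`,
`∫_{B_s(x₀)} |∇(φ - ŵ)|² ≤ C (h + h² + s²) ∫_{B_s(x₀)} |∇φ|² + C e^{2κ} s^{n+2}`. -/
theorem frozen_coefficient_comparison (n : ℕ) (hn : 2 ≤ n) (Λ Λ₁ : ℝ)
    (hΛ : 1 ≤ Λ) (hΛ₁ : 0 < Λ₁) :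
    ∃ C > (0:ℝ),
      ∀ κ : ℝ, 1 ≤ κ →
      ∀ (a : Fin n → Fin n → EuclideanSpace ℝ (Fin n) → ℝ → ℝ)
        (ρ : EuclideanSpace ℝ (Fin n) → ℝ → ℝ)
        (f : EuclideanSpace ℝ (Fin n) → ℝ)
        (F : EuclideanSpace ℝ (Fin n) → ℝ → EuclideanSpace ℝ (Fin n) → ℝ),
        GoodCoeffs n Λ a ρ f F → C1Bound n Λ₁ a →
        ∀ φ : EuclideanSpace ℝ (Fin n) → ℝ, IsSolution n κ a ρ f F φ →
        ∀ (x₀ : EuclideanSpace ℝ (Fin n)) (s : ℝ), s ∈ Set.Ioo (0:ℝ) 1 →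
          ball x₀ s ⊆ ball (0 : EuclideanSpace ℝ (Fin n)) 1 →
          ∀ w : EuclideanSpace ℝ (Fin n) → ℝ,
            ContDiffOn ℝ 2 w (ball x₀ s) →
            ContinuousOn w (closedBall x₀ s) →
            (∀ x ∈ ball x₀ s,
              (∑ i : Fin n, ∑ j : Fin n,
                a i j x₀ (φ x₀) *
                  fderiv ℝ (fun y => fderiv ℝ w y (EuclideanSpace.single i 1)) x
                    (EuclideanSpace.single j 1)) = 0) →
            (∀ x ∈ sphere x₀ s, w x = φ x) →
            IntegrableOn (fun x => ‖gradient w x‖ ^ 2) (ball x₀ s) →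
            (∫ x in ball x₀ s, ‖gradient φ x - gradient w x‖ ^ 2)
              ≤ C * ((sSup (φ '' ball x₀ s) - sInf (φ '' ball x₀ s))
                      + (sSup (φ '' ball x₀ s) - sInf (φ '' ball x₀ s)) ^ 2 + s ^ 2) *
                  (∫ x in ball x₀ s, ‖gradient φ x‖ ^ 2)
                + C * Real.exp (2 * κ) * s ^ (n + 2) := by
  classical
  have hΛ0 : 0 < Λ := by linarith
  have hfr : Module.finrank ℝ (EuclideanSpace ℝ (Fin n)) = n := by simp
  have hdim : 2 ≤ Module.finrank ℝ (EuclideanSpace ℝ (Fin n)) := by rw [hfr]; exact hn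
  have hnt : Nontrivial (EuclideanSpace ℝ (Fin n)) :=
    Module.nontrivial_of_finrank_pos (R := ℝ) (by omega)
  let K : ℝ := (n:ℝ) ^ 2 * Λ₁
  have hK0 : 0 ≤ K := by positivity
  let C : ℝ := 4 * Λ + 4 * Λ ^ 2 * K ^ 2 +
    128 * Λ ^ 2 * (volume : Measure (EuclideanSpace ℝ (Fin n))).real (ball 0 1)
  have hC : 0 < C := by positivity
  refine ⟨C, hC, ?_⟩
  intro κ hκ a ρ f F hgood hC1 φ hsol x₀ s hs hsub w hw2 hwc hweq hwφ hwint
  obtain ⟨hac, -, hell, hρc, hρb, hfc, hfb, hFc, hFb⟩ := hgood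
  obtain ⟨haC1, haL⟩ := hC1
  obtain ⟨hφ1, hφb, hφw⟩ := hsol
  obtain ⟨hs0, hs1⟩ := hs
  have hU : IsOpen (ball x₀ s) := isOpen_ball
  have hx₀ : x₀ ∈ ball x₀ s := mem_ball_self hs0
  have hφB : ContDiffOn ℝ 1 φ (ball x₀ s) := hφ1.mono hsub
  have hwB : ContDiffOn ℝ 1 w (ball x₀ s) := hw2.of_le (by norm_num)
  have hφd : ContinuousOn (fderiv ℝ φ) (ball x₀ s) := hφB.continuousOn_fderiv_of_isOpen hU le_rfl
  have hφd1 : ContinuousOn (fderiv ℝ φ) (ball 0 1) :=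
    hφ1.continuousOn_fderiv_of_isOpen isOpen_ball le_rfl
  have hwd : ContinuousOn (fderiv ℝ w) (ball x₀ s) := hwB.continuousOn_fderiv_of_isOpen hU le_rfl
  simp only [norm_grad, norm_grad_sub] at hwint ⊢
  by_cases hφint : IntegrableOn (fun x => ‖fderiv ℝ φ x‖ ^ 2) (ball x₀ s)
  swap
  · have hn1 : ¬ IntegrableOn (fun x => ‖fderiv ℝ φ x - fderiv ℝ w x‖ ^ 2) (ball x₀ s) := by
      intro hI
      apply hφint
      refine ((hI.const_mul 2).add (hwint.const_mul 2)).mono'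
        ((hφd.norm.pow 2).aestronglyMeasurable hU.measurableSet) ?_
      refine Filter.Eventually.of_forall fun x => ?_
      rw [norm_pow, norm_norm]
      simp only [Pi.add_apply]
      have h1 : ‖fderiv ℝ φ x‖ ≤ ‖fderiv ℝ φ x - fderiv ℝ w x‖ + ‖fderiv ℝ w x‖ := by
        simpa using norm_add_le (fderiv ℝ φ x - fderiv ℝ w x) (fderiv ℝ w x)
      have h2 : ‖fderiv ℝ φ x‖ ^ 2 ≤
        (‖fderiv ℝ φ x - fderiv ℝ w x‖ + ‖fderiv ℝ w x‖) ^ 2 := by gcongr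
      nlinarith [sq_nonneg (‖fderiv ℝ φ x - fderiv ℝ w x‖ - ‖fderiv ℝ w x‖)]
    rw [integral_undef hn1, integral_undef hφint, mul_zero, zero_add]
    positivity
  set m := sSup (φ '' ball x₀ s) with hm
  set m' := sInf (φ '' ball x₀ s) with hm'
  have hba : BddAbove (φ '' ball x₀ s) := ⟨κ, by
    rintro _ ⟨x, hx, rfl⟩; exact (hφb x (hsub hx)).2⟩
  have hbb : BddBelow (φ '' ball x₀ s) := ⟨0, by
    rintro _ ⟨x, hx, rfl⟩; exact (hφb x (hsub hx)).1⟩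
  have hφm : ∀ x ∈ ball x₀ s, φ x ≤ m := fun x hx => le_csSup hba (mem_image_of_mem _ hx)
  have hφm' : ∀ x ∈ ball x₀ s, m' ≤ φ x := fun x hx => csInf_le hbb (mem_image_of_mem _ hx)
  set h := m - m' with hh
  have hh0 : 0 ≤ h := by
    have h1 := hφm x₀ hx₀
    have h2 := hφm' x₀ hx₀
    linarith
  -- the weak equations
  let A0 : Fin n → Fin n → ℝ := fun i j => a i j x₀ (φ x₀)
  let A : EuclideanSpace ℝ (Fin n) → Fin n → Fin n → ℝ := fun x i j => a i j x (φ x)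
  have hA0 : ∀ ξ : EuclideanSpace ℝ (Fin n), Λ⁻¹ * ‖ξ‖ ^ 2 ≤ ∑ i, ∑ j, A0 i j * ξ i * ξ j :=
    fun ξ => (hell x₀ (hsub hx₀) (φ x₀) ξ).1
  have hAc : ∀ i j, ContinuousOn (fun x => A x i j) (ball 0 1) := fun i j =>
    (hac i j).comp (f := fun x => (x, φ x)) (continuousOn_id.prodMk hφ1.continuousOn)
      (fun x hx => ⟨hx, mem_univ _⟩)
  let G : EuclideanSpace ℝ (Fin n) → ℝ := fun x =>
    ρ x (φ x) * (1 - (1/2) * f x * Real.exp (φ x) + F x (φ x) (gradient φ x))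
  have hgradc : ContinuousOn (gradient φ) (ball 0 1) :=
    (LinearIsometryEquiv.continuous _).comp_continuousOn hφd1
  have hGc : ContinuousOn G (ball 0 1) := by
    refine ContinuousOn.mul ?_ (ContinuousOn.add (continuousOn_const.sub
      ((continuousOn_const.mul hfc).mul (Real.continuous_exp.comp_continuousOn hφ1.continuousOn))) ?_)
    · exact hρc.comp (f := fun x => (x, φ x)) (continuousOn_id.prodMk hφ1.continuousOn)
        (fun x hx => ⟨hx, mem_univ _⟩)
    · exact hFc.comp (f := fun x => (x, φ x, gradient φ x))
        (continuousOn_id.prodMk (hφ1.continuousOn.prodMk hgradc))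
        (fun x hx => ⟨hx, mem_univ _⟩)
  have hXφc : ContinuousOn (fun x => flux (A x) (fderiv ℝ φ x)) (ball 0 1) :=
    flux_continuousOn hAc hφd1
  have hXwc : ContinuousOn (fun x => flux A0 (fderiv ℝ w x)) (ball x₀ s) :=
    flux_continuousOn (A := fun _ => A0) (fun i j => continuousOn_const) hwd
  have wφ1 : WeakEq volume (ball 0 1) (fun x => flux (A x) (fderiv ℝ φ x)) G := by
    refine weakEq_of_smooth isOpen_ball hXφc hGc ?_
    intro ψ h1 h2 h3
    simp only [apply_flux]
    exact hφw ψ h1 h2 h3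
  have wφ := wφ1.mono isOpen_ball hsub
  have ww : WeakEq volume (ball x₀ s) (fun x => flux A0 (fderiv ℝ w x)) (fun _ => 0) :=
    weakEq_frozen hU hw2 A0 hweq
  have wX := WeakEq.sub hU (hXφc.mono hsub) (hGc.mono hsub) hXwc continuousOn_const wφ ww
  simp only [sub_zero] at wX
  -- boundary values
  obtain ⟨p, hp⟩ := exists_touch hs0 hs1 hsub
  have hcl : closure (ball x₀ s) \ ball x₀ s = sphere x₀ s := by
    rw [closure_ball x₀ hs0.ne', closedBall_sdiff_ball]
  have hwlim : ∀ q ∈ sphere x₀ s,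
      Filter.Tendsto w (nhdsWithin q (ball x₀ s)) (nhds (w q)) := fun q hq =>
    (hwc q (sphere_subset_closedBall hq)).mono_left (nhdsWithin_mono _ ball_subset_closedBall)
  have hwm : ∀ x ∈ ball x₀ s, w x ≤ m := by
    refine weak_max (μ := volume) hU isBounded_ball hXwc hwB ww ?_ ?_ ?_
    · intro x hx
      exact le_trans (by positivity) (flux_ell hA0 (fderiv ℝ w x))
    · intro x hx h0
      have h1 := flux_ell hA0 (fderiv ℝ w x)
      rw [h0] at h1
      have h2 : ‖fderiv ℝ w x‖ ^ 2 ≤ 0 := by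
        by_contra! h3
        have : 0 < Λ⁻¹ * ‖fderiv ℝ w x‖ ^ 2 := by positivity
        linarith
      exact norm_eq_zero.1 (pow_eq_zero_iff (two_ne_zero) |>.1 (le_antisymm h2 (by positivity)))
    · intro q hq
      rw [hcl] at hq
      exact ⟨w q, sphere_le hdim hs0 hp hφ1.continuousOn hwc hwφ hφm q hq, hwlim q hq⟩
  have hwm' : ∀ x ∈ ball x₀ s, m' ≤ w x := by
    have hneg : ∀ x, fderiv ℝ (fun y => - w y) x = - fderiv ℝ w x := fun x => fderiv_fun_neg
    have hfn : ∀ l : EuclideanSpace ℝ (Fin n) →L[ℝ] ℝ, (-l) (- flux A0 l) = l (flux A0 l) := by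
      intro l
      simp
    have wn : WeakEq volume (ball x₀ s) (fun x => - flux A0 (fderiv ℝ w x)) (fun _ => 0) := by
      intro ψ h1 h2 h3
      have h4 := ww ψ h1 h2 h3
      simp only [map_neg, integral_neg, zero_mul, integral_zero] at h4 ⊢
      rw [h4, neg_zero]
    have := weak_max (μ := volume) (X := fun x => - flux A0 (fderiv ℝ w x))
      (w := fun y => - w y) (m := -m') hU isBounded_ball hXwc.neg
      hwB.neg wn ?_ ?_ ?_
    · intro x hx
      have := this x hx
      linarith
    · intro x hx
      rw [hneg, hfn]
      exact le_trans (by positivity) (flux_ell hA0 (fderiv ℝ w x))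
    · intro x hx h0
      rw [hneg, hfn] at h0
      rw [hneg]
      have h1 := flux_ell hA0 (fderiv ℝ w x)
      rw [h0] at h1
      have h2 : ‖fderiv ℝ w x‖ ^ 2 ≤ 0 := by
        by_contra! h3
        have : 0 < Λ⁻¹ * ‖fderiv ℝ w x‖ ^ 2 := by positivity
        linarith
      rw [norm_eq_zero.1 (pow_eq_zero_iff (two_ne_zero) |>.1 (le_antisymm h2 (by positivity))),
        neg_zero]
    · intro q hq
      rw [hcl] at hq
      refine ⟨- w q, ?_, (hwlim q hq).neg⟩
      exact sphere_le (φ := fun y => - φ y) (w := fun y => - w y) hdim hs0 hp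
        hφ1.continuousOn.neg hwc.neg (fun x hx => by rw [hwφ x hx])
        (fun x hx => neg_le_neg (hφm' x hx)) q hq
  -- the difference
  let v : EuclideanSpace ℝ (Fin n) → ℝ := fun x => φ x - w x
  have hv : ContDiffOn ℝ 1 v (ball x₀ s) := hφB.sub hwB
  have hvf : ∀ x ∈ ball x₀ s, fderiv ℝ v x = fderiv ℝ φ x - fderiv ℝ w x := fun x hx =>
    fderiv_fun_sub ((hφB.differentiableOn one_ne_zero).differentiableAt (hU.mem_nhds hx))
      ((hwB.differentiableOn one_ne_zero).differentiableAt (hU.mem_nhds hx))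
  have hvM : ∀ x ∈ ball x₀ s, |v x| ≤ h := by
    intro x hx
    have h1 := hφm x hx
    have h2 := hφm' x hx
    have h3 := hwm x hx
    have h4 := hwm' x hx
    simp only [v, abs_le]
    constructor <;> linarith
  have hv2 : IntegrableOn (fun x => ‖fderiv ℝ v x‖ ^ 2) (ball x₀ s) := by
    refine ((hφint.const_mul 2).add (hwint.const_mul 2)).mono'
      (((hv.continuousOn_fderiv_of_isOpen hU le_rfl).norm.pow 2).aestronglyMeasurable
        hU.measurableSet) ?_
    filter_upwards [ae_restrict_mem hU.measurableSet] with x hx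
    rw [norm_pow, norm_norm, hvf x hx]
    simp only [Pi.add_apply]
    have h1 := norm_sub_le (fderiv ℝ φ x) (fderiv ℝ w x)
    have h2 : ‖fderiv ℝ φ x - fderiv ℝ w x‖ ^ 2 ≤ (‖fderiv ℝ φ x‖ + ‖fderiv ℝ w x‖) ^ 2 := by
      gcongr
    nlinarith [sq_nonneg (‖fderiv ℝ φ x‖ - ‖fderiv ℝ w x‖)]
  have hlim : ∀ q ∈ closure (ball x₀ s) \ ball x₀ s, q ≠ p →
      Filter.Tendsto v (nhdsWithin q (ball x₀ s)) (nhds 0) := by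
    intro q hq hqp
    rw [hcl] at hq
    have h1 : Filter.Tendsto φ (nhdsWithin q (ball x₀ s)) (nhds (φ q)) :=
      (hφ1.continuousOn.continuousAt (isOpen_ball.mem_nhds (hp q hq hqp))).mono_left
        nhdsWithin_le_nhds
    have h2 := h1.sub (hwlim q hq)
    rwa [hwφ q hq, sub_self] at h2
  -- coefficient difference
  have hAd : ∀ x ∈ ball x₀ s, ∀ i j, |A x i j - A0 i j| ≤ Λ₁ * (s + h) := by
    intro x hx i j
    refine (coeff_lip (haC1 i j) (haL i j) (hsub hx₀) (hsub hx) (φ x₀) (φ x)).trans ?_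
    gcongr
    · rw [← dist_eq_norm]; exact (mem_ball.1 hx).le
    · rw [abs_le]
      have h1 := hφm x hx
      have h2 := hφm' x hx
      have h3 := hφm x₀ hx₀
      have h4 := hφm' x₀ hx₀
      constructor <;> linarith
  let c0 : ℝ := ∑ i, ∑ j, |A0 i j|
  have hc0 : ∀ i j, |A0 i j| ≤ c0 := fun i j =>
    (Finset.single_le_sum (f := fun j => |A0 i j|) (fun j _ => abs_nonneg _)
      (Finset.mem_univ j)).trans
    (Finset.single_le_sum (f := fun i => ∑ j, |A0 i j|)
      (fun i _ => Finset.sum_nonneg fun j _ => abs_nonneg _) (Finset.mem_univ i))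
  have hc00 : 0 ≤ c0 := Finset.sum_nonneg fun i _ => Finset.sum_nonneg fun j _ => abs_nonneg _
  have hexp : 1 ≤ Real.exp κ := Real.one_le_exp (by linarith)
  have main := energy_estimate (μ := (volume : Measure (EuclideanSpace ℝ (Fin n)))) (v := v)
    (P := fun x => ‖fderiv ℝ φ x‖) (g := G)
    (X := fun x => flux (A x) (fderiv ℝ φ x) - flux A0 (fderiv ℝ w x)) (h := h)
    (Λ := Λ) (K := K) (D := Real.exp κ)
    (c := (n:ℝ) ^ 2 * c0 + (n:ℝ) ^ 2 * (Λ₁ * (s + h)))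
    hs0 hdim p hΛ hK0 hexp hv hvM hv2 hlim (fun x => norm_nonneg _) hφint
    ((hXφc.mono hsub).sub hXwc) (hGc.mono hsub) ?_ ?_ wX ?_
  · have e1 : ∫ x in ball x₀ s, ‖fderiv ℝ φ x - fderiv ℝ w x‖ ^ 2 =
        ∫ x in ball x₀ s, ‖fderiv ℝ v x‖ ^ 2 :=
      setIntegral_congr_fun hU.measurableSet fun x hx => by
        rw [hvf x hx]
    have e2 : Real.exp (2 * κ) = Real.exp κ ^ 2 := by
      rw [← Real.exp_nat_mul]; norm_num
    rw [hfr] at main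
    rw [e1, e2]
    exact main
  · intro x hx
    rw [flux_decomp, ← hvf x hx]
    refine (norm_add_le _ _).trans ?_
    have h1 := flux_bound hc0 (fderiv ℝ v x)
    have h2 := flux_bound (hAd x hx) (fderiv ℝ φ x)
    have h3 : 0 ≤ (n:ℝ) ^ 2 * c0 * ‖fderiv ℝ φ x‖ := by positivity
    have h4 : 0 ≤ (n:ℝ) ^ 2 * (Λ₁ * (s + h)) * ‖fderiv ℝ v x‖ := by positivity
    linarith
  · intro x hx
    have hx1 := hsub hx
    have h1 := hρb x hx1 (φ x)
    have h2 := hfb x hx1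
    have h3 := hFb x hx1 (φ x) (gradient φ x)
    rw [norm_grad] at h3
    have h4 : Real.exp (φ x) ≤ Real.exp κ := Real.exp_le_exp.2 (hφb x hx1).2
    have h5 := Real.exp_pos (φ x)
    have h6 : 0 ≤ f x * Real.exp (φ x) := mul_nonneg h2.1 h5.le
    have h7 : f x * Real.exp (φ x) ≤ Real.exp κ := by nlinarith
    have h8 : 1 + 1 ≤ Real.exp κ := by
      have := Real.add_one_le_exp κ
      linarith
    simp only [G]
    rw [abs_mul, abs_of_nonneg (by linarith : 0 ≤ ρ x (φ x))]
    have h9 : |1 - (1/2) * f x * Real.exp (φ x) + F x (φ x) (gradient φ x)| ≤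
        2 * Real.exp κ + ‖fderiv ℝ φ x‖ ^ 2 := by
      rw [abs_le] at h3 ⊢
      constructor <;> nlinarith
    have h10 := mul_le_mul h1.2 h9 (abs_nonneg _) (by norm_num)
    linarith
  · intro x hx
    rw [flux_decomp, ← hvf x hx, map_add]
    have h1 := flux_ell hA0 (fderiv ℝ v x)
    have h2 := flux_bound (hAd x hx) (fderiv ℝ φ x)
    have h3 := (fderiv ℝ v x).le_opNorm (flux (fun i j => A x i j - A0 i j) (fderiv ℝ φ x))
    rw [Real.norm_eq_abs] at h3
    have h4 := (abs_le.1 h3).1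
    have h5 := mul_le_mul_of_nonneg_left h2 (norm_nonneg (fderiv ℝ v x))
    have h6 : K * (s + h) * ‖fderiv ℝ φ x‖ * ‖fderiv ℝ v x‖ =
      ‖fderiv ℝ v x‖ * ((n:ℝ) ^ 2 * (Λ₁ * (s + h)) * ‖fderiv ℝ φ x‖) := by
      simp only [K]; ring
    linarith
end

section
/- Let n ≥ 1 be an integer and μ ∈ (0, 1/n). Set ν = μ · 2^{1 + 2μ − nμ} and β = 2(2 + μ)/(1 + nμ). Then there exists ε₀ ∈ (0,1), depending only on n and μ, such that for every ε ∈ (0, ε₀), setting δ = ε^β, for every d ∈ [0, ε]: 2μ (2 + δ)^{1 − μ(n−1)} δ^{1 + nμ} / (δ + d²/2)^{2+μ} > ν. -/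
open Real

/-- **The multi-valley lower bound** (from the proof of Theorem 7.4 /
`prop-anisotropic-supersolution-phi-multi`): for `n ≥ 1`, `μ ∈ (0, 1/n)`,
`ν = μ 2^{1 + 2μ - nμ}` and `β = 2(2 + μ)/(1 + nμ)`, there is an `ε₀ ∈ (0,1)` depending
only on `n` and `μ` such that for all `ε ∈ (0, ε₀)`, setting `δ = ε^β`, for every
`d ∈ [0, ε]`, `2μ (2 + δ)^{1 - μ(n-1)} δ^{1 + nμ} / (δ + d²/2)^{2+μ} > ν`. -/
theorem multi_valley_lower_bound (n : ℕ) (hn : 1 ≤ n) (μ : ℝ)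
    (hμ0 : 0 < μ) (hμn : μ < 1 / (n : ℝ)) (ν β : ℝ)
    (hν : ν = μ * (2:ℝ) ^ (1 + 2 * μ - (n : ℝ) * μ))
    (hβ : β = 2 * (2 + μ) / (1 + (n : ℝ) * μ)) :
    ∃ ε₀ ∈ Set.Ioo (0:ℝ) 1, ∀ ε ∈ Set.Ioo (0:ℝ) ε₀, ∀ δ : ℝ, δ = ε ^ β →
      ∀ d ∈ Set.Icc (0:ℝ) ε,
        ν < 2 * μ * (2 + δ) ^ (1 - μ * ((n : ℝ) - 1)) * δ ^ (1 + (n : ℝ) * μ) /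
              (δ + d ^ 2 / 2) ^ (2 + μ) := by
  have hn1 : (1:ℝ) ≤ n := by exact_mod_cast hn
  have hnμ : μ * n < 1 := by rwa [lt_div_iff₀ (by linarith)] at hμn
  have hμ1 : μ < 1 := by nlinarith
  have hpos : 0 < 1 + (n:ℝ) * μ := by positivity
  have hβ2 : 0 < β - 2 := by
    rw [hβ, sub_pos, lt_div_iff₀ hpos]; nlinarith
  refine ⟨(1/2:ℝ) ^ (1 / (β - 2)), ⟨by positivity,
    Real.rpow_lt_one (by norm_num) (by norm_num) (by positivity)⟩, ?_⟩
  rintro ε ⟨hε0, hε⟩ δ hδ d ⟨hd0, hd⟩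
  have hδ0 : 0 < δ := by rw [hδ]; positivity
  have h1 : ε ^ (β - 2) ≤ 1 / 2 := by
    have h := Real.rpow_le_rpow hε0.le hε.le hβ2.le
    rwa [← Real.rpow_mul (by norm_num), one_div_mul_cancel hβ2.ne', Real.rpow_one] at h
  have h2 : δ ≤ ε ^ 2 / 2 := by
    have h : δ = ε ^ (β - 2) * ε ^ 2 := by
      rw [hδ, ← Real.rpow_natCast ε 2, ← Real.rpow_add hε0]
      norm_num
    rw [h]
    nlinarith [sq_nonneg ε]
  have h3 : δ ^ (1 + (n:ℝ) * μ) = (ε ^ 2) ^ (2 + μ) := by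
    rw [hδ, ← Real.rpow_mul hε0.le, ← Real.rpow_natCast ε 2, ← Real.rpow_mul hε0.le, hβ,
      div_mul_cancel₀ _ hpos.ne']
    norm_num
  have h4 : (δ + d ^ 2 / 2) ^ (2 + μ) ≤ δ ^ (1 + (n:ℝ) * μ) := by
    rw [h3]
    exact Real.rpow_le_rpow (by positivity) (by nlinarith) (by linarith)
  have h5 : (2:ℝ) ^ (1 - μ * ((n:ℝ) - 1)) ≤ (2 + δ) ^ (1 - μ * ((n:ℝ) - 1)) :=
    Real.rpow_le_rpow (by norm_num) (by linarith) (by nlinarith)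
  have h6 : (2:ℝ) ^ (1 + 2 * μ - (n:ℝ) * μ) < 2 * (2:ℝ) ^ (1 - μ * ((n:ℝ) - 1)) := by
    have h : 2 * (2:ℝ) ^ (1 - μ * ((n:ℝ) - 1)) = (2:ℝ) ^ (1 + (1 - μ * ((n:ℝ) - 1))) := by
      rw [Real.rpow_add (by norm_num), Real.rpow_one]
    rw [h]
    exact Real.rpow_lt_rpow_of_exponent_lt (by norm_num) (by nlinarith)
  have h7 : ν < 2 * μ * (2 + δ) ^ (1 - μ * ((n : ℝ) - 1)) := by
    rw [hν]; nlinarith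
  have h8 : 0 < ν := by rw [hν]; positivity
  rw [lt_div_iff₀ (by positivity)]
  calc ν * (δ + d ^ 2 / 2) ^ (2 + μ) ≤ ν * δ ^ (1 + (n:ℝ) * μ) :=
        mul_le_mul_of_nonneg_left h4 h8.le
    _ < _ := mul_lt_mul_of_pos_right h7 (by positivity)
end
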